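/- arXiv:2211.16075 — 2 statements merged into one kernel-verified Lean document; each statement's English description precedes it below -/
import Mathlib

section
/- Rigidity for odd-in-time non-radiative linear waves around a soliton: let R ≥ 0 and let u be a radial finite-energy solution of ∂_t²u − Δu + Vu = 0 on ℝ × ℝ⁶ such that lim_{t→+∞} ∫_{|x|>R+|t|} |∇_{t,x}u(t,x)|² dx = 0 and lim_{t→−∞} ∫_{|x|>R+|t|} |∇_{t,x}u(t,x)|² dx = 0. Then there exists c ∈ ℝ such that ∂_t u(0,x) = c ΛW(x) for all |x| ≥ R. -/
open MeasureTheory Real Filter Set Topology ENNReal RealInnerProductSpace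

noncomputable section

abbrev E6 := EuclideanSpace ℝ (Fin 6)

/-- The ground state `W(x) = (1+|x|²/24)⁻²` on `ℝ⁶`. -/
def W6 (x : E6) : ℝ := ((1 + ‖x‖ ^ 2 / 24) ^ 2)⁻¹

/-- The potential `V = -2W` of the linearized equation. -/
def V6 (x : E6) : ℝ := -2 * W6 x

/-- `ΛW(x) = x·∇W(x) + 2W(x)`. -/
def LW6 (x : E6) : ℝ := fderiv ℝ W6 x x + 2 * W6 x

/-- The Laplacian of `f : ℝ⁶ → ℝ`. -/
def lap6 (f : E6 → ℝ) (x : E6) : ℝ :=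
  ∑ i : Fin 6, fderiv ℝ (fun y => fderiv ℝ f y (EuclideanSpace.single i 1)) x
    (EuclideanSpace.single i 1)

/-- `∂ₜ u`. -/
def dtu (u : ℝ → E6 → ℝ) (t : ℝ) (x : E6) : ℝ := deriv (fun s => u s x) t

/-- `∂ₜ² u`. -/
def dttu (u : ℝ → E6 → ℝ) (t : ℝ) (x : E6) : ℝ := deriv (fun s => dtu u s x) t

/-- `|∇_{t,x} u|² = (∂ₜ u)² + |∇u|²`. -/
def eDensity (u : ℝ → E6 → ℝ) (t : ℝ) (x : E6) : ℝ :=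
  dtu u t x ^ 2 + ‖gradient (u t) x‖ ^ 2

/-- `u` is a radial finite-energy solution of `∂ₜ²u - Δu + P·u = 0` on `ℝ × ℝ⁶`. -/
def IsRadSolOf (P : E6 → ℝ) (u : ℝ → E6 → ℝ) : Prop :=
  ContDiff ℝ 2 (fun p : ℝ × E6 => u p.1 p.2) ∧
  (∀ t x y, ‖x‖ = ‖y‖ → u t x = u t y) ∧
  (∀ t x, dttu u t x - lap6 (u t) x + P x * u t x = 0) ∧
  Integrable (fun x => eDensity u 0 x)

lemma HasDerivAt.of_eq {f g : ℝ → ℝ} {f' g' x : ℝ} (h : HasDerivAt f f' x)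
    (hf : ∀ y, g y = f y) (hf' : g' = f') : HasDerivAt g g' x := by
  rw [hf', show g = f from funext hf]
  exact h

/-- A function whose derivative is dominated by that of `g` varies less than `g`. -/
lemma abs_sub_le_of_abs_deriv_le {f f' g g' : ℝ → ℝ} {a b : ℝ} (hab : a ≤ b)
    (hf : ∀ x ∈ Icc a b, HasDerivAt f (f' x) x) (hg : ∀ x ∈ Icc a b, HasDerivAt g (g' x) x)
    (h : ∀ x ∈ Icc a b, |f' x| ≤ g' x) : |f b - f a| ≤ g b - g a := by
  have key : ∀ F F' : ℝ → ℝ, (∀ x ∈ Icc a b, HasDerivAt F (F' x) x) →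
      (∀ x ∈ Icc a b, 0 ≤ F' x) → F a ≤ F b := by
    intro F F' hF hF'
    have hm : MonotoneOn F (Icc a b) := by
      refine monotoneOn_of_deriv_nonneg (convex_Icc a b)
        (fun x hx => (hF x hx).continuousAt.continuousWithinAt) ?_ ?_
      · intro x hx
        exact (hF x (interior_subset hx)).differentiableAt.differentiableWithinAt
      · intro x hx
        rw [(hF x (interior_subset hx)).deriv]
        exact hF' x (interior_subset hx)
    exact hm (left_mem_Icc.2 hab) (right_mem_Icc.2 hab) hab
  have h1 := key (fun x => g x - f x) (fun x => g' x - f' x)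
    (fun x hx => (hg x hx).sub (hf x hx)) (fun x hx => by linarith [le_abs_self (f' x), h x hx])
  have h2 := key (fun x => g x + f x) (fun x => g' x + f' x)
    (fun x hx => (hg x hx).add (hf x hx)) (fun x hx => by linarith [neg_abs_le (f' x), h x hx])
  rw [abs_le]
  constructor <;> linarith

/-- A function vanishing at infinity is dominated by any comparison function vanishing at infinity
whose derivative dominates. -/
lemma abs_le_of_abs_deriv_le_of_tendsto {f f' g g' : ℝ → ℝ} {a : ℝ}
    (hf : ∀ x ∈ Ici a, HasDerivAt f (f' x) x) (hg : ∀ x ∈ Ici a, HasDerivAt g (-g' x) x)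
    (h : ∀ x ∈ Ici a, |f' x| ≤ g' x) (hf0 : Tendsto f atTop (𝓝 0)) (hg0 : Tendsto g atTop (𝓝 0)) :
    |f a| ≤ g a := by
  have h1 : ∀ᶠ b in atTop, |f b - f a| ≤ g a - g b := by
    filter_upwards [eventually_ge_atTop a] with b hb
    have := abs_sub_le_of_abs_deriv_le (g := fun x => -g x) (g' := g') hb
      (fun x hx => hf x hx.1) (fun x hx => (hg x hx.1).neg.of_eq (fun _ => rfl) (by simp))
      (fun x hx => h x hx.1)
    linarith
  have h2 : Tendsto (fun b => |f b - f a|) atTop (𝓝 |0 - f a|) := (hf0.sub_const _).abs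
  have h3 : Tendsto (fun b => g a - g b) atTop (𝓝 (g a - 0)) := hg0.const_sub _
  simpa using le_of_tendsto_of_tendsto h2 h3 h1

lemma hasDerivAt_sqrt_div_pow (n : ℕ) {r : ℝ} (hr : 0 < r) :
    HasDerivAt (fun r : ℝ => √r / r ^ n) ((1 / 2 - n) * (√r / r ^ (n + 1))) r := by
  have h := (Real.hasDerivAt_sqrt hr.ne').div (hasDerivAt_pow n r) (pow_ne_zero n hr.ne')
  refine h.of_eq (fun _ => rfl) ?_
  have hs : 0 < √r := Real.sqrt_pos.2 hr
  have hs2 : √r ^ 2 = r := Real.sq_sqrt hr.le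
  rcases n with _ | n
  · simp
    field_simp
    linarith
  · simp only [Nat.add_sub_cancel]
    field_simp
    rw [hs2]
    push_cast
    ring

lemma tendsto_sqrt_div_pow (n : ℕ) : Tendsto (fun r : ℝ => √r / r ^ (n + 1)) atTop (𝓝 0) := by
  have h1 : Tendsto (fun r : ℝ => (√r)⁻¹) atTop (𝓝 0) :=
    tendsto_inv_atTop_zero.comp tendsto_sqrt_atTop
  refine squeeze_zero' ?_ ?_ h1
  · filter_upwards [eventually_gt_atTop 0] with r hr
    positivity
  · filter_upwards [eventually_ge_atTop 1] with r hr
    have hs : 0 < √r := Real.sqrt_pos.2 (by linarith)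
    have hr0 : 0 < r := by linarith
    rw [div_le_iff₀ (by positivity), inv_mul_eq_div, le_div_iff₀ hs, Real.mul_self_sqrt hr0.le]
    calc r = r ^ 1 := by ring
      _ ≤ r ^ (n + 1) := pow_le_pow_right₀ hr (by omega)

lemma tendsto_mean_left (y : ℝ) : Tendsto (fun x : ℝ => (x + y) / 2) atTop atTop :=
  (tendsto_atTop_add_const_right _ y tendsto_id).atTop_div_const (by norm_num)

lemma hasDerivAt_mean_left (x y : ℝ) : HasDerivAt (fun x : ℝ => (x + y) / 2) (1 / 2) x := by
  simpa using ((hasDerivAt_id x).add_const y).div_const 2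

lemma hasDerivAt_mean_right (x y : ℝ) : HasDerivAt (fun y : ℝ => (x + y) / 2) (1 / 2) y := by
  simpa using ((hasDerivAt_id y).const_add x).div_const 2

/-- `w` solves `∂ₓ∂ᵧ w = g` for `x, y > ρ` in null coordinates, with `a = ∂ₓ w` and `b = ∂ᵧ w`. -/
structure NullSol (ρ : ℝ) (w a b g : ℝ → ℝ → ℝ) : Prop where
  dx : ∀ x y, ρ < x → ρ < y → HasDerivAt (fun x => w x y) (a x y) x
  dy : ∀ x y, ρ < x → ρ < y → HasDerivAt (fun y => w x y) (b x y) y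
  bx : ∀ x y, ρ < x → ρ < y → HasDerivAt (fun x => b x y) (g x y) x
  ay : ∀ x y, ρ < x → ρ < y → HasDerivAt (fun y => a x y) (g x y) y
  dt : ∀ x y, ρ < x → ρ < y → HasDerivAt (fun s => w (x + s) (y - s)) (a x y - b x y) 0

namespace NullSol

variable {ρ : ℝ} {w a b g : ℝ → ℝ → ℝ}

lemma mono {ρ' : ℝ} (h : NullSol ρ w a b g) (hρ : ρ ≤ ρ') : NullSol ρ' w a b g where
  dx x y hx hy := h.dx x y (by linarith) (by linarith)
  dy x y hx hy := h.dy x y (by linarith) (by linarith)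
  bx x y hx hy := h.bx x y (by linarith) (by linarith)
  ay x y hx hy := h.ay x y (by linarith) (by linarith)
  dt x y hx hy := h.dt x y (by linarith) (by linarith)

lemma swap (h : NullSol ρ w a b g) :
    NullSol ρ (fun x y => w y x) (fun x y => b y x) (fun x y => a y x) (fun x y => g y x) where
  dx x y hx hy := h.dy y x hy hx
  dy x y hx hy := h.dx y x hy hx
  bx x y hx hy := h.ay y x hy hx
  ay x y hx hy := h.bx y x hy hx
  dt x y hx hy := by
    have h1 : HasDerivAt (fun s : ℝ => w (y + s) (x - s)) (a y x - b y x) (-0) := by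
      simpa using h.dt y x hy hx
    have h2 := h1.scomp (0 : ℝ) (hasDerivAt_neg (0 : ℝ))
    exact h2.of_eq (fun s => by simp [sub_eq_add_neg]) (by simp)

lemma sub {w' a' b' g' : ℝ → ℝ → ℝ} (h : NullSol ρ w a b g) (h' : NullSol ρ w' a' b' g') :
    NullSol ρ (fun x y => w x y - w' x y) (fun x y => a x y - a' x y)
      (fun x y => b x y - b' x y) (fun x y => g x y - g' x y) where
  dx x y hx hy := (h.dx x y hx hy).sub (h'.dx x y hx hy)
  dy x y hx hy := (h.dy x y hx hy).sub (h'.dy x y hx hy)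
  bx x y hx hy := (h.bx x y hx hy).sub (h'.bx x y hx hy)
  ay x y hx hy := (h.ay x y hx hy).sub (h'.ay x y hx hy)
  dt x y hx hy := by
    exact ((h.dt x y hx hy).sub (h'.dt x y hx hy)).of_eq (fun _ => rfl) (by ring)

lemma shift (h : NullSol ρ w a b g) (s : ℝ) :
    NullSol (ρ + |s|) (fun x y => w (x + s) (y - s)) (fun x y => a (x + s) (y - s))
      (fun x y => b (x + s) (y - s)) (fun x y => g (x + s) (y - s)) where
  dx x y hx hy := (h.dx (x + s) (y - s) (by linarith [neg_abs_le s])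
    (by linarith [le_abs_self s])).comp_add_const x s
  dy x y hx hy := (h.dy (x + s) (y - s) (by linarith [neg_abs_le s])
    (by linarith [le_abs_self s])).comp_sub_const y s
  bx x y hx hy := (h.bx (x + s) (y - s) (by linarith [neg_abs_le s])
    (by linarith [le_abs_self s])).comp_add_const x s
  ay x y hx hy := (h.ay (x + s) (y - s) (by linarith [neg_abs_le s])
    (by linarith [le_abs_self s])).comp_sub_const y s
  dt x y hx hy := by
    refine (h.dt (x + s) (y - s) (by linarith [neg_abs_le s])
      (by linarith [le_abs_self s])).of_eq (fun σ => ?_) rfl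
    congr 1 <;> ring

lemma dt_at (h : NullSol ρ w a b g) {x y s : ℝ} (hx : ρ < x + s) (hy : ρ < y - s) :
    HasDerivAt (fun s => w (x + s) (y - s)) (a (x + s) (y - s) - b (x + s) (y - s)) s := by
  have h1 : HasDerivAt (fun σ => w (x + s + σ) (y - s - σ))
      (a (x + s) (y - s) - b (x + s) (y - s)) (s - s) := by
    simpa using h.dt _ _ hx hy
  refine (h1.comp_sub_const s s).of_eq (fun σ => ?_) rfl
  congr 1 <;> ring

lemma abs_b_le (h : NullSol ρ w a b g) (hρ : 0 ≤ ρ) {C : ℝ} {n : ℕ}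
    (hg : ∀ x y, ρ < x → ρ < y → |g x y| ≤ C * (√((x + y) / 2) / ((x + y) / 2) ^ (n + 2)))
    (hb : ∀ y, ρ < y → Tendsto (fun x => b x y) atTop (𝓝 0)) {x y : ℝ} (hx : ρ < x) (hy : ρ < y) :
    |b x y| ≤ 4 * C * (√((x + y) / 2) / ((x + y) / 2) ^ (n + 1)) := by
  refine abs_le_of_abs_deriv_le_of_tendsto (f := fun x => b x y)
    (g := fun x => 4 * C * (√((x + y) / 2) / ((x + y) / 2) ^ (n + 1)))
    (g' := fun x => (2 * n + 1) * (C * (√((x + y) / 2) / ((x + y) / 2) ^ (n + 2))))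
    (fun z hz => h.bx z y (hx.trans_le hz) hy) ?_ ?_ (hb y hy) ?_
  · intro z hz
    have hz' : ρ < z := hx.trans_le hz
    have h1 := ((hasDerivAt_sqrt_div_pow (n + 1) (r := (z + y) / 2) (by linarith)).comp z
      (hasDerivAt_mean_left z y)).const_mul (4 * C)
    refine h1.of_eq (fun _ => rfl) ?_
    push_cast
    ring
  · intro z hz
    have hz' : ρ < z := hx.trans_le hz
    have h1 := hg z y hz' hy
    have h2 : 0 ≤ C * (√((z + y) / 2) / ((z + y) / 2) ^ (n + 2)) := (abs_nonneg _).trans h1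
    have h3 : (0 : ℝ) ≤ n := Nat.cast_nonneg n
    nlinarith
  · simpa using ((tendsto_sqrt_div_pow n).comp (tendsto_mean_left y)).const_mul (4 * C)

end NullSol

/-- Solutions of `∂ₓ∂ᵧ w = K w` in null coordinates, radiating neither to the future nor to the
past, and bounded by `r ^ (1/2 - n)`. -/
structure NonRad (K : ℝ → ℝ) (n : ℕ) (ρ : ℝ) (w a b : ℝ → ℝ → ℝ) : Prop where
  sol : NullSol ρ w a b (fun x y => K ((x + y) / 2) * w x y)
  lim_b : ∀ y, ρ < y → Tendsto (fun x => b x y) atTop (𝓝 0)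
  lim_a : ∀ x, ρ < x → Tendsto (fun y => a x y) atTop (𝓝 0)
  bound : ∃ C, ∀ x y, ρ < x → ρ < y → |w x y| ≤ C * (√((x + y) / 2) / ((x + y) / 2) ^ n)

/-- The symmetric time difference of step `s`, in null coordinates. -/
def timeDiff (s : ℝ) (w : ℝ → ℝ → ℝ) (x y : ℝ) : ℝ := w (x + s) (y - s) - w (x - s) (y + s)

namespace NonRad

variable {K : ℝ → ℝ} {n : ℕ} {ρ : ℝ} {w a b : ℝ → ℝ → ℝ}

lemma deriv_bound (h : NonRad K n ρ w a b) (hρ : 0 ≤ ρ)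
    (hK : ∀ r, 0 < r → |K r| ≤ 33 / 16 / r ^ 2) :
    ∃ C, 0 ≤ C ∧ ∀ x y, ρ < x → ρ < y →
      |a x y| ≤ C * (√((x + y) / 2) / ((x + y) / 2) ^ (n + 1)) ∧
      |b x y| ≤ C * (√((x + y) / 2) / ((x + y) / 2) ^ (n + 1)) := by
  obtain ⟨C, hC⟩ := h.bound
  have hg : ∀ x y, ρ < x → ρ < y → |K ((x + y) / 2) * w x y| ≤
      (33 / 16 * C) * (√((x + y) / 2) / ((x + y) / 2) ^ (n + 2)) := by
    intro x y hx hy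
    have hr : 0 < (x + y) / 2 := by linarith
    rw [abs_mul]
    calc |K ((x + y) / 2)| * |w x y|
        ≤ (33 / 16 / ((x + y) / 2) ^ 2) * (C * (√((x + y) / 2) / ((x + y) / 2) ^ n)) :=
          mul_le_mul (hK _ hr) (hC x y hx hy) (abs_nonneg _) (by positivity)
      _ = _ := by rw [pow_add]; field_simp
  refine ⟨4 * (33 / 16 * C), ?_, fun x y hx hy => ⟨?_, ?_⟩⟩
  · have h1 := (abs_nonneg _).trans (hC (ρ + 1) (ρ + 1) (by linarith) (by linarith))
    have h2 : 0 < √((ρ + 1 + (ρ + 1)) / 2) / ((ρ + 1 + (ρ + 1)) / 2) ^ n := by positivity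
    have := nonneg_of_mul_nonneg_left h1 h2
    positivity
  · have := h.sol.swap.abs_b_le hρ (C := 33 / 16 * C) (n := n)
      (fun x y hx hy => by rw [add_comm x y]; exact hg y x hy hx) h.lim_a hy hx
    rwa [add_comm y x] at this
  · exact h.sol.abs_b_le hρ hg h.lim_b hx hy

lemma timeDiff (h : NonRad K n ρ w a b) (hρ : 0 ≤ ρ)
    (hK : ∀ r, 0 < r → |K r| ≤ 33 / 16 / r ^ 2) {s : ℝ} (hs : 0 < s) :
    NonRad K (n + 1) (ρ + s) (timeDiff s w) (timeDiff s a) (timeDiff s b) where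
  sol := by
    have h1 := (h.sol.shift s).sub (by simpa only [abs_neg] using h.sol.shift (-s))
    rw [abs_of_pos hs] at h1
    convert h1 using 1
    · funext x y; simp [_root_.timeDiff, sub_eq_add_neg]
    · funext x y; simp [_root_.timeDiff, sub_eq_add_neg]
    · funext x y; simp [_root_.timeDiff, sub_eq_add_neg]
    · funext x y
      have e1 : x + s + (y - s) = x + y := by ring
      have e2 : x + -s + (y - -s) = x + y := by ring
      rw [e1, e2, ← mul_sub]
      simp [_root_.timeDiff, sub_eq_add_neg]
  lim_b y hy := by
    have h1 := (h.lim_b (y - s) (by linarith)).comp (tendsto_atTop_add_const_right _ s tendsto_id)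
    have h2 := (h.lim_b (y + s) (by linarith)).comp
      (tendsto_atTop_add_const_right _ (-s) tendsto_id)
    simpa [_root_.timeDiff, Function.comp_def, sub_eq_add_neg] using h1.sub h2
  lim_a x hx := by
    have h1 := (h.lim_a (x + s) (by linarith)).comp
      (tendsto_atTop_add_const_right _ (-s) tendsto_id)
    have h2 := (h.lim_a (x - s) (by linarith)).comp
      (tendsto_atTop_add_const_right _ s tendsto_id)
    simpa [_root_.timeDiff, Function.comp_def, sub_eq_add_neg] using h1.sub h2
  bound := by
    obtain ⟨C, -, hC⟩ := h.deriv_bound hρ hK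
    refine ⟨2 * s * (2 * C), fun x y hx hy => ?_⟩
    set D := √((x + y) / 2) / ((x + y) / 2) ^ (n + 1)
    have h1 := abs_sub_le_of_abs_deriv_le (a := -s) (b := s) (by linarith)
      (f := fun σ => w (x + σ) (y - σ)) (g := fun σ => 2 * C * D * σ) (g' := fun _ => 2 * C * D)
      (fun σ hσ => h.sol.dt_at (by linarith [hσ.1]) (by linarith [hσ.2]))
      (fun σ _ => by simpa using (hasDerivAt_id σ).const_mul (2 * C * D))
      (fun σ hσ => by
        have h2 := hC (x + σ) (y - σ) (by linarith [hσ.1]) (by linarith [hσ.2])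
        have e1 : x + σ + (y - σ) = x + y := by ring
        rw [e1] at h2
        have := abs_sub (a (x + σ) (y - σ)) (b (x + σ) (y - σ))
        linarith [h2.1, h2.2])
    have e : _root_.timeDiff s w x y = w (x + s) (y - s) - w (x + -s) (y - -s) := by
      simp [_root_.timeDiff, sub_eq_add_neg]
    rw [e]
    linarith

/-- Contraction step of `NonRad.eq_zero`. -/
lemma contract (h : NonRad K 2 ρ w a b) (hρ : 0 ≤ ρ)
    (hK : ∀ r, 0 < r → |K r| ≤ 33 / 16 / r ^ 2) (hodd : ∀ x, ρ < x → w x x = 0) {M : ℝ}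
    (hM : ∀ x y, ρ < y → y ≤ x →
      |w x y| ≤ M * ((x - y) / 2 * (√((x + y) / 2) / ((x + y) / 2) ^ 3))) :
    ∀ x y, ρ < y → y ≤ x →
      |w x y| ≤ 33 / 35 * M * ((x - y) / 2 * (√((x + y) / 2) / ((x + y) / 2) ^ 3)) := by
  set φ : ℝ → ℝ → ℝ := fun x y => (x - y) / 2 * (√((x + y) / 2) / ((x + y) / 2) ^ 3) with hφ
  set ψ : ℝ → ℝ → ℝ := fun x y => 1 / 2 * (√((x + y) / 2) / ((x + y) / 2) ^ 3) +
    5 / 4 * ((x - y) / 2 * (√((x + y) / 2) / ((x + y) / 2) ^ 4)) with hψ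
  have φy : ∀ x y, 0 < x → 0 < y → HasDerivAt (fun y => φ x y) (-ψ x y) y := by
    intro x y hx hy
    have h1 := (((hasDerivAt_id y).const_sub x).div_const 2).mul
      ((hasDerivAt_sqrt_div_pow 3 (r := (x + y) / 2) (by linarith)).comp y
      (hasDerivAt_mean_right x y))
    refine h1.of_eq (fun _ => rfl) ?_
    simp only [hψ, Function.comp_apply, id]
    push_cast
    ring
  have ψx : ∀ x y, 0 < x → 0 < y → HasDerivAt (fun x => ψ x y)
      (-(35 / 16 * ((x - y) / 2 * (√((x + y) / 2) / ((x + y) / 2) ^ 5)))) x := by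
    intro x y hx hy
    have hm := hasDerivAt_mean_left x y
    have h1 := ((hasDerivAt_sqrt_div_pow 3 (r := (x + y) / 2) (by linarith)).comp x hm).const_mul
      (1 / 2)
    have h2 := ((((hasDerivAt_id x).sub_const y).div_const 2).mul
      ((hasDerivAt_sqrt_div_pow 4 (r := (x + y) / 2) (by linarith)).comp x hm)).const_mul (5 / 4)
    refine (h1.add h2).of_eq (fun _ => rfl) ?_
    simp only [Function.comp_apply, id]
    push_cast
    ring
  have ψlim : ∀ y, 0 < y → Tendsto (fun x => ψ x y) atTop (𝓝 0) := by
    intro y hy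
    have h1 := ((tendsto_sqrt_div_pow 2).comp (tendsto_mean_left y)).const_mul (1 / 2)
    have h2 := ((tendsto_sqrt_div_pow 2).comp (tendsto_mean_left y)).const_mul (5 / 4)
    have h3 := ((tendsto_sqrt_div_pow 3).comp (tendsto_mean_left y)).const_mul (5 / 4 * y)
    have h4 := (h1.add h2).sub h3
    simp only [mul_zero, add_zero, sub_zero] at h4
    refine h4.congr' ?_
    filter_upwards [eventually_gt_atTop 0] with x hx
    simp only [hψ, Function.comp_apply]
    have hr : x + y ≠ 0 := by positivity
    field_simp
    ring
  have hb : ∀ x y, ρ < y → y ≤ x → |b x y| ≤ 33 / 35 * M * ψ x y := by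
    intro x y hy hyx
    refine abs_le_of_abs_deriv_le_of_tendsto (f := fun x => b x y)
      (g := fun x => 33 / 35 * M * ψ x y)
      (g' := fun x => 33 / 35 * M * (35 / 16 * ((x - y) / 2 *
        (√((x + y) / 2) / ((x + y) / 2) ^ 5))))
      (fun z hz => h.sol.bx z y (hy.trans_le (hyx.trans hz)) hy) ?_ ?_ (h.lim_b y hy) ?_
    · intro z hz
      have hz' : y ≤ z := hyx.trans hz
      exact ((ψx z y (by linarith) (by linarith)).const_mul (33 / 35 * M)).of_eq (fun _ => rfl)
        (by ring)
    · intro z hz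
      have hz' : y ≤ z := hyx.trans hz
      have hr : 0 < (z + y) / 2 := by linarith
      rw [abs_mul]
      calc |K ((z + y) / 2)| * |w z y| ≤ (33 / 16 / ((z + y) / 2) ^ 2) * (M * φ z y) :=
            mul_le_mul (hK _ hr) (hM z y hy hz') (abs_nonneg _) (by positivity)
        _ = _ := by simp only [hφ]; field_simp
    · simpa using (ψlim y (by linarith)).const_mul (33 / 35 * M)
  intro x y hy hyx
  have h1 := abs_sub_le_of_abs_deriv_le hyx (f := fun y => w x y)
    (g := fun y => -(33 / 35 * M * φ x y)) (g' := fun y => 33 / 35 * M * ψ x y)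
    (fun z hz => h.sol.dy x z (by linarith) (by linarith [hz.1]))
    (fun z hz => ((φy x z (by linarith) (by linarith [hz.1])).const_mul (33 / 35 * M)).neg.of_eq
      (fun _ => rfl) (by ring))
    (fun z hz => hb x z (by linarith [hz.1]) hz.2)
  have h2 : φ x x = 0 := by simp [hφ]
  simp only [hodd x (by linarith), h2] at h1
  rw [zero_sub, abs_neg] at h1
  simpa [hφ] using h1

/-- Odd-in-time nonradiative solutions with sufficient decay vanish. -/
theorem eq_zero (h : NonRad K 2 ρ w a b) (hρ : 0 ≤ ρ)
    (hK : ∀ r, 0 < r → |K r| ≤ 33 / 16 / r ^ 2) (hodd : ∀ x y, w y x = -w x y) {x y : ℝ}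
    (hx : ρ < x) (hy : ρ < y) : w x y = 0 := by
  have hdiag : ∀ x, ρ < x → w x x = 0 := fun x _ => by linarith [hodd x x]
  wlog hyx : y ≤ x generalizing x y
  · linarith [hodd x y, this hy hx (le_of_not_ge hyx)]
  obtain ⟨C, hC0, hC⟩ := h.deriv_bound hρ hK
  have base : ∀ x y, ρ < y → y ≤ x →
      |w x y| ≤ 2 * C * ((x - y) / 2 * (√((x + y) / 2) / ((x + y) / 2) ^ 3)) := by
    intro x y hy hyx
    have hr : 0 < (x + y) / 2 := by linarith
    have h1 := abs_sub_le_of_abs_deriv_le hyx (f := fun y => w x y)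
      (g := fun z => C * (√((x + y) / 2) / ((x + y) / 2) ^ 3) * z)
      (g' := fun _ => C * (√((x + y) / 2) / ((x + y) / 2) ^ 3))
      (fun z hz => h.sol.dy x z (by linarith) (by linarith [hz.1]))
      (fun z hz => by simpa using (hasDerivAt_id z).const_mul _)
      (fun z hz => by
        refine ((hC x z (by linarith) (by linarith [hz.1])).2).trans ?_
        refine mul_le_mul_of_nonneg_left ?_ hC0
        have key : ∀ r : ℝ, 0 < r → √r / r ^ 3 = 1 / (√r * r ^ 2) := by
          intro r hr
          have : √r ^ 2 = r := Real.sq_sqrt hr.le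
          have hs : 0 < √r := Real.sqrt_pos.2 hr
          rw [div_eq_div_iff (by positivity) (by positivity)]
          calc √r * (√r * r ^ 2) = √r ^ 2 * r ^ 2 := by ring
            _ = 1 * r ^ 3 := by rw [this]; ring
        rw [key _ (by linarith [hz.1]), key _ hr]
        have hz1 := hz.1
        have hs : 0 < √((x + y) / 2) := Real.sqrt_pos.2 hr
        gcongr)
    simp only [hdiag x (by linarith)] at h1
    rw [zero_sub, abs_neg] at h1
    linarith
  have iter : ∀ m : ℕ, ∀ x y, ρ < y → y ≤ x →
      |w x y| ≤ (33 / 35) ^ m * (2 * C) * ((x - y) / 2 * (√((x + y) / 2) / ((x + y) / 2) ^ 3)) := by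
    intro m
    induction m with
    | zero => simpa using base
    | succ m ih =>
      have := h.contract hρ hK hdiag ih
      intro x y hy hyx
      convert this x y hy hyx using 2
      ring
  have hl : Tendsto (fun m : ℕ => (33 / 35 : ℝ) ^ m * (2 * C) *
      ((x - y) / 2 * (√((x + y) / 2) / ((x + y) / 2) ^ 3))) atTop (𝓝 0) := by
    simpa using ((tendsto_pow_atTop_nhds_zero_of_lt_one (r := (33 / 35 : ℝ)) (by norm_num)
      (by norm_num)).mul_const (2 * C)).mul_const
      ((x - y) / 2 * (√((x + y) / 2) / ((x + y) / 2) ^ 3))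
  have := ge_of_tendsto' hl (fun m => iter m x y hy hyx)
  exact abs_nonpos_iff.1 this

/-- Odd-in-time nonradiative solutions are affine in time. -/
theorem second_difference_eq_zero (h : NonRad K 0 ρ w a b) (hρ : 0 ≤ ρ)
    (hK : ∀ r, 0 < r → |K r| ≤ 33 / 16 / r ^ 2) (hodd : ∀ x y, w y x = -w x y) {s : ℝ}
    (hs : 0 < s) {x y : ℝ} (hx : ρ + 2 * s < x) (hy : ρ + 2 * s < y) :
    w (x + 2 * s) (y - 2 * s) + w (x - 2 * s) (y + 2 * s) = 2 * w x y := by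
  have h2 := (h.timeDiff hρ hK hs).timeDiff (by linarith) hK hs
  have h3 := h2.eq_zero (x := x) (y := y) (by linarith) hK
    (fun x y => by
      simp only [_root_.timeDiff]
      rw [hodd (x - s - s) (y + s + s), hodd (x - s + s) (y + s - s),
        hodd (x + s - s) (y - s + s), hodd (x + s + s) (y - s - s)]
      ring) (by linarith) (by linarith)
  simp only [_root_.timeDiff] at h3
  have e1 : x + s + s = x + 2 * s := by ring
  have e2 : y - s - s = y - 2 * s := by ring
  have e3 : x - s - s = x - 2 * s := by ring
  have e4 : y + s + s = y + 2 * s := by ring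
  have e5 : x + s - s = x := by ring
  have e6 : y - s + s = y := by ring
  have e7 : x - s + s = x := by ring
  have e8 : y + s - s = y := by ring
  rw [e1, e2, e3, e4, e5, e6, e7, e8] at h3
  linarith

end NonRad

/-- The potential as a function of the radius. -/
def potential (r : ℝ) : ℝ := -2 * ((1 + r ^ 2 / 24) ^ 2)⁻¹

/-- The potential of the equation for `r ^ (5/2) u` in null coordinates. -/
def nullPotential (r : ℝ) : ℝ := 15 / 16 / r ^ 2 + potential r / 4

lemma abs_potential_le {r : ℝ} (hr : 0 < r) : |potential r| ≤ 1152 / r ^ 4 := by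
  have h1 : (r ^ 2 / 24) ^ 2 ≤ (1 + r ^ 2 / 24) ^ 2 := by gcongr; linarith
  rw [potential, abs_mul, abs_of_neg (by norm_num : (-2 : ℝ) < 0), abs_of_pos (by positivity)]
  calc - -2 * ((1 + r ^ 2 / 24) ^ 2)⁻¹ ≤ - -2 * ((r ^ 2 / 24) ^ 2)⁻¹ := by gcongr
    _ = 1152 / r ^ 4 := by field_simp; norm_num

lemma abs_nullPotential_le {r : ℝ} (hr : 0 < r) : |nullPotential r| ≤ 33 / 16 / r ^ 2 := by
  have h1 : ((1 + r ^ 2 / 24) ^ 2)⁻¹ ≤ 6 / r ^ 2 := by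
    rw [inv_le_comm₀ (by positivity) (by positivity), inv_div]
    nlinarith [sq_nonneg (1 - r ^ 2 / 24)]
  have h2 : 0 < ((1 + r ^ 2 / 24) ^ 2)⁻¹ := by positivity
  have e1 : 15 / 16 / r ^ 2 = 15 / 16 * (1 / r ^ 2) := by ring
  have e2 : 33 / 16 / r ^ 2 = 33 / 16 * (1 / r ^ 2) := by ring
  have e3 : 6 / r ^ 2 = 6 * (1 / r ^ 2) := by ring
  have h3 : 0 < 1 / r ^ 2 := by positivity
  rw [nullPotential, potential, abs_le, e1, e2]
  rw [e3] at h1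
  constructor <;> linarith

/-- A radial `C²` solution of the linearized wave equation, as a function of time and radius,
together with its partial derivatives. -/
structure RadialWave where
  F : ℝ → ℝ → ℝ
  Ft : ℝ → ℝ → ℝ
  Fr : ℝ → ℝ → ℝ
  Ftt : ℝ → ℝ → ℝ
  Ftr : ℝ → ℝ → ℝ
  Frr : ℝ → ℝ → ℝ
  hasF : ∀ t r, HasFDerivAt (fun p : ℝ × ℝ => F p.1 p.2)
    (Ft t r • ContinuousLinearMap.fst ℝ ℝ ℝ + Fr t r • ContinuousLinearMap.snd ℝ ℝ ℝ) (t, r)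
  hasFt : ∀ t r, HasFDerivAt (fun p : ℝ × ℝ => Ft p.1 p.2)
    (Ftt t r • ContinuousLinearMap.fst ℝ ℝ ℝ + Ftr t r • ContinuousLinearMap.snd ℝ ℝ ℝ) (t, r)
  hasFr : ∀ t r, HasFDerivAt (fun p : ℝ × ℝ => Fr p.1 p.2)
    (Ftr t r • ContinuousLinearMap.fst ℝ ℝ ℝ + Frr t r • ContinuousLinearMap.snd ℝ ℝ ℝ) (t, r)
  eqn : ∀ t r, 0 < r → Ftt t r = Frr t r + 5 / r * Fr t r - potential r * F t r

lemma HasFDerivAt.comp_curve {G Gt Gr : ℝ → ℝ → ℝ} {x y : ℝ → ℝ} {x' y' s : ℝ}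
    (h : ∀ t r, HasFDerivAt (fun p : ℝ × ℝ => G p.1 p.2)
      (Gt t r • ContinuousLinearMap.fst ℝ ℝ ℝ + Gr t r • ContinuousLinearMap.snd ℝ ℝ ℝ) (t, r))
    (hx : HasDerivAt x x' s) (hy : HasDerivAt y y' s) :
    HasDerivAt (fun s => G (x s) (y s)) (Gt (x s) (y s) * x' + Gr (x s) (y s) * y') s := by
  have h1 := (h (x s) (y s)).comp_hasDerivAt s (hx.prodMk hy)
  exact h1.of_eq (fun _ => rfl) (by simp)

lemma HasFDerivAt.comp_neg_fst {G Gt Gr : ℝ → ℝ → ℝ}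
    (h : ∀ t r, HasFDerivAt (fun p : ℝ × ℝ => G p.1 p.2)
      (Gt t r • ContinuousLinearMap.fst ℝ ℝ ℝ + Gr t r • ContinuousLinearMap.snd ℝ ℝ ℝ) (t, r))
    (t r : ℝ) : HasFDerivAt (fun p : ℝ × ℝ => G (-p.1) p.2)
      ((-Gt (-t) r) • ContinuousLinearMap.fst ℝ ℝ ℝ + Gr (-t) r • ContinuousLinearMap.snd ℝ ℝ ℝ)
      (t, r) := by
  have h1 : HasFDerivAt (fun p : ℝ × ℝ => (-p.1, p.2))
      ((-ContinuousLinearMap.fst ℝ ℝ ℝ).prod (ContinuousLinearMap.snd ℝ ℝ ℝ)) (t, r) :=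
    (hasFDerivAt_fst.neg).prodMk hasFDerivAt_snd
  have h2 := HasFDerivAt.comp (t, r) (f := fun p : ℝ × ℝ => (-p.1, p.2)) (h (-t) r) h1
  refine h2.congr_fderiv ?_
  ext <;> simp

namespace RadialWave

/-- Time reversal. -/
def refl (U : RadialWave) : RadialWave where
  F t r := U.F (-t) r
  Ft t r := -U.Ft (-t) r
  Fr t r := U.Fr (-t) r
  Ftt t r := U.Ftt (-t) r
  Ftr t r := -U.Ftr (-t) r
  Frr t r := U.Frr (-t) r
  hasF := HasFDerivAt.comp_neg_fst U.hasF
  hasFt t r := by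
    refine (HasFDerivAt.comp_neg_fst U.hasFt t r).neg.congr_fderiv ?_
    ext <;> simp
  hasFr := HasFDerivAt.comp_neg_fst U.hasFr
  eqn t r hr := U.eqn (-t) r hr

/-- The odd-in-time part. -/
def odd (U : RadialWave) : RadialWave where
  F t r := (U.F t r - U.F (-t) r) / 2
  Ft t r := (U.Ft t r + U.Ft (-t) r) / 2
  Fr t r := (U.Fr t r - U.Fr (-t) r) / 2
  Ftt t r := (U.Ftt t r - U.Ftt (-t) r) / 2
  Ftr t r := (U.Ftr t r + U.Ftr (-t) r) / 2
  Frr t r := (U.Frr t r - U.Frr (-t) r) / 2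
  hasF t r := by
    refine (((U.hasF t r).sub (U.refl.hasF t r)).mul_const (1 / 2)).congr_fderiv ?_
      |>.congr_of_eventuallyEq ?_
    · ext <;> simp [refl] <;> ring
    · exact .of_forall fun p => by simp [refl]; ring
  hasFt t r := by
    refine (((U.hasFt t r).sub (U.refl.hasFt t r)).mul_const (1 / 2)).congr_fderiv ?_
      |>.congr_of_eventuallyEq ?_
    · ext <;> simp [refl] <;> ring
    · exact .of_forall fun p => by simp [refl]; ring
  hasFr t r := by
    refine (((U.hasFr t r).sub (U.refl.hasFr t r)).mul_const (1 / 2)).congr_fderiv ?_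
      |>.congr_of_eventuallyEq ?_
    · ext <;> simp [refl] <;> ring
    · exact .of_forall fun p => by simp [refl]; ring
  eqn t r hr := by
    rw [U.eqn t r hr, U.eqn (-t) r hr]
    ring

variable (U : RadialWave)

lemma continuous_F : Continuous (fun p : ℝ × ℝ => U.F p.1 p.2) :=
  continuous_iff_continuousAt.2 fun p => (U.hasF p.1 p.2).continuousAt

lemma continuous_Ft : Continuous (fun p : ℝ × ℝ => U.Ft p.1 p.2) :=
  continuous_iff_continuousAt.2 fun p => (U.hasFt p.1 p.2).continuousAt

lemma continuous_Fr : Continuous (fun p : ℝ × ℝ => U.Fr p.1 p.2) :=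
  continuous_iff_continuousAt.2 fun p => (U.hasFr p.1 p.2).continuousAt

lemma hasDerivAt_F_time (t r : ℝ) : HasDerivAt (fun t => U.F t r) (U.Ft t r) t :=
  (HasFDerivAt.comp_curve U.hasF (hasDerivAt_id t) (hasDerivAt_const t r)).of_eq
    (fun _ => rfl) (by simp)

lemma hasDerivAt_Ft_time (t r : ℝ) : HasDerivAt (fun t => U.Ft t r) (U.Ftt t r) t :=
  (HasFDerivAt.comp_curve U.hasFt (hasDerivAt_id t) (hasDerivAt_const t r)).of_eq
    (fun _ => rfl) (by simp)

lemma hasDerivAt_F_radius (t r : ℝ) : HasDerivAt (fun r => U.F t r) (U.Fr t r) r :=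
  (HasFDerivAt.comp_curve U.hasF (hasDerivAt_const r t) (hasDerivAt_id r)).of_eq
    (fun _ => rfl) (by simp)

lemma hasDerivAt_Fr_radius (t r : ℝ) : HasDerivAt (fun r => U.Fr t r) (U.Frr t r) r :=
  (HasFDerivAt.comp_curve U.hasFr (hasDerivAt_const r t) (hasDerivAt_id r)).of_eq
    (fun _ => rfl) (by simp)

/-- The energy density with respect to `dr`. -/
def energy (t r : ℝ) : ℝ := r ^ 5 * (U.Ft t r ^ 2 + U.Fr t r ^ 2)

lemma continuous_energy (t : ℝ) : Continuous (U.energy t) := by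
  have h1 : Continuous (fun r => U.Ft t r) :=
    U.continuous_Ft.comp (by fun_prop : Continuous fun r : ℝ => (t, r))
  have h2 : Continuous (fun r => U.Fr t r) :=
    U.continuous_Fr.comp (by fun_prop : Continuous fun r : ℝ => (t, r))
  unfold energy
  fun_prop

lemma energy_nonneg (t : ℝ) {r : ℝ} (hr : 0 ≤ r) : 0 ≤ U.energy t r := by
  unfold energy; positivity

/-- `r ^ (5/2) (u - ℓ)` in null coordinates. -/
def nullW (ℓ x y : ℝ) : ℝ :=
  √((x + y) / 2) * ((x + y) / 2) ^ 2 * (U.F ((x - y) / 2) ((x + y) / 2) - ℓ)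

/-- The derivative of `nullW` in `x`. -/
def nullA (ℓ x y : ℝ) : ℝ :=
  1 / 2 * (√((x + y) / 2) * ((x + y) / 2) ^ 2 *
    (U.Fr ((x - y) / 2) ((x + y) / 2) + U.Ft ((x - y) / 2) ((x + y) / 2)) +
    5 / 2 * (U.nullW ℓ x y / ((x + y) / 2)))

/-- The derivative of `nullW` in `y`. -/
def nullB (ℓ x y : ℝ) : ℝ :=
  1 / 2 * (√((x + y) / 2) * ((x + y) / 2) ^ 2 *
    (U.Fr ((x - y) / 2) ((x + y) / 2) - U.Ft ((x - y) / 2) ((x + y) / 2)) +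
    5 / 2 * (U.nullW ℓ x y / ((x + y) / 2)))

/-- The mixed derivative of `nullW`. -/
def nullG (ℓ x y : ℝ) : ℝ :=
  nullPotential ((x + y) / 2) * U.nullW ℓ x y +
    potential ((x + y) / 2) / 4 * (√((x + y) / 2) * ((x + y) / 2) ^ 2 * ℓ)

lemma continuous_nullW (ℓ : ℝ) : Continuous (fun p : ℝ × ℝ => U.nullW ℓ p.1 p.2) := by
  have h1 : Continuous (fun p : ℝ × ℝ => U.F ((p.1 - p.2) / 2) ((p.1 + p.2) / 2)) :=
    U.continuous_F.comp
      (by fun_prop : Continuous fun p : ℝ × ℝ => ((p.1 - p.2) / 2, (p.1 + p.2) / 2))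
  unfold nullW
  fun_prop

lemma hasDerivAt_weight {x : ℝ → ℝ} {x' s : ℝ} (hx : HasDerivAt x x' s) (h0 : 0 < x s) :
    HasDerivAt (fun s => √(x s) * x s ^ 2) (5 / 2 * (√(x s) * x s) * x') s := by
  have h1 := (hx.sqrt h0.ne').mul (hx.pow 2)
  refine h1.of_eq (fun _ => rfl) ?_
  have hs : 0 < √(x s) := Real.sqrt_pos.2 h0
  have hs2 : √(x s) ^ 2 = x s := Real.sq_sqrt h0.le
  field_simp
  simp only [Pi.pow_apply]
  rw [hs2]
  ring

lemma hasDerivAt_diff_left (x y : ℝ) : HasDerivAt (fun x : ℝ => (x - y) / 2) (1 / 2) x := by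
  simpa using ((hasDerivAt_id x).sub_const y).div_const 2

lemma hasDerivAt_diff_right (x y : ℝ) :
    HasDerivAt (fun y : ℝ => (x - y) / 2) (-1 / 2) y := by
  simpa using ((hasDerivAt_id y).const_sub x).div_const 2

lemma hasDerivAt_nullW_left (ℓ : ℝ) {x y : ℝ} (hx : 0 < x) (hy : 0 < y) :
    HasDerivAt (fun x => U.nullW ℓ x y) (U.nullA ℓ x y) x := by
  have hr : 0 < (x + y) / 2 := by linarith
  refine ((hasDerivAt_weight (hasDerivAt_mean_left x y) hr).mul
    ((HasFDerivAt.comp_curve U.hasF (hasDerivAt_diff_left x y)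
      (hasDerivAt_mean_left x y)).sub_const ℓ)).of_eq (fun _ => rfl) ?_
  simp only [nullA, nullW]
  field_simp
  ring

lemma hasDerivAt_nullW_right (ℓ : ℝ) {x y : ℝ} (hx : 0 < x) (hy : 0 < y) :
    HasDerivAt (fun y => U.nullW ℓ x y) (U.nullB ℓ x y) y := by
  have hr : 0 < (x + y) / 2 := by linarith
  refine ((hasDerivAt_weight (hasDerivAt_mean_right x y) hr).mul
    ((HasFDerivAt.comp_curve U.hasF (hasDerivAt_diff_right x y)
      (hasDerivAt_mean_right x y)).sub_const ℓ)).of_eq (fun _ => rfl) ?_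
  simp only [nullB, nullW]
  field_simp
  ring

/-- In null coordinates the wave equation is `∂ₓ∂ᵧ w = g`. -/
theorem nullSol (ℓ : ℝ) : NullSol 0 (U.nullW ℓ) (U.nullA ℓ) (U.nullB ℓ) (U.nullG ℓ) where
  dx x y hx hy := U.hasDerivAt_nullW_left ℓ hx hy
  dy x y hx hy := U.hasDerivAt_nullW_right ℓ hx hy
  bx x y hx hy := by
    have hr : 0 < (x + y) / 2 := by linarith
    have hm := hasDerivAt_mean_left x y
    have h1 := (hasDerivAt_weight hm hr).mul
      ((HasFDerivAt.comp_curve U.hasFr (hasDerivAt_diff_left x y) hm).sub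
      (HasFDerivAt.comp_curve U.hasFt (hasDerivAt_diff_left x y) hm))
    have h2 := (U.hasDerivAt_nullW_left ℓ hx hy).div hm hr.ne'
    refine ((h1.add (h2.const_mul (5 / 2))).const_mul (1 / 2)).of_eq (fun _ => rfl) ?_
    simp only [nullG, nullA, nullW, nullPotential, Pi.sub_apply]
    rw [U.eqn _ _ hr]
    generalize U.F ((x - y) / 2) ((x + y) / 2) = f
    generalize U.Ft ((x - y) / 2) ((x + y) / 2) = ft
    generalize U.Fr ((x - y) / 2) ((x + y) / 2) = fr
    generalize U.Frr ((x - y) / 2) ((x + y) / 2) = frr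
    generalize U.Ftr ((x - y) / 2) ((x + y) / 2) = ftr
    generalize √((x + y) / 2) = z
    generalize potential ((x + y) / 2) = v
    generalize (x + y) / 2 = r at hr
    field_simp
    ring
  ay x y hx hy := by
    have hr : 0 < (x + y) / 2 := by linarith
    have hm := hasDerivAt_mean_right x y
    have h1 := (hasDerivAt_weight hm hr).mul
      ((HasFDerivAt.comp_curve U.hasFr (hasDerivAt_diff_right x y) hm).add
      (HasFDerivAt.comp_curve U.hasFt (hasDerivAt_diff_right x y) hm))
    have h2 := (U.hasDerivAt_nullW_right ℓ hx hy).div hm hr.ne'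
    refine ((h1.add (h2.const_mul (5 / 2))).const_mul (1 / 2)).of_eq (fun _ => rfl) ?_
    simp only [nullG, nullB, nullW, nullPotential, Pi.add_apply]
    rw [U.eqn _ _ hr]
    generalize U.F ((x - y) / 2) ((x + y) / 2) = f
    generalize U.Ft ((x - y) / 2) ((x + y) / 2) = ft
    generalize U.Fr ((x - y) / 2) ((x + y) / 2) = fr
    generalize U.Frr ((x - y) / 2) ((x + y) / 2) = frr
    generalize U.Ftr ((x - y) / 2) ((x + y) / 2) = ftr
    generalize √((x + y) / 2) = z
    generalize potential ((x + y) / 2) = v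
    generalize (x + y) / 2 = r at hr
    field_simp
    ring
  dt x y hx hy := by
    have h1 := ((((hasDerivAt_id (0 : ℝ)).add_const ((x - y) / 2)).of_eq
      (g := fun s => (x + s - (y - s)) / 2) (fun s => by simp only [id]; ring) rfl))
    have h2 := (((HasFDerivAt.comp_curve U.hasF h1
      (hasDerivAt_const (0 : ℝ) ((x + y) / 2))).sub_const ℓ).const_mul
      (√((x + y) / 2) * ((x + y) / 2) ^ 2))
    refine h2.of_eq (fun s => ?_) ?_
    · simp only [nullW]
      rw [show x + s + (y - s) = x + y by ring]
    · simp only [nullA, nullB, add_zero, sub_zero]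
      ring

end RadialWave

lemma abs_sub_le_of_energy {h h' : ℝ → ℝ} {ρ E : ℝ} (hρ : 0 < ρ)
    (hd : ∀ r, ρ < r → HasDerivAt h (h' r) r) (hc : Continuous h')
    (hi : IntegrableOn (fun r => r ^ 5 * h' r ^ 2) (Ioi ρ))
    (hE : ∫ r in Ioi ρ, r ^ 5 * h' r ^ 2 ≤ E) {a b : ℝ} (ha : ρ < a) (hab : a ≤ b) :
    |h b - h a| ≤ (E / 2 + 1 / 8) / a ^ 2 := by
  have ha0 : 0 < a := hρ.trans ha
  have hcont : Continuous (fun r => r ^ 5 * h' r ^ 2) := by fun_prop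
  have h1 := abs_sub_le_of_abs_deriv_le (f := h) (f' := h')
    (g := fun r => 1 / 2 * (1 / a ^ 2 * (∫ s in a..r, s ^ 5 * h' s ^ 2) - a ^ 2 / 4 * (r ^ 4)⁻¹))
    (g' := fun r => 1 / 2 * (1 / a ^ 2 * (r ^ 5 * h' r ^ 2) + a ^ 2 / r ^ 5)) hab
    (fun r hr => hd r (ha.trans_le hr.1)) (fun r hr => ?_) (fun r hr => ?_)
  · have h2 : ∫ s in a..b, s ^ 5 * h' s ^ 2 ≤ E := by
      rw [intervalIntegral.integral_of_le hab]
      refine le_trans (setIntegral_mono_set hi ?_ ?_) hE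
      · filter_upwards [ae_restrict_mem measurableSet_Ioi] with r hr
        have : 0 < r := hρ.trans hr
        simp only [Pi.zero_apply]
        positivity
      · exact LE.le.eventuallyLE (show Ioc a b ≤ Ioi ρ from fun r hr => ha.trans hr.1)
    have h3 : 0 ≤ a ^ 2 / 4 * (b ^ 4)⁻¹ := by positivity
    have h4 : 1 / a ^ 2 * (∫ s in a..b, s ^ 5 * h' s ^ 2) ≤ 1 / a ^ 2 * E := by gcongr
    simp only [intervalIntegral.integral_same, mul_zero, zero_sub] at h1
    have h5 : a ^ 2 / 4 * (a ^ 4)⁻¹ = 1 / 4 * (1 / a ^ 2) := by field_simp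
    have h6 : (E / 2 + 1 / 8) / a ^ 2 = 1 / 2 * (1 / a ^ 2 * E) + 1 / 8 * (1 / a ^ 2) := by ring
    rw [h6]
    rw [h5] at h1
    linarith
  · have hr0 : 0 < r := ha0.trans_le hr.1
    have h2 := (hcont.integral_hasStrictDerivAt a r).hasDerivAt
    have h3 := (hasDerivAt_pow 4 r).inv (pow_ne_zero 4 hr0.ne')
    refine (((h2.const_mul (1 / a ^ 2)).sub (h3.const_mul (a ^ 2 / 4))).const_mul (1 / 2)).of_eq
      (fun _ => rfl) ?_
    field_simp
    push_cast
    ring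
  · have hr0 : 0 < r := ha0.trans_le hr.1
    set s := √r with hs
    have hs0 : 0 < s := Real.sqrt_pos.2 hr0
    have hsr : r = s ^ 2 := (Real.sq_sqrt hr0.le).symm
    have h2 := two_mul_le_add_sq (s ^ 5 * |h' r| / a) (a / s ^ 5)
    have h3 : s ^ 5 * |h' r| / a * (a / s ^ 5) = |h' r| := by field_simp
    have h4 : (s ^ 5 * |h' r| / a) ^ 2 = 1 / a ^ 2 * (r ^ 5 * h' r ^ 2) := by
      rw [hsr, ← sq_abs (h' (s ^ 2))]
      ring
    have h5 : (a / s ^ 5) ^ 2 = a ^ 2 / r ^ 5 := by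
      rw [hsr]
      ring
    rw [mul_assoc, h3, h4, h5] at h2
    linarith

/-- A radial function of finite energy has a limit, with a rate. -/
lemma exists_tendsto_of_energy {h h' : ℝ → ℝ} {ρ E : ℝ} (hρ : 0 < ρ)
    (hd : ∀ r, ρ < r → HasDerivAt h (h' r) r) (hc : Continuous h')
    (hi : IntegrableOn (fun r => r ^ 5 * h' r ^ 2) (Ioi ρ))
    (hE : ∫ r in Ioi ρ, r ^ 5 * h' r ^ 2 ≤ E) :
    ∃ ℓ, Tendsto h atTop (𝓝 ℓ) ∧ ∀ r, ρ < r → |h r - ℓ| ≤ (E / 2 + 1 / 8) / r ^ 2 := by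
  have key := fun a b => abs_sub_le_of_energy (a := a) (b := b) hρ hd hc hi hE
  have h1 : CauchySeq h := by
    refine Metric.cauchySeq_iff'.2 fun ε hε => ?_
    have h2 : Tendsto (fun r : ℝ => (E / 2 + 1 / 8) / r ^ 2) atTop (𝓝 0) :=
      tendsto_const_nhds.div_atTop (tendsto_pow_atTop (by norm_num))
    obtain ⟨N, hN, hN'⟩ := ((h2.eventually (gt_mem_nhds hε)).and (eventually_gt_atTop ρ)).exists
    exact ⟨N, fun n hn => (key N n hN' hn).trans_lt hN⟩
  obtain ⟨ℓ, hℓ⟩ := cauchySeq_tendsto_of_complete h1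
  refine ⟨ℓ, hℓ, fun r hr => ?_⟩
  have h3 : Tendsto (fun b => |h b - h r|) atTop (𝓝 |ℓ - h r|) := (hℓ.sub_const _).abs
  rw [abs_sub_comm]
  exact le_of_tendsto h3 ((eventually_ge_atTop r).mono fun b hb => key r b hr hb)

/-- Control of a solution in null coordinates on the diagonal `x = y` (that is, at time zero), which
propagates to `x - y ≤ 2 * T`. -/
structure DiagBound (w a b g : ℝ → ℝ → ℝ) (β' β : ℝ → ℝ) (T C₀ Cs B : ℝ) : Prop where
  sol : NullSol 0 w a b g
  cont : Continuous (fun p : ℝ × ℝ => w p.1 p.2)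
  T_nonneg : 0 ≤ T
  Cs_nonneg : 0 ≤ Cs
  source : ∀ x y, 1 ≤ x → 1 ≤ y → |g x y| ≤
    33 / 16 / ((x + y) / 2) ^ 2 * |w x y| + Cs * (√((x + y) / 2) / ((x + y) / 2) ^ 2)
  diag : ∀ x, 1 ≤ x → |w x x| ≤ C₀ * √x
  diag_b : ∀ y, 1 ≤ y → |b y y| ≤ β' y
  hasDeriv : ∀ y, 1 ≤ y → HasDerivAt β (β' y) y
  var : ∀ x y, 1 ≤ y → y ≤ x → x ≤ y + 2 * T → β x - β y ≤ B

namespace DiagBound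

variable {w a b g : ℝ → ℝ → ℝ} {β' β : ℝ → ℝ} {T C₀ Cs B : ℝ}

lemma hasDerivAt_exp_left (c x y : ℝ) :
    HasDerivAt (fun x => c * exp (3 * (x - y))) (3 * c * exp (3 * (x - y))) x :=
  ((((hasDerivAt_id x).sub_const y).const_mul 3).exp.const_mul c).of_eq (fun _ => rfl)
    (by simp only [id]; ring)

lemma hasDerivAt_exp_right (c x y : ℝ) :
    HasDerivAt (fun y => -(c * exp (3 * (x - y)))) (3 * c * exp (3 * (x - y))) y :=
  ((((hasDerivAt_id y).const_sub x).const_mul 3).exp.const_mul c).neg.of_eq (fun _ => rfl)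
    (by simp only [id]; ring)

lemma sqrt_div_sq_le {r : ℝ} (hr : 1 ≤ r) : √r / r ^ 2 ≤ 1 / r := by
  have h1 : √r ≤ r := Real.sqrt_le_self_iff.2 (Or.inr hr)
  calc √r / r ^ 2 ≤ r / r ^ 2 := by gcongr
    _ = 1 / r := by field_simp

/-- An exponentially weighted bound on a truncated region improves itself. -/
lemma improve (h : DiagBound w a b g β' β T C₀ Cs B) {X M : ℝ} (hM : 0 ≤ M)
    (hw : ∀ x y, 1 ≤ y → y ≤ x → x ≤ y + 2 * T → x ≤ X →
      |w x y| ≤ M * (√((x + y) / 2) * exp (3 * (x - y)))) {x y : ℝ} (hy : 1 ≤ y) (hxy : y ≤ x)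
    (hxT : x ≤ y + 2 * T) (hX : x ≤ X) :
    |w x y| ≤ |w x x| + B + 4 * T ^ 2 * Cs + 33 / 144 * M * exp (3 * (x - y)) := by
  have hT := h.T_nonneg
  have hCs := h.Cs_nonneg
  have hb : ∀ z, y ≤ z → z ≤ x → |b x z| ≤
      β' z + (33 / 48 * M * exp (3 * (x - z)) + Cs * (2 * T)) := by
    intro z hz hzx
    have hz1 : 1 ≤ z := hy.trans hz
    have h1 := abs_sub_le_of_abs_deriv_le (f := fun x => b x z) (f' := fun x => g x z)
      (g := fun x => 33 / 48 * M * exp (3 * (x - z)) + Cs * x)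
      (g' := fun x => 3 * (33 / 48 * M) * exp (3 * (x - z)) + Cs) hzx
      (fun s hs => h.sol.bx s z (by linarith [hs.1]) (by linarith))
      (fun s hs => ((hasDerivAt_exp_left _ s z).add ((hasDerivAt_id s).const_mul Cs)).of_eq
        (fun _ => rfl) (by simp)) (fun s hs => ?_)
    · have h2 := h.diag_b z hz1
      have h3 : 0 ≤ 33 / 48 * M * exp (3 * (z - z)) := by positivity
      have h4 := abs_sub_abs_le_abs_sub (b x z) (b z z)
      have h5 : Cs * x - Cs * z ≤ Cs * (2 * T) := by
        rw [← mul_sub]; gcongr; linarith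
      linarith
    · have hr : 1 ≤ (s + z) / 2 := by linarith [hs.1]
      have h2 := h.source s z (by linarith [hs.1]) hz1
      have h3 := hw s z hz1 hs.1 (by linarith [hs.2]) (by linarith [hs.2])
      have h4 := sqrt_div_sq_le hr
      have h5 : 1 / ((s + z) / 2) ≤ 1 := by
        rw [div_le_one (by linarith)]; exact hr
      calc |g s z| ≤ 33 / 16 / ((s + z) / 2) ^ 2 *
            (M * (√((s + z) / 2) * exp (3 * (s - z)))) +
              Cs * (√((s + z) / 2) / ((s + z) / 2) ^ 2) :=
            h2.trans (by gcongr)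
        _ = 33 / 16 * M * exp (3 * (s - z)) * (√((s + z) / 2) / ((s + z) / 2) ^ 2) +
            Cs * (√((s + z) / 2) / ((s + z) / 2) ^ 2) := by ring
        _ ≤ 33 / 16 * M * exp (3 * (s - z)) * 1 + Cs * 1 := by gcongr <;> linarith
        _ = _ := by ring
  have h1 := abs_sub_le_of_abs_deriv_le (f := fun z => w x z) (f' := fun z => b x z)
      (g := fun z => β z + (-(33 / 144 * M * exp (3 * (x - z))) + Cs * (2 * T) * z))
      (g' := fun z => β' z + (3 * (33 / 144 * M) * exp (3 * (x - z)) + Cs * (2 * T))) hxy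
      (fun s hs => h.sol.dy x s (by linarith [hs.1]) (by linarith [hs.1]))
      (fun s hs => ((h.hasDeriv s (hy.trans hs.1)).add ((hasDerivAt_exp_right _ x s).add
        ((hasDerivAt_id s).const_mul (Cs * (2 * T))))).of_eq
        (fun _ => rfl) (by simp)) (fun s hs => (hb s hs.1 hs.2).trans (le_of_eq (by ring)))
  have h2 := h.var x y hy hxy hxT
  have h3 := abs_sub_abs_le_abs_sub (w x y) (w x x)
  rw [abs_sub_comm] at h3
  have h4 : 0 ≤ 33 / 144 * M * exp (3 * (x - x)) := by positivity
  have h5 : Cs * (2 * T) * x - Cs * (2 * T) * y ≤ 4 * T ^ 2 * Cs := by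
    calc Cs * (2 * T) * x - Cs * (2 * T) * y = Cs * (2 * T) * (x - y) := by ring
      _ ≤ Cs * (2 * T) * (2 * T) := by gcongr; linarith
      _ = _ := by ring
  linarith

lemma bound_w (h : DiagBound w a b g β' β T C₀ Cs B) {x y : ℝ} (hy : 1 ≤ y) (hxy : y ≤ x)
    (hxT : x ≤ y + 2 * T) :
    |w x y| ≤ 4 / 3 * (2 * C₀ + B + 4 * T ^ 2 * Cs) * exp (6 * T) * √((x + y) / 2) := by
  have hT := h.T_nonneg
  have hCs := h.Cs_nonneg
  have hB : 0 ≤ B := by simpa using h.var 1 1 le_rfl le_rfl (by linarith)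
  have hC₀ : 0 ≤ C₀ := by
    have := (abs_nonneg _).trans (h.diag 1 le_rfl)
    simpa using this
  set X := x with hXdef
  let K : Set (ℝ × ℝ) := (Icc 1 X ×ˢ Icc 1 X) ∩ {p | p.2 ≤ p.1} ∩ {p | p.1 ≤ p.2 + 2 * T}
  have hK : IsCompact K := ((isCompact_Icc.prod isCompact_Icc).inter_right
    (isClosed_le continuous_snd continuous_fst)).inter_right
    (isClosed_le continuous_fst (by fun_prop))
  have hxK : (x, y) ∈ K := ⟨⟨⟨⟨hy.trans hxy, le_rfl⟩, ⟨hy, hxy⟩⟩, hxy⟩, hxT⟩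
  have hpos : ∀ p ∈ K, 1 ≤ (p.1 + p.2) / 2 := fun p hp => by
    have h1 := hp.1.1.1.1
    have h2 := hp.1.1.2.1
    linarith
  have hcont : ContinuousOn
      (fun p : ℝ × ℝ => |w p.1 p.2| / (√((p.1 + p.2) / 2) * exp (3 * (p.1 - p.2)))) K := by
    refine ContinuousOn.div h.cont.abs.continuousOn (by fun_prop) fun p hp => ?_
    have : 0 < √((p.1 + p.2) / 2) := Real.sqrt_pos.2 (by linarith [hpos p hp])
    positivity
  obtain ⟨q, hq, hmax⟩ := hK.exists_isMaxOn ⟨_, hxK⟩ hcont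
  set M := |w q.1 q.2| / (√((q.1 + q.2) / 2) * exp (3 * (q.1 - q.2))) with hM
  have hM0 : 0 ≤ M := by positivity
  have hw : ∀ x y, 1 ≤ y → y ≤ x → x ≤ y + 2 * T → x ≤ X →
      |w x y| ≤ M * (√((x + y) / 2) * exp (3 * (x - y))) := by
    intro x y hy hxy hxT hX
    have hmem : (x, y) ∈ K := ⟨⟨⟨⟨hy.trans hxy, hX⟩, ⟨hy, hxy.trans hX⟩⟩, hxy⟩, hxT⟩
    have h0 : 0 < √((x + y) / 2) := Real.sqrt_pos.2 (by linarith)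
    have h1 : |w x y| / (√((x + y) / 2) * exp (3 * (x - y))) ≤ M := hmax hmem
    rwa [div_le_iff₀ (by positivity)] at h1
  have hMle : M ≤ 4 / 3 * (2 * C₀ + B + 4 * T ^ 2 * Cs) := by
    have hq1 := hpos q hq
    have h0 : 1 ≤ √((q.1 + q.2) / 2) := Real.one_le_sqrt.2 hq1
    have h2 : 1 ≤ exp (3 * (q.1 - q.2)) :=
      Real.one_le_exp (by linarith [show q.2 ≤ q.1 from hq.1.2])
    have h1 := h.improve hM0 hw hq.1.1.2.1 hq.1.2 hq.2 hq.1.1.1.2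
    have h3 := h.diag q.1 hq.1.1.1.1
    have h4 : √q.1 ≤ 2 * √((q.1 + q.2) / 2) := by
      rw [Real.sqrt_le_left (by positivity), mul_pow, Real.sq_sqrt (by linarith)]
      linarith [hq.1.1.1.1, hq.1.1.2.1]
    set E := exp (3 * (q.1 - q.2))
    set S := √((q.1 + q.2) / 2)
    have h5 : |w q.1 q.2| = M * (S * E) := by rw [hM]; field_simp
    have h6 : 1 ≤ S * E := one_le_mul_of_one_le_of_one_le h0 h2
    have h7 : M * (S * E) ≤ (2 * C₀ + B + 4 * T ^ 2 * Cs + 33 / 144 * M) * (S * E) := by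
      have e1 : C₀ * √q.1 ≤ C₀ * (2 * (S * E)) := by
        gcongr
        nlinarith
      have e2 : (B + 4 * T ^ 2 * Cs) * 1 ≤ (B + 4 * T ^ 2 * Cs) * (S * E) := by gcongr
      have e3 : 33 / 144 * M * (1 * E) ≤ 33 / 144 * M * (S * E) := by gcongr
      linarith
    have h8 := le_of_mul_le_mul_right h7 (by linarith)
    linarith
  have h1 := hw x y hy hxy hxT le_rfl
  have h2 : exp (3 * (x - y)) ≤ exp (6 * T) := exp_le_exp.2 (by linarith)
  calc |w x y| ≤ M * (√((x + y) / 2) * exp (3 * (x - y))) := h1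
    _ ≤ (4 / 3 * (2 * C₀ + B + 4 * T ^ 2 * Cs)) * (√((x + y) / 2) * exp (6 * T)) := by
      gcongr
    _ = _ := by ring

lemma bound_g (h : DiagBound w a b g β' β T C₀ Cs B) : ∃ C, 0 ≤ C ∧ ∀ x y, 1 ≤ y → y ≤ x →
    x ≤ y + 2 * T → |w x y| ≤ C * √((x + y) / 2) ∧ |g x y| ≤ C * (1 / ((x + y) / 2)) := by
  have hCs := h.Cs_nonneg
  set C₁ := 4 / 3 * (2 * C₀ + B + 4 * T ^ 2 * Cs) * exp (6 * T) with hC₁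
  have hC₁0 : 0 ≤ C₁ := by
    have h1 := (abs_nonneg _).trans (h.bound_w le_rfl le_rfl (by linarith [h.T_nonneg]))
    simpa using h1
  refine ⟨C₁ * 3 + Cs, by positivity, fun x y hy hxy hxT => ?_⟩
  have h1 := h.bound_w hy hxy hxT
  rw [← hC₁] at h1
  have hr : 1 ≤ (x + y) / 2 := by linarith
  have h2 := h.source x y (hy.trans hxy) hy
  have h3 := sqrt_div_sq_le hr
  set r := (x + y) / 2
  have hr0 : 0 < r := by linarith
  constructor
  · refine h1.trans ?_
    gcongr
    linarith
  · calc |g x y| ≤ 33 / 16 / r ^ 2 * (C₁ * √r) + Cs * (√r / r ^ 2) := h2.trans (by gcongr)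
      _ = (C₁ * (33 / 16) + Cs) * (√r / r ^ 2) := by ring
      _ ≤ (C₁ * 3 + Cs) * (1 / r) := by gcongr; norm_num

/-- Up to time `T`, the null derivatives are close to those of the free evolution. -/
theorem bounds (h : DiagBound w a b g β' β T C₀ Cs B) : ∃ C, 0 ≤ C ∧ ∀ x y, 1 ≤ y → y ≤ x →
    x ≤ y + 2 * T → |w x y| ≤ C * √((x + y) / 2) ∧ |w x y - w x x| ≤ C ∧
      |a x y - a x x| ≤ C / ((x + y) / 2) ∧ |b x y - b y y| ≤ C / ((x + y) / 2) := by
  obtain ⟨C, hC, hwg⟩ := h.bound_g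
  have hT := h.T_nonneg
  have hCs := h.Cs_nonneg
  have hB : 0 ≤ B := by simpa using h.var 1 1 le_rfl le_rfl (by linarith)
  have hb : ∀ x y, 1 ≤ y → y ≤ x → x ≤ y + 2 * T →
      |b x y - b y y| ≤ C * (1 + T) * (2 * T) / ((x + y) / 2) := by
    intro x y hy hxy hxT
    have h1 := abs_sub_le_of_abs_deriv_le (f := fun x => b x y) (f' := fun x => g x y)
      (g := fun s => C * (1 + T) / ((x + y) / 2) * s)
      (g' := fun s => C * (1 + T) / ((x + y) / 2)) hxy
      (fun s hs => h.sol.bx s y (by linarith [hs.1]) (by linarith))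
      (fun s hs => ((hasDerivAt_id s).const_mul _).of_eq
        (fun _ => rfl) (by simp)) (fun s hs => ?_)
    · refine h1.trans ?_
      rw [← mul_sub, div_mul_eq_mul_div]
      have hr : 0 < (x + y) / 2 := by linarith
      gcongr
      linarith
    · refine (hwg s y hy hs.1 (by linarith [hs.2])).2.trans ?_
      have := hs.1
      have h2 : 1 / ((s + y) / 2) ≤ (1 + T) / ((x + y) / 2) := by
        rw [div_le_div_iff₀ (by linarith) (by linarith)]
        nlinarith
      rw [mul_div_assoc]
      gcongr
  have ha : ∀ x y, 1 ≤ y → y ≤ x → x ≤ y + 2 * T →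
      |a x y - a x x| ≤ C * (2 * T) / ((x + y) / 2) := by
    intro x y hy hxy hxT
    have h1 := abs_sub_le_of_abs_deriv_le (f := fun y => a x y) (f' := fun y => g x y)
      (g := fun s => C / ((x + y) / 2) * s)
      (g' := fun s => C / ((x + y) / 2)) hxy
      (fun s hs => h.sol.ay x s (by linarith [hs.1]) (by linarith [hs.1]))
      (fun s hs => ((hasDerivAt_id s).const_mul _).of_eq
        (fun _ => rfl) (by simp)) (fun s hs => ?_)
    · rw [abs_sub_comm]
      refine h1.trans ?_
      rw [← mul_sub, div_mul_eq_mul_div]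
      have hr : 0 < (x + y) / 2 := by linarith
      gcongr
      linarith
    · refine (hwg x s (hy.trans hs.1) hs.2 (by linarith [hs.1])).2.trans ?_
      rw [mul_one_div]
      have := hs.1
      have hr : 0 < (x + y) / 2 := by linarith
      gcongr
  have hw : ∀ x y, 1 ≤ y → y ≤ x → x ≤ y + 2 * T →
      |w x y - w x x| ≤ B + C * (1 + T) * (2 * T) * (2 * T) := by
    intro x y hy hxy hxT
    have h1 := abs_sub_le_of_abs_deriv_le (f := fun z => w x z) (f' := fun z => b x z)
      (g := fun s => β s + C * (1 + T) * (2 * T) * s)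
      (g' := fun s => β' s + C * (1 + T) * (2 * T)) hxy
      (fun s hs => h.sol.dy x s (by linarith [hs.1]) (by linarith [hs.1]))
      (fun s hs => ((h.hasDeriv s (hy.trans hs.1)).add ((hasDerivAt_id s).const_mul _)).of_eq
        (fun _ => rfl) (by simp)) (fun s hs => ?_)
    · rw [abs_sub_comm]
      have h2 := h.var x y hy hxy hxT
      have h3 : C * (1 + T) * (2 * T) * (x - y) ≤ C * (1 + T) * (2 * T) * (2 * T) := by
        gcongr
        linarith
      linarith
    · have h2 := h.diag_b s (hy.trans hs.1)
      have h3 := hb x s (hy.trans hs.1) hs.2 (by linarith [hs.1])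
      have h4 := abs_sub_abs_le_abs_sub (b x s) (b s s)
      have h5 : C * (1 + T) * (2 * T) / ((x + s) / 2) ≤ C * (1 + T) * (2 * T) :=
        div_le_self (by positivity) (by linarith [hs.1])
      linarith
  refine ⟨C + (B + C * (1 + T) * (2 * T) * (2 * T)) + C * (2 * T) + C * (1 + T) * (2 * T),
    by positivity, fun x y hy hxy hxT => ⟨?_, ?_, ?_, ?_⟩⟩
  · refine (hwg x y hy hxy hxT).1.trans ?_
    gcongr
    have : 0 ≤ C * (1 + T) * (2 * T) * (2 * T) := by positivity
    have : 0 ≤ C * (1 + T) * (2 * T) := by positivity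
    have : 0 ≤ C * (2 * T) := by positivity
    linarith
  · refine (hw x y hy hxy hxT).trans ?_
    have : 0 ≤ C * (1 + T) * (2 * T) := by positivity
    have : 0 ≤ C * (2 * T) := by positivity
    linarith
  · refine (ha x y hy hxy hxT).trans ?_
    have : 0 ≤ C * (1 + T) * (2 * T) * (2 * T) := by positivity
    have : 0 ≤ C * (1 + T) * (2 * T) := by positivity
    gcongr
    · linarith
    · linarith
  · refine (hb x y hy hxy hxT).trans ?_
    have : 0 ≤ C * (1 + T) * (2 * T) * (2 * T) := by positivity
    have : 0 ≤ C * (2 * T) := by positivity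
    gcongr
    · linarith
    · linarith

end DiagBound

namespace RadialWave

variable (U : RadialWave)

lemma continuous_Fr_radius (t : ℝ) : Continuous (U.Fr t) :=
  U.continuous_Fr.comp (by fun_prop : Continuous fun r : ℝ => (t, r))

lemma continuous_Ft_radius (t : ℝ) : Continuous (U.Ft t) :=
  U.continuous_Ft.comp (by fun_prop : Continuous fun r : ℝ => (t, r))

lemma radial_energy_le (t : ℝ) {r : ℝ} (hr : 0 ≤ r) : r ^ 5 * U.Fr t r ^ 2 ≤ U.energy t r := by
  unfold energy
  gcongr
  nlinarith [sq_nonneg (U.Ft t r)]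

lemma integrableOn_radial_energy {t ρ : ℝ} (hρ : 0 ≤ ρ) (hE : IntegrableOn (U.energy t) (Ioi ρ)) :
    IntegrableOn (fun r => r ^ 5 * U.Fr t r ^ 2) (Ioi ρ) := by
  have h1 := U.continuous_Fr_radius t
  refine Integrable.mono' hE
    (by fun_prop : Continuous fun r => r ^ 5 * U.Fr t r ^ 2).aestronglyMeasurable ?_
  filter_upwards [ae_restrict_mem measurableSet_Ioi] with r hr
  have hr0 : 0 ≤ r := hρ.trans (le_of_lt hr)
  rw [norm_of_nonneg (by positivity)]
  exact U.radial_energy_le t hr0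

/-- At each time the wave has a limit at spatial infinity. -/
lemma exists_tendsto {t ρ : ℝ} (hρ : 0 < ρ) (hE : IntegrableOn (U.energy t) (Ioi ρ)) :
    ∃ ℓ, Tendsto (U.F t) atTop (𝓝 ℓ) ∧
      ∀ r, ρ < r → |U.F t r - ℓ| ≤ ((∫ s in Ioi ρ, U.energy t s) / 2 + 1 / 8) / r ^ 2 := by
  refine exists_tendsto_of_energy hρ (fun r _ => U.hasDerivAt_F_radius t r)
    (U.continuous_Fr_radius t) (U.integrableOn_radial_energy hρ.le hE) ?_
  refine setIntegral_mono_on (U.integrableOn_radial_energy hρ.le hE) hE measurableSet_Ioi ?_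
  exact fun r hr => U.radial_energy_le t (hρ.le.trans (le_of_lt hr))

lemma weight_sq {r : ℝ} (hr : 0 ≤ r) : (√r * r ^ 2) ^ 2 = r ^ 5 := by
  rw [mul_pow, Real.sq_sqrt hr]; ring

lemma abs_weight_mul_le {r : ℝ} (hr : 0 ≤ r) (z : ℝ) :
    |√r * r ^ 2 * z| ≤ 1 / 2 * (r ^ 5 * z ^ 2) + 1 / 2 := by
  have h1 := two_mul_le_add_sq |√r * r ^ 2 * z| 1
  rw [sq_abs, mul_pow, weight_sq hr] at h1
  linarith

lemma nullW_diag (ℓ x : ℝ) : U.nullW ℓ x x = √x * x ^ 2 * (U.F 0 x - ℓ) := by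
  simp [nullW]

lemma nullA_diag (ℓ x : ℝ) : U.nullA ℓ x x =
    1 / 2 * (√x * x ^ 2 * (U.Fr 0 x + U.Ft 0 x) + 5 / 2 * (U.nullW ℓ x x / x)) := by
  simp [nullA]

lemma nullB_diag (ℓ x : ℝ) : U.nullB ℓ x x =
    1 / 2 * (√x * x ^ 2 * (U.Fr 0 x - U.Ft 0 x) + 5 / 2 * (U.nullW ℓ x x / x)) := by
  simp [nullB]

lemma abs_nullW_diag_le {ℓ C₀ : ℝ} (h0 : ∀ r, 1 ≤ r → |U.F 0 r - ℓ| ≤ C₀ / r ^ 2) {x : ℝ}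
    (hx : 1 ≤ x) : |U.nullW ℓ x x| ≤ C₀ * √x := by
  have hx0 : 0 < x := by linarith
  rw [nullW_diag, abs_mul, abs_of_nonneg (by positivity : 0 ≤ √x * x ^ 2)]
  calc √x * x ^ 2 * |U.F 0 x - ℓ| ≤ √x * x ^ 2 * (C₀ / x ^ 2) := by
        gcongr
        exact h0 x hx
    _ = _ := by field_simp

lemma abs_nullG_le (ℓ : ℝ) {x y : ℝ} (hr : 0 < (x + y) / 2) : |U.nullG ℓ x y| ≤
    33 / 16 / ((x + y) / 2) ^ 2 * |U.nullW ℓ x y| +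
      288 * |ℓ| * (√((x + y) / 2) / ((x + y) / 2) ^ 2) := by
  have h1 := abs_nullPotential_le hr
  have h2 := abs_potential_le hr
  unfold nullG
  refine (abs_add_le _ _).trans ?_
  set r := (x + y) / 2
  rw [abs_mul, abs_mul, abs_mul, abs_div, abs_of_nonneg (by positivity : 0 ≤ √r * r ^ 2),
    abs_of_pos (by norm_num : (0 : ℝ) < 4)]
  have h3 : |potential r| / 4 * (√r * r ^ 2 * |ℓ|) ≤ 1152 / r ^ 4 / 4 * (√r * r ^ 2 * |ℓ|) := by
    gcongr
  have h4 : 1152 / r ^ 4 / 4 * (√r * r ^ 2 * |ℓ|) = 288 * |ℓ| * (√r / r ^ 2) := by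
    field_simp
    ring
  rw [← h4]
  gcongr

lemma diagBound {ℓ C₀ T : ℝ} (h0 : ∀ r, 1 ≤ r → |U.F 0 r - ℓ| ≤ C₀ / r ^ 2)
    (hE : IntegrableOn (U.energy 0) (Ioi 1)) (hT : 0 ≤ T) :
    DiagBound (U.nullW ℓ) (U.nullA ℓ) (U.nullB ℓ) (U.nullG ℓ)
      (fun y => U.energy 0 y + (1 / 2 + 5 / 2 * C₀))
      (fun y => (∫ s in (1 : ℝ)..y, U.energy 0 s) + (1 / 2 + 5 / 2 * C₀) * y) T C₀ (288 * |ℓ|)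
      ((∫ s in Ioi 1, U.energy 0 s) + (1 / 2 + 5 / 2 * C₀) * (2 * T)) := by
  have hC₀ : 0 ≤ C₀ := by simpa using (abs_nonneg _).trans (h0 1 le_rfl)
  refine ⟨U.nullSol ℓ, U.continuous_nullW ℓ, hT, by positivity, fun x y hx hy =>
    U.abs_nullG_le ℓ (by linarith), fun x hx => U.abs_nullW_diag_le h0 hx, fun y hy => ?_,
    fun y hy => ?_, fun x y hy hxy hxT => ?_⟩
  · have hy0 : 0 < y := by linarith
    have h1 := U.abs_nullW_diag_le h0 hy
    have h2 := abs_weight_mul_le hy0.le (U.Fr 0 y - U.Ft 0 y)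
    have h3 : y ^ 5 * (U.Fr 0 y - U.Ft 0 y) ^ 2 ≤ y ^ 5 * (2 * (U.Ft 0 y ^ 2 + U.Fr 0 y ^ 2)) := by
      gcongr
      nlinarith [sq_nonneg (U.Fr 0 y + U.Ft 0 y)]
    have h4 : |U.nullW ℓ y y / y| ≤ C₀ := by
      rw [abs_div, abs_of_pos hy0, div_le_iff₀ hy0]
      have : √y ≤ y := Real.sqrt_le_self_iff.2 (Or.inr hy)
      nlinarith
    have h5 := U.energy_nonneg 0 hy0.le
    have h6 : y ^ 5 * (2 * (U.Ft 0 y ^ 2 + U.Fr 0 y ^ 2)) = 2 * U.energy 0 y := by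
      unfold energy; ring
    rw [nullB_diag, abs_mul, abs_of_pos (by norm_num : (0 : ℝ) < 1 / 2)]
    have h7 := abs_add_le (√y * y ^ 2 * (U.Fr 0 y - U.Ft 0 y)) (5 / 2 * (U.nullW ℓ y y / y))
    rw [abs_mul (5 / 2), abs_of_pos (by norm_num : (0 : ℝ) < 5 / 2)] at h7
    linarith
  · exact (((U.continuous_energy 0).integral_hasStrictDerivAt 1 y).hasDerivAt.add
      ((hasDerivAt_id y).const_mul _)).of_eq (fun _ => rfl) (by simp)
  · have h1 : (∫ s in (1 : ℝ)..x, U.energy 0 s) - ∫ s in (1 : ℝ)..y, U.energy 0 s ≤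
        ∫ s in Ioi 1, U.energy 0 s := by
      rw [intervalIntegral.integral_interval_sub_left
        ((U.continuous_energy 0).intervalIntegrable _ _)
        ((U.continuous_energy 0).intervalIntegrable _ _), intervalIntegral.integral_of_le hxy]
      refine setIntegral_mono_set hE ?_
        (LE.le.eventuallyLE (show Ioc y x ≤ Ioi 1 from fun r hr => hy.trans_lt hr.1))
      filter_upwards [ae_restrict_mem measurableSet_Ioi] with r hr
      exact U.energy_nonneg 0 (zero_le_one.trans (le_of_lt hr))
    have h2 : (1 / 2 + 5 / 2 * C₀) * (x - y) ≤ (1 / 2 + 5 / 2 * C₀) * (2 * T) := by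
      gcongr
      linarith
    linarith

lemma abs_nullW_diag_sub_le {ℓ C₀ T : ℝ} (h0 : ∀ r, 1 ≤ r → |U.F 0 r - ℓ| ≤ C₀ / r ^ 2)
    (hE : IntegrableOn (U.energy 0) (Ioi 1)) (hT : 0 ≤ T) {x y : ℝ} (hy : 1 ≤ y) (hxy : y ≤ x)
    (hxT : x ≤ y + 2 * T) : |U.nullW ℓ x x - U.nullW ℓ y y| ≤
      (∫ s in Ioi 1, U.energy 0 s) + (1 / 2 + 5 / 2 * C₀) * (2 * T) := by
  have h := U.diagBound h0 hE hT
  refine (abs_sub_le_of_abs_deriv_le (f := fun x => U.nullW ℓ x x)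
    (f' := fun x => 5 / 2 * (√x * x) * (U.F 0 x - ℓ) + √x * x ^ 2 * U.Fr 0 x) hxy
    (fun s hs => ?_) (fun s hs => h.hasDeriv s (hy.trans hs.1)) (fun s hs => ?_)).trans
    (h.var x y hy hxy hxT)
  · have hs0 : 0 < s := by linarith [hs.1]
    refine ((hasDerivAt_weight (hasDerivAt_id s) hs0).mul
      ((U.hasDerivAt_F_radius 0 s).sub_const ℓ)).of_eq (fun z => U.nullW_diag ℓ z) ?_
    simp
  · have hs1 : 1 ≤ s := hy.trans hs.1
    have hs0 : 0 < s := by linarith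
    have h1 := abs_weight_mul_le hs0.le (U.Fr 0 s)
    have h2 := U.radial_energy_le 0 hs0.le
    have h3 := U.energy_nonneg 0 hs0.le
    have h4 : |5 / 2 * (√s * s) * (U.F 0 s - ℓ)| ≤ 5 / 2 * C₀ := by
      have hC₀ : 0 ≤ C₀ := by simpa using (abs_nonneg _).trans (h0 1 le_rfl)
      have h5 : √s ≤ s := Real.sqrt_le_self_iff.2 (Or.inr hs1)
      rw [abs_mul, abs_of_nonneg (by positivity : 0 ≤ 5 / 2 * (√s * s))]
      calc 5 / 2 * (√s * s) * |U.F 0 s - ℓ| ≤ 5 / 2 * (s * s) * (C₀ / s ^ 2) := by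
            gcongr
            exact h0 s hs1
        _ = _ := by field_simp
    refine (abs_add_le _ _).trans ?_
    linarith

lemma abs_div_sub_div_le {u v c z r T C : ℝ} (hz : 1 ≤ z) (hr : 0 < r) (hzr : |z - r| ≤ T)
    (huv : |u - v| ≤ c) (hv : |v| ≤ C * √z) : |u / r - v / z| ≤ (c + C * T) / r := by
  have hz0 : 0 < z := by linarith
  have h1 : u / r - v / z = ((u - v) + v / z * (z - r)) / r := by field_simp; ring
  have h2 : |v / z| ≤ C := by
    rw [abs_div, abs_of_pos hz0, div_le_iff₀ hz0]
    have h3 : √z ≤ z := Real.sqrt_le_self_iff.2 (Or.inr hz)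
    have h4 : 0 < √z := Real.sqrt_pos.2 hz0
    have hC : 0 ≤ C := by
      by_contra! hC
      nlinarith [abs_nonneg v]
    nlinarith
  rw [h1, abs_div, abs_of_pos hr]
  have h5 : |v / z * (z - r)| ≤ C * T := by
    rw [abs_mul]
    exact mul_le_mul h2 hzr (abs_nonneg _) ((abs_nonneg _).trans h2)
  gcongr
  exact (abs_add_le _ _).trans (by linarith)

lemma sq_le_of_abs_sub_le {p q c : ℝ} (h : |p - q| ≤ c) : p ^ 2 ≤ 2 * q ^ 2 + 2 * c ^ 2 := by
  have h1 : (p - q) ^ 2 ≤ c ^ 2 := by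
    rw [← sq_abs]
    gcongr
  nlinarith [sq_nonneg (p - 2 * q)]

lemma outgoing_le (t : ℝ) {r : ℝ} (hr : 0 ≤ r) :
    r ^ 5 * (U.Fr t r + U.Ft t r) ^ 2 ≤ 2 * U.energy t r := by
  have : 0 ≤ r ^ 5 * (U.Fr t r - U.Ft t r) ^ 2 := by positivity
  unfold energy
  linarith

lemma incoming_le (t : ℝ) {r : ℝ} (hr : 0 ≤ r) :
    r ^ 5 * (U.Fr t r - U.Ft t r) ^ 2 ≤ 2 * U.energy t r := by
  have : 0 ≤ r ^ 5 * (U.Fr t r + U.Ft t r) ^ 2 := by positivity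
  unfold energy
  linarith

lemma abs_sub_le_of_null {a a₀ p p₀ u v c d : ℝ} (ha : a = 1 / 2 * (p + 5 / 2 * u))
    (ha₀ : a₀ = 1 / 2 * (p₀ + 5 / 2 * v)) (h : |a - a₀| ≤ c) (huv : |u - v| ≤ d) :
    |p - p₀| ≤ 2 * c + 5 / 2 * d := by
  rw [abs_le] at *
  constructor <;> linarith

lemma forward_bounds {ℓ C₀ T : ℝ} (h0 : ∀ r, 1 ≤ r → |U.F 0 r - ℓ| ≤ C₀ / r ^ 2)
    (hE : IntegrableOn (U.energy 0) (Ioi 1)) (hT : 0 ≤ T) : ∃ C, ∀ t r, 0 ≤ t → t ≤ T → 1 + t ≤ r →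
      |U.F t r - ℓ| ≤ C / r ^ 2 ∧
      U.energy t r ≤ 2 * U.energy 0 (r + t) + 2 * U.energy 0 (r - t) + C / r ^ 2 := by
  obtain ⟨C, hC, hb⟩ := (U.diagBound h0 hE hT).bounds
  obtain ⟨B, hBd⟩ : ∃ B, ∀ x y, 1 ≤ y → y ≤ x → x ≤ y + 2 * T →
      |U.nullW ℓ x x - U.nullW ℓ y y| ≤ B := ⟨_, fun x y => U.abs_nullW_diag_sub_le h0 hE hT⟩
  obtain ⟨D, hD⟩ : ∃ D, D = 2 * C + 5 / 2 * ((C + B) + C * T) := ⟨_, rfl⟩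
  have hB : 0 ≤ B := (abs_nonneg _).trans (hBd 1 1 le_rfl le_rfl (by linarith))
  refine ⟨C + 2 * D ^ 2, fun t r ht htT htr => ?_⟩
  have hr0 : 0 < r := by linarith
  have hx : (r + t + (r - t)) / 2 = r := by ring
  have hx' : (r + t - (r - t)) / 2 = t := by ring
  have hb1 := hb (r + t) (r - t) (by linarith) (by linarith) (by linarith)
  have hb2 := hb (r + t) (r + t) (by linarith) (by linarith) (by linarith)
  have hb3 := hb (r - t) (r - t) (by linarith) (by linarith) (by linarith)
  have hb4 := hBd (r + t) (r - t) (by linarith) (by linarith) (by linarith)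
  simp only [hx] at hb1
  obtain ⟨hw, hwx, ha, hbb⟩ := hb1
  have hwx2 := hb2.1
  have hwy2 := hb3.1
  rw [add_self_div_two] at hwx2 hwy2
  have eW : U.nullW ℓ (r + t) (r - t) = √r * r ^ 2 * (U.F t r - ℓ) := by
    simp only [nullW, hx, hx']
  have eA : U.nullA ℓ (r + t) (r - t) = 1 / 2 * (√r * r ^ 2 * (U.Fr t r + U.Ft t r) +
      5 / 2 * (U.nullW ℓ (r + t) (r - t) / r)) := by simp only [nullA, hx, hx']
  have eB : U.nullB ℓ (r + t) (r - t) = 1 / 2 * (√r * r ^ 2 * (U.Fr t r - U.Ft t r) +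
      5 / 2 * (U.nullW ℓ (r + t) (r - t) / r)) := by simp only [nullB, hx, hx']
  have eA0 := U.nullA_diag ℓ (r + t)
  have eB0 := U.nullB_diag ℓ (r - t)
  constructor
  · rw [eW, abs_mul, abs_of_nonneg (by positivity)] at hw
    have hs : 0 < √r := Real.sqrt_pos.2 hr0
    have h1 : r ^ 2 * |U.F t r - ℓ| ≤ C := by
      refine le_of_mul_le_mul_left ?_ hs
      linarith
    rw [le_div_iff₀ (by positivity), mul_comm]
    exact h1.trans (le_add_of_nonneg_right (by positivity))
  · have hp := abs_div_sub_div_le (z := r + t) (r := r) (T := T) (by linarith) hr0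
      (by rw [abs_of_nonneg] <;> linarith) hwx hwx2
    have hq := abs_div_sub_div_le (z := r - t) (r := r) (T := T)
      (u := U.nullW ℓ (r + t) (r - t)) (c := C + B) (by linarith) hr0
      (by rw [abs_of_nonpos] <;> linarith) ((abs_sub_le _ _ _).trans (add_le_add hwx hb4)) hwy2
    have hDr : D / r = 2 * (C / r) + 5 / 2 * ((C + B + C * T) / r) := by rw [hD]; ring
    have hp2 : |√r * r ^ 2 * (U.Fr t r + U.Ft t r) -
        √(r + t) * (r + t) ^ 2 * (U.Fr 0 (r + t) + U.Ft 0 (r + t))| ≤ D / r := by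
      have h1 : (C + C * T) / r ≤ (C + B + C * T) / r := by gcongr; linarith
      rw [hDr]
      exact abs_sub_le_of_null eA eA0 ha (hp.trans h1)
    have hq2 : |√r * r ^ 2 * (U.Fr t r - U.Ft t r) -
        √(r - t) * (r - t) ^ 2 * (U.Fr 0 (r - t) - U.Ft 0 (r - t))| ≤ D / r := by
      rw [hDr]
      exact abs_sub_le_of_null eB eB0 hbb hq
    have hp3 := sq_le_of_abs_sub_le hp2
    have hq3 := sq_le_of_abs_sub_le hq2
    rw [mul_pow, mul_pow (√(r + t) * _), weight_sq hr0.le, weight_sq (by linarith)] at hp3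
    rw [mul_pow, mul_pow (√(r - t) * _), weight_sq hr0.le, weight_sq (by linarith)] at hq3
    have h1 : U.energy t r = 1 / 2 * (r ^ 5 * (U.Fr t r + U.Ft t r) ^ 2 +
        r ^ 5 * (U.Fr t r - U.Ft t r) ^ 2) := by unfold energy; ring
    have h2 : (r + t) ^ 5 * (U.Fr 0 (r + t) + U.Ft 0 (r + t)) ^ 2 ≤ 2 * U.energy 0 (r + t) := by
      exact U.outgoing_le 0 (by linarith)
    have h3 : (r - t) ^ 5 * (U.Fr 0 (r - t) - U.Ft 0 (r - t)) ^ 2 ≤ 2 * U.energy 0 (r - t) :=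
      U.incoming_le 0 (by linarith)
    have h4 : (C + 2 * D ^ 2) / r ^ 2 = C / r ^ 2 + 2 * (D / r) ^ 2 := by ring
    have h5 : 0 ≤ C / r ^ 2 := by positivity
    rw [h1, h4]
    linarith

lemma energy_refl (t r : ℝ) : U.refl.energy t r = U.energy (-t) r := by
  simp [energy, refl]

lemma two_sided_bounds {ℓ C₀ T : ℝ} (h0 : ∀ r, 1 ≤ r → |U.F 0 r - ℓ| ≤ C₀ / r ^ 2)
    (hE : IntegrableOn (U.energy 0) (Ioi 1)) (hT : 0 ≤ T) : ∃ C, ∀ t r, |t| ≤ T → 1 + |t| ≤ r →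
      |U.F t r - ℓ| ≤ C / r ^ 2 ∧
      U.energy t r ≤ 2 * U.energy 0 (r + t) + 2 * U.energy 0 (r - t) + C / r ^ 2 := by
  have hE' : U.refl.energy 0 = U.energy 0 := by
    funext r
    rw [energy_refl, neg_zero]
  obtain ⟨C, hC⟩ := U.forward_bounds h0 hE hT
  obtain ⟨C', hC'⟩ := U.refl.forward_bounds (ℓ := ℓ) (C₀ := C₀)
    (by simpa only [refl, neg_zero] using h0) (by rwa [hE']) hT
  refine ⟨max C C', fun t r ht hr => ?_⟩
  have hr0 : 0 < r := by linarith [abs_nonneg t]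
  have h1 : C / r ^ 2 ≤ max C C' / r ^ 2 := by gcongr; exact le_max_left _ _
  have h2 : C' / r ^ 2 ≤ max C C' / r ^ 2 := by gcongr; exact le_max_right _ _
  rcases le_total 0 t with h | h
  · rw [abs_of_nonneg h] at ht hr
    have h3 := hC t r h ht hr
    exact ⟨h3.1.trans h1, h3.2.trans (by linarith)⟩
  · rw [abs_of_nonpos h] at ht hr
    have h3 := hC' (-t) r (by linarith) ht hr
    rw [energy_refl, hE', neg_neg, sub_neg_eq_add, ← sub_eq_add_neg] at h3
    simp only [refl, neg_neg] at h3
    exact ⟨h3.1.trans h2, h3.2.trans (by linarith)⟩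

lemma exists_initial_limit (hE : IntegrableOn (U.energy 0) (Ioi 0)) :
    ∃ ℓ C₀, ∀ r, 1 ≤ r → |U.F 0 r - ℓ| ≤ C₀ / r ^ 2 := by
  obtain ⟨ℓ, -, hℓ⟩ := U.exists_tendsto (t := 0) (ρ := 1 / 2) (by norm_num)
    (hE.mono_set (Ioi_subset_Ioi (by norm_num)))
  exact ⟨ℓ, _, fun r hr => hℓ r (by linarith)⟩

/-- For bounded times the wave differs by `O(r⁻²)` from a fixed constant. -/
theorem exists_limit (hE : IntegrableOn (U.energy 0) (Ioi 0)) :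
    ∃ ℓ, ∀ T, 0 ≤ T → ∃ C, ∀ t r, |t| ≤ T → 1 + |t| ≤ r → |U.F t r - ℓ| ≤ C / r ^ 2 := by
  obtain ⟨ℓ, C₀, h0⟩ := U.exists_initial_limit hE
  refine ⟨ℓ, fun T hT => ?_⟩
  obtain ⟨C, hC⟩ := U.two_sided_bounds h0 (hE.mono_set (Ioi_subset_Ioi zero_le_one)) hT
  exact ⟨C, fun t r ht hr => (hC t r ht hr).1⟩

lemma integrableOn_Ioi_comp_add {f : ℝ → ℝ} {c d s : ℝ} (hf : IntegrableOn f (Ioi c))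
    (hd : c ≤ d + s) : IntegrableOn (fun r => f (r + s)) (Ioi d) := by
  have h1 := (measurePreserving_add_right volume s).integrableOn_comp_preimage
    (MeasurableEquiv.addRight s).measurableEmbedding |>.2 hf
  refine IntegrableOn.mono_set h1 fun r hr => ?_
  simp only [mem_preimage, mem_Ioi] at *
  linarith

/-- Finite energy persists. -/
theorem integrableOn_energy (hE : IntegrableOn (U.energy 0) (Ioi 0)) (t : ℝ) {ρ : ℝ} :
    IntegrableOn (U.energy t) (Ioi ρ) := by
  obtain ⟨ℓ, C₀, h0⟩ := U.exists_initial_limit hE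
  obtain ⟨C, hC⟩ := U.two_sided_bounds h0 (hE.mono_set (Ioi_subset_Ioi zero_le_one)) (abs_nonneg t)
  have h1 : IntegrableOn (U.energy t) (Ioi (1 + |t|)) := by
    have i1 := integrableOn_Ioi_comp_add (d := 1 + |t|) (s := t) hE (by linarith [neg_abs_le t])
    have i2 := integrableOn_Ioi_comp_add (d := 1 + |t|) (s := -t) hE (by linarith [le_abs_self t])
    have i3 : IntegrableOn (fun r : ℝ => C * r ^ (-2 : ℝ)) (Ioi (1 + |t|)) :=
      (integrableOn_Ioi_rpow_of_lt (by norm_num) (by positivity)).const_mul C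
    refine Integrable.mono' (((i1.const_mul 2).add (i2.const_mul 2)).add i3)
      (U.continuous_energy t).aestronglyMeasurable ?_
    filter_upwards [ae_restrict_mem measurableSet_Ioi] with r hr
    have hr' : 1 + |t| < r := hr
    have hr0 : 0 < r := by linarith [abs_nonneg t]
    rw [norm_of_nonneg (U.energy_nonneg t hr0.le)]
    refine (hC t r le_rfl hr'.le).2.trans (le_of_eq ?_)
    simp only [Pi.add_apply, sub_eq_add_neg, Real.rpow_neg hr0.le, div_eq_mul_inv]
    norm_num
  have h2 : IntegrableOn (U.energy t) (Icc ρ (1 + |t|)) :=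
    (U.continuous_energy t).continuousOn.integrableOn_Icc
  refine (h2.union h1).mono_set fun r hr => ?_
  by_cases h : r ≤ 1 + |t|
  · exact Or.inl ⟨le_of_lt hr, h⟩
  · exact Or.inr (not_le.1 h)

end RadialWave

namespace RadialWave

/-- An odd-in-time wave of finite energy whose exterior energy vanishes as time goes to infinity. -/
structure OddNonRad (v : RadialWave) (ρ : ℝ) : Prop where
  odd_F : ∀ t r, v.F (-t) r = -v.F t r
  odd_Fr : ∀ t r, v.Fr (-t) r = -v.Fr t r
  even_Ft : ∀ t r, v.Ft (-t) r = v.Ft t r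
  integrable : ∀ t c, IntegrableOn (v.energy t) (Ioi c)
  lim : Tendsto (fun t => ∫ r in Ioi (ρ + |t|), v.energy t r) atTop (𝓝 0)
  bdd : ∀ T, 0 ≤ T → ∃ C, ∀ t r, |t| ≤ T → 1 + |t| ≤ r → |v.F t r| ≤ C / r ^ 2

lemma odd_energy_le (U : RadialWave) (t : ℝ) {r : ℝ} (hr : 0 ≤ r) :
    U.odd.energy t r ≤ 1 / 2 * U.energy t r + 1 / 2 * U.energy (-t) r := by
  have h1 : ((U.Ft t r + U.Ft (-t) r) / 2) ^ 2 + ((U.Fr t r - U.Fr (-t) r) / 2) ^ 2 ≤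
      1 / 2 * (U.Ft t r ^ 2 + U.Fr t r ^ 2) + 1 / 2 * (U.Ft (-t) r ^ 2 + U.Fr (-t) r ^ 2) := by
    nlinarith [sq_nonneg (U.Ft t r - U.Ft (-t) r), sq_nonneg (U.Fr t r + U.Fr (-t) r)]
  calc U.odd.energy t r = r ^ 5 * (((U.Ft t r + U.Ft (-t) r) / 2) ^ 2 +
        ((U.Fr t r - U.Fr (-t) r) / 2) ^ 2) := rfl
    _ ≤ r ^ 5 * (1 / 2 * (U.Ft t r ^ 2 + U.Fr t r ^ 2) +
        1 / 2 * (U.Ft (-t) r ^ 2 + U.Fr (-t) r ^ 2)) := by gcongr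
    _ = _ := by unfold energy; ring

/-- The odd part of a nonradiative wave. -/
lemma oddNonRad_odd (U : RadialWave) {R ρ : ℝ} (hR : 0 ≤ R) (hρ : R ≤ ρ)
    (hE : IntegrableOn (U.energy 0) (Ioi 0))
    (hp : Tendsto (fun t => ∫ r in Ioi (R + |t|), U.energy t r) atTop (𝓝 0))
    (hm : Tendsto (fun t => ∫ r in Ioi (R + |t|), U.energy t r) atBot (𝓝 0)) :
    OddNonRad U.odd ρ := by
  have hint : ∀ t c, IntegrableOn (fun r => 1 / 2 * U.energy t r + 1 / 2 * U.energy (-t) r)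
      (Ioi c) := fun t c =>
    ((U.integrableOn_energy hE t).const_mul _).add ((U.integrableOn_energy hE (-t)).const_mul _)
  have hodd : ∀ t, IntegrableOn (U.odd.energy t) (Ioi 0) := fun t => by
    refine Integrable.mono' (hint t 0) (U.odd.continuous_energy t).aestronglyMeasurable ?_
    filter_upwards [ae_restrict_mem measurableSet_Ioi] with r hr
    have hr0 : 0 ≤ r := le_of_lt hr
    rw [norm_of_nonneg (U.odd.energy_nonneg t hr0)]
    exact U.odd_energy_le t hr0
  refine ⟨fun t r => ?_, fun t r => ?_, fun t r => ?_, fun t c =>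
    U.odd.integrableOn_energy (hodd 0) t, ?_, fun T hT => ?_⟩
  · simp only [odd, neg_neg]; ring
  · simp only [odd, neg_neg]; ring
  · simp only [odd, neg_neg]; ring
  · have h1 : Tendsto (fun t => 1 / 2 * (∫ r in Ioi (R + |t|), U.energy t r) +
        1 / 2 * ∫ r in Ioi (R + |-t|), U.energy (-t) r) atTop (𝓝 (1 / 2 * 0 + 1 / 2 * 0)) :=
      (hp.const_mul _).add ((hm.comp tendsto_neg_atTop_atBot).const_mul _)
    rw [mul_zero, add_zero] at h1
    refine squeeze_zero (fun t => setIntegral_nonneg measurableSet_Ioi fun r hr => ?_)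
      (fun t => ?_) h1
    · have hr' : ρ + |t| < r := hr
      exact U.odd.energy_nonneg t (by linarith [abs_nonneg t])
    · rw [abs_neg, ← integral_const_mul, ← integral_const_mul, ← integral_add
        ((U.integrableOn_energy hE t).const_mul _) ((U.integrableOn_energy hE (-t)).const_mul _)]
      refine le_trans (setIntegral_mono_on (U.odd.integrableOn_energy (hodd 0) t) (hint t _)
        measurableSet_Ioi fun r hr => ?_) (setIntegral_mono_set (hint t _) ?_
        (LE.le.eventuallyLE (Ioi_subset_Ioi (by linarith))))
      · have hr' : ρ + |t| < r := hr
        exact U.odd_energy_le t (by linarith [abs_nonneg t])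
      · filter_upwards [ae_restrict_mem measurableSet_Ioi] with r hr
        have hr' : R + |t| < r := hr
        have hr0 : 0 ≤ r := by linarith [abs_nonneg t]
        have := U.energy_nonneg t hr0
        have := U.energy_nonneg (-t) hr0
        simp only [Pi.zero_apply]
        positivity
  · obtain ⟨ℓ, hℓ⟩ := U.exists_limit hE
    obtain ⟨C, hC⟩ := hℓ T hT
    refine ⟨C, fun t r ht hr => ?_⟩
    have h1 := hC t r ht hr
    have h2 := hC (-t) r (by rwa [abs_neg]) (by rwa [abs_neg])
    have h3 : U.odd.F t r = ((U.F t r - ℓ) - (U.F (-t) r - ℓ)) / 2 := by simp only [odd]; ring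
    rw [h3, abs_div, abs_of_pos (by norm_num : (0 : ℝ) < 2), div_le_iff₀ (by norm_num)]
    exact (abs_sub _ _).trans (by linarith)

namespace OddNonRad

variable {v : RadialWave} {ρ : ℝ}

lemma tendsto_zero (h : OddNonRad v ρ) (t : ℝ) : Tendsto (v.F t) atTop (𝓝 0) := by
  obtain ⟨C, hC⟩ := h.bdd |t| (abs_nonneg t)
  have h2 : Tendsto (fun r : ℝ => C / r ^ 2) atTop (𝓝 0) :=
    tendsto_const_nhds.div_atTop (tendsto_pow_atTop (by norm_num))
  refine squeeze_zero_norm' ?_ h2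
  filter_upwards [eventually_ge_atTop (1 + |t|)] with r hr
  exact hC t r le_rfl hr

/-- Pointwise decay outside the light cone. -/
lemma decay (h : OddNonRad v ρ) (hρ : 0 < ρ) :
    ∃ C, ∀ t r, ρ + |t| < r → |v.F t r| ≤ C / r ^ 2 := by
  have key : ∃ C, ∀ t r, 0 ≤ t → ρ + t < r → |v.F t r| ≤ C / r ^ 2 := by
    obtain ⟨T, hT, hT0⟩ :=
      ((h.lim.eventually (ge_mem_nhds (zero_lt_one' ℝ))).and (eventually_ge_atTop 0)
        |> fun hh => (eventually_atTop.1 hh)) |> fun ⟨T, hT⟩ =>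
        (⟨max T 0, fun t ht => (hT t ((le_max_left _ _).trans ht)).1, le_max_right _ _⟩ :
          ∃ T : ℝ, (∀ t, T ≤ t → ∫ r in Ioi (ρ + |t|), v.energy t r ≤ 1) ∧ 0 ≤ T)
    obtain ⟨C, hC⟩ := h.bdd T hT0
    obtain ⟨M, hM⟩ := (isCompact_Icc (a := (0 : ℝ)) (b := T)).prod
      (isCompact_Icc (a := (0 : ℝ)) (b := 1 + T)) |>.exists_bound_of_continuousOn
      v.continuous_F.continuousOn
    have hM0 : 0 ≤ M := (norm_nonneg _).trans
      (hM (0, 0) ⟨⟨le_rfl, hT0⟩, ⟨le_rfl, by linarith⟩⟩)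
    refine ⟨max 1 (max C (M * (1 + T) ^ 2)), fun t r ht hr => ?_⟩
    have hr0 : 0 < r := by linarith
    rcases le_total T t with hTt | hTt
    · obtain ⟨ℓ, hℓ, hb⟩ := v.exists_tendsto (t := t) (ρ := ρ + |t|) (by positivity)
        (h.integrable t _)
      rw [tendsto_nhds_unique hℓ (h.tendsto_zero t)] at hb
      have h1 := hb r (by rwa [abs_of_nonneg ht])
      rw [sub_zero] at h1
      refine h1.trans ?_
      have h2 := hT t hTt
      gcongr
      exact le_trans (by linarith) (le_max_left _ _)
    · by_cases hr1 : 1 + t ≤ r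
      · refine (hC t r (by rwa [abs_of_nonneg ht]) (by rwa [abs_of_nonneg ht])).trans ?_
        gcongr
        exact le_max_of_le_right (le_max_left _ _)
      · have h1 : |v.F t r| ≤ M := hM (t, r) ⟨⟨ht, hTt⟩, ⟨hr0.le, by linarith⟩⟩
        have h2 : M ≤ M * (1 + T) ^ 2 / r ^ 2 := by
          rw [le_div_iff₀ (by positivity)]
          have : r ≤ 1 + T := by linarith
          gcongr
        refine h1.trans (h2.trans ?_)
        gcongr
        exact le_max_of_le_right (le_max_right _ _)
  obtain ⟨C, hC⟩ := key
  refine ⟨C, fun t r hr => ?_⟩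
  rcases le_total 0 t with ht | ht
  · exact hC t r ht (by rwa [abs_of_nonneg ht] at hr)
  · have h1 := hC (-t) r (by linarith) (by rwa [abs_of_nonpos ht] at hr)
    rwa [h.odd_F, abs_neg] at h1

lemma cone_mem {x y : ℝ} (hx : ρ < x) (hy : ρ < y) : ρ + |(x - y) / 2| < (x + y) / 2 := by
  have : |(x - y) / 2| < (x + y) / 2 - ρ := abs_lt.2 ⟨by linarith, by linarith⟩
  linarith

lemma abs_nullW_le (h : OddNonRad v ρ) (hρ : 0 < ρ) :
    ∃ C, ∀ x y, ρ < x → ρ < y → |v.nullW 0 x y| ≤ C * √((x + y) / 2) := by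
  obtain ⟨C, hC⟩ := h.decay hρ
  refine ⟨C, fun x y hx hy => ?_⟩
  have h1 := hC _ _ (cone_mem hx hy)
  have hr : 0 < (x + y) / 2 := by linarith
  rw [nullW, sub_zero, abs_mul, abs_of_nonneg (by positivity)]
  set r := (x + y) / 2
  calc √r * r ^ 2 * |v.F ((x - y) / 2) r| ≤ √r * r ^ 2 * (C / r ^ 2) := by gcongr
    _ = _ := by field_simp

lemma nullG_zero (v : RadialWave) (x y : ℝ) :
    v.nullG 0 x y = nullPotential ((x + y) / 2) * v.nullW 0 x y := by
  simp [nullG]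

lemma nullSol_zero (v : RadialWave) (hρ : 0 ≤ ρ) : NullSol ρ (v.nullW 0) (v.nullA 0) (v.nullB 0)
    (fun x y => nullPotential ((x + y) / 2) * v.nullW 0 x y) := by
  have h1 := (v.nullSol 0).mono hρ
  rwa [show v.nullG 0 = fun x y => nullPotential ((x + y) / 2) * v.nullW 0 x y from
    funext fun x => funext fun y => nullG_zero v x y] at h1

lemma continuousAt_nullB (v : RadialWave) {x y : ℝ} (hr : 0 < (x + y) / 2) :
    ContinuousAt (fun y => v.nullB 0 x y) y := by
  have h1 : Continuous (fun y : ℝ => v.Fr ((x - y) / 2) ((x + y) / 2)) := v.continuous_Fr.comp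
    (by fun_prop : Continuous fun y : ℝ => ((x - y) / 2, (x + y) / 2))
  have h2 : Continuous (fun y : ℝ => v.Ft ((x - y) / 2) ((x + y) / 2)) := v.continuous_Ft.comp
    (by fun_prop : Continuous fun y : ℝ => ((x - y) / 2, (x + y) / 2))
  have h3 : Continuous (fun y : ℝ => v.nullW 0 x y) := (v.continuous_nullW 0).comp
    (by fun_prop : Continuous fun y : ℝ => (x, y))
  have h4 : ContinuousAt (fun y : ℝ => v.nullW 0 x y / ((x + y) / 2)) y :=
    h3.continuousAt.div (by fun_prop) hr.ne'
  have h5 : ContinuousAt (fun y : ℝ => √((x + y) / 2) * ((x + y) / 2) ^ 2 *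
      (v.Fr ((x - y) / 2) ((x + y) / 2) - v.Ft ((x - y) / 2) ((x + y) / 2))) y := by fun_prop
  exact (h5.add (h4.const_mul (5 / 2))).const_mul (1 / 2)

lemma abs_nullB_sub_le (h : OddNonRad v ρ) (hρ : 0 < ρ) : ∃ C, 0 ≤ C ∧ ∀ x X y, ρ < x → ρ < y →
    x ≤ X → |v.nullB 0 X y - v.nullB 0 x y| ≤ C * (√((x + y) / 2) / ((x + y) / 2) ^ 1) := by
  obtain ⟨C, hC⟩ := h.abs_nullW_le hρ
  have hC0 : 0 ≤ C := by
    have h1 := (abs_nonneg _).trans (hC (ρ + 1) (ρ + 1) (by linarith) (by linarith))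
    exact nonneg_of_mul_nonneg_left h1 (Real.sqrt_pos.2 (by linarith))
  refine ⟨4 * (33 / 16 * C), by positivity, fun x X y hx hy hxX => ?_⟩
  have hs := nullSol_zero v hρ.le
  have h1 := abs_sub_le_of_abs_deriv_le (f := fun x => v.nullB 0 x y)
    (f' := fun x => nullPotential ((x + y) / 2) * v.nullW 0 x y)
    (g := fun x => -(4 * (33 / 16 * C)) * (√((x + y) / 2) / ((x + y) / 2) ^ 1))
    (g' := fun x => 33 / 16 * C * (√((x + y) / 2) / ((x + y) / 2) ^ 2)) hxX
    (fun z hz => hs.bx z y (hx.trans_le hz.1) hy) (fun z hz => ?_) (fun z hz => ?_)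
  · have hr : 0 < (X + y) / 2 := by linarith
    have h2 : 0 ≤ 4 * (33 / 16 * C) * (√((X + y) / 2) / ((X + y) / 2) ^ 1) := by positivity
    linarith
  · have hr : 0 < (z + y) / 2 := by linarith [hz.1]
    refine (((hasDerivAt_sqrt_div_pow 1 hr).comp z
      (hasDerivAt_mean_left z y)).const_mul (-(4 * (33 / 16 * C)))).of_eq (fun _ => rfl) ?_
    push_cast
    ring
  · have hz1 : ρ < z := hx.trans_le hz.1
    have hr : 0 < (z + y) / 2 := by linarith
    rw [abs_mul]
    calc _ ≤ (33 / 16 / ((z + y) / 2) ^ 2) * (C * √((z + y) / 2)) :=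
          mul_le_mul (abs_nullPotential_le hr) (hC z y hz1 hy) (abs_nonneg _) (by positivity)
      _ = _ := by ring

/-- A lower bound for the outgoing flux on a light-ray segment contradicts the decay of the
exterior energy. -/
lemma not_le_nullB (h : OddNonRad v ρ) (hρ : 0 < ρ) {y η δ X : ℝ} (hy : ρ < y) (hη : 0 < η)
    (hδ : 0 < δ) (hb : ∀ x z, X ≤ x → z ∈ Icc y (y + η) → δ ≤ |v.nullB 0 x z|) : False := by
  obtain ⟨C, hC⟩ := h.abs_nullW_le hρ
  have l1 : Tendsto (fun r : ℝ => 5 / 2 * C * (√r / r ^ 1)) atTop (𝓝 0) := by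
    simpa using (tendsto_sqrt_div_pow 0).const_mul (5 / 2 * C)
  obtain ⟨N, hN⟩ := eventually_atTop.1 (l1.eventually (ge_mem_nhds hδ))
  have l2 := h.lim.eventually (gt_mem_nhds (by positivity : 0 < 1 / 2 * δ ^ 2 * η))
  obtain ⟨t, ht, ht1⟩ := (l2.and (eventually_ge_atTop (max 0 (max X N)))).exists
  have ht0 : 0 ≤ t := (le_max_left _ _).trans ht1
  have htX : X ≤ t := (le_max_of_le_right (le_max_left _ _)).trans ht1
  have htN : N ≤ t := (le_max_of_le_right (le_max_right _ _)).trans ht1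
  have hlow : ∀ r ∈ Icc (y + t) (y + t + η), 1 / 2 * δ ^ 2 ≤ v.energy t r := by
    intro r hr
    have hr0 : 0 < r := by linarith [hr.1]
    have e1 : (r + t + (r - t)) / 2 = r := by ring
    have e2 : (r + t - (r - t)) / 2 = t := by ring
    have h1 := hb (r + t) (r - t) (by linarith [hr.1])
      ⟨by linarith [hr.1], by linarith [hr.2]⟩
    have h2 := hC (r + t) (r - t) (by linarith [hr.1]) (by linarith [hr.1])
    have h3 := hN r (by linarith [hr.1])
    rw [e1] at h2
    have h4 : v.nullB 0 (r + t) (r - t) = 1 / 2 * (√r * r ^ 2 * (v.Fr t r - v.Ft t r) +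
        5 / 2 * (v.nullW 0 (r + t) (r - t) / r)) := by simp only [nullB, e1, e2]
    have h5 : |5 / 2 * (v.nullW 0 (r + t) (r - t) / r)| ≤ δ := by
      refine le_trans ?_ h3
      rw [abs_mul, abs_of_pos (by norm_num : (0 : ℝ) < 5 / 2), abs_div, abs_of_pos hr0]
      calc 5 / 2 * (|v.nullW 0 (r + t) (r - t)| / r) ≤ 5 / 2 * (C * √r / r) := by gcongr
        _ = _ := by ring
    rw [h4, abs_mul, abs_of_pos (by norm_num : (0 : ℝ) < 1 / 2)] at h1
    have h6 := abs_add_le (√r * r ^ 2 * (v.Fr t r - v.Ft t r))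
      (5 / 2 * (v.nullW 0 (r + t) (r - t) / r))
    have h7 : δ ≤ |√r * r ^ 2 * (v.Fr t r - v.Ft t r)| := by linarith
    have h8 : δ ^ 2 ≤ r ^ 5 * (v.Fr t r - v.Ft t r) ^ 2 := by
      rw [← weight_sq hr0.le, ← mul_pow, ← sq_abs (_ * _)]
      gcongr
    have h9 := v.incoming_le t hr0.le
    linarith
  have h1 : ∫ r in Icc (y + t) (y + t + η), 1 / 2 * δ ^ 2 ≤
      ∫ r in Icc (y + t) (y + t + η), v.energy t r :=
    setIntegral_mono_on (continuousOn_const.integrableOn_Icc)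
      (v.continuous_energy t).continuousOn.integrableOn_Icc measurableSet_Icc hlow
  have h2 : ∫ r in Icc (y + t) (y + t + η), v.energy t r ≤
      ∫ r in Ioi (ρ + |t|), v.energy t r := by
    refine setIntegral_mono_set (h.integrable t _) ?_ (LE.le.eventuallyLE fun r hr => ?_)
    · filter_upwards [ae_restrict_mem measurableSet_Ioi] with r hr
      have hr' : ρ + |t| < r := hr
      exact v.energy_nonneg t (by linarith [abs_nonneg t])
    · rw [mem_Ioi, abs_of_nonneg ht0]
      linarith [hr.1]
  rw [setIntegral_const, measureReal_def, Real.volume_Icc, smul_eq_mul,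
    ENNReal.toReal_ofReal (by linarith)] at h1
  linarith

lemma tendsto_nullB (h : OddNonRad v ρ) (hρ : 0 < ρ) {y : ℝ} (hy : ρ < y) :
    Tendsto (fun x => v.nullB 0 x y) atTop (𝓝 0) := by
  obtain ⟨C, hC, hd⟩ := h.abs_nullB_sub_le hρ
  refine Metric.tendsto_atTop.2 fun ε hε => ?_
  have l1 : Tendsto (fun r : ℝ => C * (√r / r ^ 1)) atTop (𝓝 0) := by
    simpa using (tendsto_sqrt_div_pow 0).const_mul C
  obtain ⟨N, hN⟩ := eventually_atTop.1 (l1.eventually (ge_mem_nhds (by positivity : 0 < ε / 4)))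
  refine ⟨max (2 * N) (ρ + 1), fun x hx => ?_⟩
  have hx1 : 2 * N ≤ x := (le_max_left _ _).trans hx
  have hx2 : ρ + 1 ≤ x := (le_max_right _ _).trans hx
  rw [Real.dist_eq, sub_zero]
  by_contra! hb
  have hc := (continuousAt_nullB v (x := x) (y := y) (by linarith)).abs
  have hc2 : ∀ᶠ z in 𝓝 y, ε / 2 < |v.nullB 0 x z| :=
    hc.eventually (lt_mem_nhds (by linarith : ε / 2 < |v.nullB 0 x y|))
  obtain ⟨η, hη, hη2⟩ := Metric.eventually_nhds_iff.1 hc2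
  refine h.not_le_nullB hρ (y := y) (η := η / 2) (δ := ε / 4) (X := x) hy (by positivity)
    (by positivity) fun X z hX hz => ?_
  have h1 := hη2 (y := z) (by
    rw [Real.dist_eq, abs_of_nonneg (by linarith [hz.1])]
    linarith [hz.2])
  have h2 := hd x X z (by linarith) (by linarith [hz.1]) hX
  have h3 := hN ((x + z) / 2) (by linarith [hz.1])
  have h4 := abs_sub_abs_le_abs_sub (v.nullB 0 x z) (v.nullB 0 X z)
  rw [abs_sub_comm] at h4
  linarith

lemma nullW_odd (h : OddNonRad v ρ) (x y : ℝ) : v.nullW 0 y x = -v.nullW 0 x y := by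
  have e1 : (y - x) / 2 = -((x - y) / 2) := by ring
  simp only [nullW, e1, h.odd_F, add_comm y x]
  ring

lemma nullA_eq (h : OddNonRad v ρ) (x y : ℝ) : v.nullA 0 x y = -v.nullB 0 y x := by
  have e1 : (y - x) / 2 = -((x - y) / 2) := by ring
  simp only [nullA, nullB, h.nullW_odd x y, e1, h.odd_Fr, h.even_Ft, add_comm y x]
  ring

theorem nonRad (h : OddNonRad v ρ) (hρ : 0 < ρ) :
    NonRad nullPotential 0 ρ (v.nullW 0) (v.nullA 0) (v.nullB 0) where
  sol := nullSol_zero v hρ.le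
  lim_b _ hy := h.tendsto_nullB hρ hy
  lim_a x hx := by
    simp only [h.nullA_eq]
    simpa using (h.tendsto_nullB hρ hx).neg
  bound := by simpa using h.abs_nullW_le hρ

end OddNonRad

end RadialWave

/-- `ΛW` as a function of the radius. -/
def radialLW (r : ℝ) : ℝ := (4 - 2 * (1 + r ^ 2 / 24)) / (1 + r ^ 2 / 24) ^ 3

/-- The derivative of `radialLW`. -/
def radialLW' (r : ℝ) : ℝ := r * ((1 + r ^ 2 / 24) - 3) / (3 * (1 + r ^ 2 / 24) ^ 4)

lemma hasDerivAt_bracket (r : ℝ) : HasDerivAt (fun r : ℝ => 1 + r ^ 2 / 24) (r / 12) r :=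
  (((hasDerivAt_pow 2 r).div_const 24).const_add 1).of_eq (fun _ => rfl) (by
    push_cast
    ring)

lemma hasDerivAt_radialLW (r : ℝ) : HasDerivAt radialLW (radialLW' r) r := by
  have h1 := hasDerivAt_bracket r
  have h0 : 1 + r ^ 2 / 24 ≠ 0 := by positivity
  refine (((h1.const_mul 2).const_sub 4).div (h1.pow 3) (pow_ne_zero 3 h0)).of_eq
    (fun _ => rfl) ?_
  unfold radialLW'
  simp only [Pi.pow_apply]
  generalize 1 + r ^ 2 / 24 = s at h0
  field_simp
  push_cast
  ring

lemma hasDerivAt_radialLW' {r : ℝ} (hr : 0 < r) :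
    HasDerivAt radialLW' (potential r * radialLW r - 5 / r * radialLW' r) r := by
  have h1 := hasDerivAt_bracket r
  have h0 : 1 + r ^ 2 / 24 ≠ 0 := by positivity
  refine (((hasDerivAt_id r).mul (h1.sub_const 3)).div ((h1.pow 4).const_mul 3)
    (mul_ne_zero (by norm_num) (pow_ne_zero 4 h0))).of_eq (fun _ => rfl) ?_
  simp only [radialLW', radialLW, potential, Pi.pow_apply, Pi.mul_apply, id]
  have h2 : r ^ 2 = 24 * ((1 + r ^ 2 / 24) - 1) := by ring
  generalize 1 + r ^ 2 / 24 = s at h0 h2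
  field_simp
  push_cast
  ring_nf
  rw [h2]
  ring

lemma abs_radialLW_le {r : ℝ} (hr : 0 < r) : |radialLW r| ≤ 6 * 24 ^ 2 / r ^ 4 := by
  have h2 : r ^ 2 / 24 ≤ 1 + r ^ 2 / 24 := by linarith
  have h1 : 1 ≤ 1 + r ^ 2 / 24 := by linarith [sq_nonneg r]
  unfold radialLW
  generalize 1 + r ^ 2 / 24 = s at h1 h2
  have hs : 0 < s := by linarith
  have h3 : |4 - 2 * s| ≤ 6 * s := abs_le.2 ⟨by linarith, by linarith⟩
  rw [abs_div, abs_of_pos (pow_pos hs 3)]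
  calc |4 - 2 * s| / s ^ 3 ≤ 6 * s / s ^ 3 := by gcongr
    _ = 6 / s ^ 2 := by field_simp
    _ ≤ 6 / (r ^ 2 / 24) ^ 2 := by gcongr
    _ = _ := by field_simp

lemma abs_radialLW'_le {r : ℝ} (hr : 0 < r) : |radialLW' r| ≤ 24 ^ 3 / r ^ 5 := by
  have h2 : r ^ 2 / 24 ≤ 1 + r ^ 2 / 24 := by linarith
  have h1 : 1 ≤ 1 + r ^ 2 / 24 := by linarith [sq_nonneg r]
  unfold radialLW'
  generalize 1 + r ^ 2 / 24 = s at h1 h2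
  have hs : 0 < s := by linarith
  have h3 : |s - 3| ≤ 3 * s := abs_le.2 ⟨by linarith, by linarith⟩
  rw [abs_div, abs_of_pos (by positivity : 0 < 3 * s ^ 4), abs_mul, abs_of_pos hr]
  calc r * |s - 3| / (3 * s ^ 4) ≤ r * (3 * s) / (3 * s ^ 4) := by gcongr
    _ = r / s ^ 3 := by field_simp
    _ ≤ r / (r ^ 2 / 24) ^ 3 := by gcongr
    _ = _ := by field_simp

lemma radialLW_ne_zero {r : ℝ} (hr : 5 ≤ r) : radialLW r ≠ 0 := by
  have h1 : 1 + r ^ 2 / 24 > 2 := by nlinarith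
  unfold radialLW
  generalize 1 + r ^ 2 / 24 = s at h1
  exact div_ne_zero (by linarith) (by positivity)

lemma radialLW_sq_add_pos {r : ℝ} (hr : 0 < r) : 0 < radialLW r ^ 2 + radialLW' r ^ 2 := by
  by_contra! h
  have h1 : radialLW r = 0 := by
    refine pow_eq_zero_iff two_ne_zero |>.1 ?_
    linarith [sq_nonneg (radialLW r), sq_nonneg (radialLW' r)]
  have h2 : radialLW' r = 0 := by
    refine pow_eq_zero_iff two_ne_zero |>.1 ?_
    linarith [sq_nonneg (radialLW r), sq_nonneg (radialLW' r)]
  have h0 : 1 + r ^ 2 / 24 ≠ 0 := by positivity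
  unfold radialLW at h1
  unfold radialLW' at h2
  generalize 1 + r ^ 2 / 24 = s at h0 h1 h2
  rw [_root_.div_eq_zero_iff, or_iff_left (pow_ne_zero 3 h0)] at h1
  rw [_root_.div_eq_zero_iff, or_iff_left (mul_ne_zero three_ne_zero (pow_ne_zero 4 h0)),
    _root_.mul_eq_zero, or_iff_right hr.ne'] at h2
  linarith

lemma eq_of_hasDerivAt_zero {f : ℝ → ℝ} {a b : ℝ} (hab : a ≤ b)
    (hf : ∀ x ∈ Icc a b, HasDerivAt f 0 x) : f b = f a := by
  have h1 := abs_sub_le_of_abs_deriv_le (f := f) (f' := fun _ => 0) (g := fun _ => 0)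
    (g' := fun _ => 0) hab hf (fun x _ => hasDerivAt_const x 0) (by simp)
  rw [sub_zero] at h1
  exact sub_eq_zero.1 (abs_nonpos_iff.1 h1)

/-- The solutions of the stationary equation decaying at infinity are the multiples of `ΛW`. -/
theorem exists_eq_mul_radialLW {h h' : ℝ → ℝ} {ρ C : ℝ} (hρ : 0 < ρ)
    (hh : ∀ r, ρ < r → HasDerivAt h (h' r) r)
    (hh' : ∀ r, ρ < r → HasDerivAt h' (potential r * h r - 5 / r * h' r) r)
    (hb : ∀ r, ρ < r → |h r| ≤ C / r ^ 2) (hb' : ∀ r, ρ < r → |h' r| ≤ C / r ^ 3) :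
    ∃ c, ∀ r, ρ < r → h r = c * radialLW r := by
  have hC : 0 ≤ C := by
    have h1 := (abs_nonneg _).trans (hb (ρ + 1) (by linarith))
    rw [div_eq_mul_inv] at h1
    exact nonneg_of_mul_nonneg_left h1 (by positivity)
  have hZd : ∀ r, ρ < r →
      HasDerivAt (fun r => r ^ 5 * (h r * radialLW' r - h' r * radialLW r)) 0 r := by
    intro r hr
    have hr0 : 0 < r := hρ.trans hr
    refine ((hasDerivAt_pow 5 r).mul (((hh r hr).mul (hasDerivAt_radialLW' hr0)).sub
      ((hh' r hr).mul (hasDerivAt_radialLW r)))).of_eq (fun _ => rfl) ?_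
    simp only [Pi.mul_apply, Pi.sub_apply]
    field_simp
    push_cast
    ring
  have hZl : Tendsto (fun r => r ^ 5 * (h r * radialLW' r - h' r * radialLW r)) atTop (𝓝 0) := by
    have l1 : Tendsto (fun r : ℝ => C * (24 ^ 3 + 6 * 24 ^ 2) / r ^ 2) atTop (𝓝 0) :=
      tendsto_const_nhds.div_atTop (tendsto_pow_atTop (by norm_num))
    refine squeeze_zero_norm' ?_ l1
    filter_upwards [eventually_gt_atTop ρ] with r hr
    have hr0 : 0 < r := hρ.trans hr
    have h1 : |h r * radialLW' r| ≤ C / r ^ 2 * (24 ^ 3 / r ^ 5) := by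
      rw [abs_mul]
      exact mul_le_mul (hb r hr) (abs_radialLW'_le hr0) (abs_nonneg _) (by positivity)
    have h2 : |h' r * radialLW r| ≤ C / r ^ 3 * (6 * 24 ^ 2 / r ^ 4) := by
      rw [abs_mul]
      exact mul_le_mul (hb' r hr) (abs_radialLW_le hr0) (abs_nonneg _) (by positivity)
    rw [Real.norm_eq_abs, abs_mul, abs_of_pos (by positivity : 0 < r ^ 5)]
    calc r ^ 5 * |h r * radialLW' r - h' r * radialLW r|
        ≤ r ^ 5 * (C / r ^ 2 * (24 ^ 3 / r ^ 5) + C / r ^ 3 * (6 * 24 ^ 2 / r ^ 4)) := by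
          gcongr
          exact (abs_sub _ _).trans (add_le_add h1 h2)
      _ = _ := by field_simp
  have hZ : ∀ r, ρ < r → h r * radialLW' r = h' r * radialLW r := by
    intro r hr
    have hr0 : 0 < r := hρ.trans hr
    have h1 := abs_le_of_abs_deriv_le_of_tendsto (a := r)
      (f := fun r => r ^ 5 * (h r * radialLW' r - h' r * radialLW r)) (f' := fun _ => 0)
      (g := fun _ => 0) (g' := fun _ => 0) (fun x hx => hZd x (hr.trans_le hx))
      (fun x _ => (hasDerivAt_const x (0 : ℝ)).of_eq (fun _ => rfl) (by simp)) (by simp) hZl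
      tendsto_const_nhds
    have h2 := (mul_eq_zero.1 (abs_nonpos_iff.1 h1)).resolve_left (pow_ne_zero 5 hr0.ne')
    linarith
  let c : ℝ → ℝ := fun r =>
    (h r * radialLW r + h' r * radialLW' r) / (radialLW r ^ 2 + radialLW' r ^ 2)
  have hc : ∀ r, ρ < r → h r = c r * radialLW r ∧ h' r = c r * radialLW' r := by
    intro r hr
    have hD := radialLW_sq_add_pos (hρ.trans hr)
    have h1 := hZ r hr
    simp only [c]
    constructor
    · field_simp
      linear_combination radialLW' r * h1
    · field_simp
      linear_combination -radialLW r * h1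
  have hcd : ∀ r, ρ < r → HasDerivAt c 0 r := by
    intro r hr
    have hr0 := hρ.trans hr
    have hD := radialLW_sq_add_pos hr0
    obtain ⟨h1, h2⟩ := hc r hr
    refine ((((hh r hr).mul (hasDerivAt_radialLW r)).add
      ((hh' r hr).mul (hasDerivAt_radialLW' hr0))).div (((hasDerivAt_radialLW r).pow 2).add
      ((hasDerivAt_radialLW' hr0).pow 2)) hD.ne').of_eq (fun _ => rfl) ?_
    simp only [Pi.mul_apply, Pi.add_apply, Pi.pow_apply]
    rw [eq_comm, _root_.div_eq_zero_iff]
    left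
    generalize c r = k at h1 h2
    rw [h1, h2]
    push_cast
    ring
  refine ⟨c (ρ + 1), fun r hr => ?_⟩
  rw [(hc r hr).1]
  congr 1
  rcases le_total r (ρ + 1) with h1 | h1
  · exact (eq_of_hasDerivAt_zero h1 fun x hx => hcd x (hr.trans_le hx.1)).symm
  · exact eq_of_hasDerivAt_zero h1 fun x hx => hcd x (lt_of_lt_of_le (by linarith) hx.1)

namespace RadialWave

namespace OddNonRad

variable {v : RadialWave} {ρ : ℝ}

lemma second_difference (h : OddNonRad v ρ) (hρ : 0 < ρ) {t s r : ℝ} (hs : 0 < s)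
    (hr : ρ + |t| + s < r) : v.F (t + s) r + v.F (t - s) r = 2 * v.F t r := by
  have ht1 := neg_abs_le t
  have ht2 := le_abs_self t
  have hr0 : 0 < r := by linarith [abs_nonneg t]
  have h1 := (h.nonRad hρ).second_difference_eq_zero hρ.le (fun r hr => abs_nullPotential_le hr)
    h.nullW_odd (s := s / 2) (x := r + t) (y := r - t) (by positivity) (by linarith)
    (by linarith)
  have e1 : (r + t + 2 * (s / 2) + (r - t - 2 * (s / 2))) / 2 = r := by ring
  have e2 : (r + t + 2 * (s / 2) - (r - t - 2 * (s / 2))) / 2 = t + s := by ring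
  have e3 : (r + t - 2 * (s / 2) + (r - t + 2 * (s / 2))) / 2 = r := by ring
  have e4 : (r + t - 2 * (s / 2) - (r - t + 2 * (s / 2))) / 2 = t - s := by ring
  have e5 : (r + t + (r - t)) / 2 = r := by ring
  have e6 : (r + t - (r - t)) / 2 = t := by ring
  simp only [nullW, e1, e2, e3, e4, e5, e6, sub_zero] at h1
  have h2 : √r * r ^ 2 ≠ 0 := by positivity
  refine mul_left_cancel₀ h2 ?_
  linarith

lemma Ftt_eq_zero (h : OddNonRad v ρ) (hρ : 0 < ρ) {t r : ℝ} (hr : ρ + |t| < r) :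
    v.Ftt t r = 0 := by
  have h1 : (fun s => v.F (t + s) r + v.F (t - s) r - 2 * v.F t r) =ᶠ[𝓝 0] fun _ => 0 := by
    refine Metric.eventually_nhds_iff.2 ⟨r - (ρ + |t|), by linarith, fun s hs => ?_⟩
    rw [Real.dist_eq, sub_zero] at hs
    rcases lt_trichotomy s 0 with h0 | h0 | h0
    · rw [abs_of_neg h0] at hs
      have := h.second_difference hρ (t := t) (r := r) (s := -s) (by linarith) (by linarith)
      rw [sub_neg_eq_add, ← sub_eq_add_neg] at this
      linarith
    · simp only [h0, add_zero, sub_zero]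
      ring
    · rw [abs_of_pos h0] at hs
      have := h.second_difference hρ (t := t) (r := r) h0 (by linarith)
      linarith
  have d1 : ∀ s, HasDerivAt (fun s => v.F (t + s) r + v.F (t - s) r - 2 * v.F t r)
      (v.Ft (t + s) r - v.Ft (t - s) r) s := fun s =>
    ((((v.hasDerivAt_F_time (t + s) r).comp_const_add t s).add
      ((v.hasDerivAt_F_time (t - s) r).comp_const_sub t s)).sub_const _).of_eq
      (fun _ => rfl) (by ring)
  have d2 : HasDerivAt (fun s => v.Ft (t + s) r - v.Ft (t - s) r) (2 * v.Ftt t r) 0 :=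
    (((v.hasDerivAt_Ft_time (t + 0) r).comp_const_add t 0).sub
      ((v.hasDerivAt_Ft_time (t - 0) r).comp_const_sub t 0)).of_eq
      (fun _ => rfl) (by rw [add_zero, sub_zero]; ring)
  have h2 := h1.deriv.deriv_eq
  rw [show deriv (fun s => v.F (t + s) r + v.F (t - s) r - 2 * v.F t r) =
    fun s => v.Ft (t + s) r - v.Ft (t - s) r from funext fun s => (d1 s).deriv, d2.deriv] at h2
  simpa using h2

/-- Nonradiative odd waves are linear in time. -/
lemma linear (h : OddNonRad v ρ) (hρ : 0 < ρ) {t r : ℝ} (ht : 0 ≤ t) (hr : ρ + t < r) :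
    v.F t r = t * v.Ft 0 r := by
  have h1 : ∀ s ∈ Icc 0 t, v.Ft s r = v.Ft 0 r := fun s hs =>
    eq_of_hasDerivAt_zero (f := fun s => v.Ft s r) hs.1 fun z hz => by
      have := v.hasDerivAt_Ft_time z r
      rwa [h.Ftt_eq_zero hρ (by rw [abs_of_nonneg hz.1]; linarith [hz.2, hs.2])] at this
  have h2 := eq_of_hasDerivAt_zero (f := fun s => v.F s r - s * v.Ft 0 r) ht fun z hz =>
    ((v.hasDerivAt_F_time z r).sub ((hasDerivAt_id z).mul_const (v.Ft 0 r))).of_eq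
      (fun _ => rfl) (by rw [h1 z hz]; ring)
  have h3 := h.odd_F 0 r
  rw [neg_zero] at h3
  simp only [zero_mul, sub_zero] at h2
  linarith

lemma decay_Fr (h : OddNonRad v ρ) (hρ : 0 < ρ) :
    ∃ C, ∀ t r, ρ + |t| < r → |v.Fr t r| ≤ C / r ^ 3 := by
  obtain ⟨C, hC⟩ := h.abs_nullW_le hρ
  obtain ⟨D, hD, hab⟩ := (h.nonRad hρ).deriv_bound hρ.le (fun r hr => abs_nullPotential_le hr)
  refine ⟨2 * D + 5 / 2 * C, fun t r hr => ?_⟩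
  have ht1 := neg_abs_le t
  have ht2 := le_abs_self t
  have hr0 : 0 < r := by linarith [abs_nonneg t]
  have e5 : (r + t + (r - t)) / 2 = r := by ring
  have e6 : (r + t - (r - t)) / 2 = t := by ring
  have hw := hC (r + t) (r - t) (by linarith) (by linarith)
  obtain ⟨ha, hb⟩ := hab (r + t) (r - t) (by linarith) (by linarith)
  have h1 : √r * r ^ 2 * v.Fr t r = v.nullA 0 (r + t) (r - t) + v.nullB 0 (r + t) (r - t) -
      5 / 2 * (v.nullW 0 (r + t) (r - t) / r) := by
    simp only [nullA, nullB, e5, e6]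
    ring
  rw [e5] at hw ha hb
  have hs : 0 < √r := Real.sqrt_pos.2 hr0
  have h2 : |5 / 2 * (v.nullW 0 (r + t) (r - t) / r)| ≤ 5 / 2 * (C * √r / r) := by
    rw [abs_mul, abs_of_pos (by norm_num : (0 : ℝ) < 5 / 2), abs_div, abs_of_pos hr0]
    gcongr
  have h3 : √r * r ^ 2 * |v.Fr t r| ≤
      D * (√r / r ^ (0 + 1)) + D * (√r / r ^ (0 + 1)) + 5 / 2 * (C * √r / r) := by
    rw [← abs_of_pos (by positivity : 0 < √r * r ^ 2), ← abs_mul, h1]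
    exact (abs_sub _ _).trans (add_le_add ((abs_add_le _ _).trans (add_le_add ha hb)) h2)
  have h4 : D * (√r / r ^ (0 + 1)) + D * (√r / r ^ (0 + 1)) + 5 / 2 * (C * √r / r) =
      √r * r ^ 2 * ((2 * D + 5 / 2 * C) / r ^ 3) := by
    field_simp
    ring
  rw [h4] at h3
  exact le_of_mul_le_mul_left h3 (by positivity)

theorem exists_Ft_eq (h : OddNonRad v ρ) (hρ : 0 < ρ) {t : ℝ} (ht : 0 < t) :
    ∃ c, ∀ r, ρ + t < r → v.Ft 0 r = c * radialLW r := by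
  obtain ⟨C, hC⟩ := h.decay hρ
  obtain ⟨D, hD⟩ := h.decay_Fr hρ
  obtain ⟨c, hc⟩ := exists_eq_mul_radialLW (h := v.F t) (h' := v.Fr t) (ρ := ρ + t)
    (C := max C D) (by positivity) (fun r _ => v.hasDerivAt_F_radius t r)
    (fun r hr => by
      have h1 := v.eqn t r (by linarith)
      rw [h.Ftt_eq_zero hρ (by rwa [abs_of_pos ht])] at h1
      exact (v.hasDerivAt_Fr_radius t r).of_eq (fun _ => rfl) (by linarith))
    (fun r hr => by
      have hr0 : 0 < r := by linarith
      refine (hC t r (by rwa [abs_of_pos ht])).trans ?_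
      gcongr
      exact le_max_left _ _)
    (fun r hr => by
      have hr0 : 0 < r := by linarith
      refine (hD t r (by rwa [abs_of_pos ht])).trans ?_
      gcongr
      exact le_max_right _ _)
  refine ⟨c / t, fun r hr => ?_⟩
  have h1 := hc r hr
  rw [h.linear hρ ht.le hr] at h1
  field_simp
  linarith

end OddNonRad

/-- Rigidity of nonradiative waves, in radial form. -/
theorem exists_Ft_eq (U : RadialWave) {R : ℝ} (hR : 0 ≤ R)
    (hE : IntegrableOn (U.energy 0) (Ioi 0))
    (hp : Tendsto (fun t => ∫ r in Ioi (R + |t|), U.energy t r) atTop (𝓝 0))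
    (hm : Tendsto (fun t => ∫ r in Ioi (R + |t|), U.energy t r) atBot (𝓝 0)) :
    ∃ c, ∀ r, R ≤ r → U.Ft 0 r = c * radialLW r := by
  have key : ∀ ρ, R < ρ → ∃ c, ∀ r, ρ < r → U.Ft 0 r = c * radialLW r := by
    intro ρ hρ
    obtain ⟨c, hc⟩ := (U.oddNonRad_odd hR (ρ := (R + ρ) / 2) (by linarith) hE hp hm).exists_Ft_eq
      (by linarith) (t := (ρ - R) / 2) (by linarith)
    refine ⟨c, fun r hr => ?_⟩
    rw [← hc r (by linarith)]
    simp [odd]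
  obtain ⟨c, hc⟩ := key (R + 1) (by linarith)
  refine ⟨c, fun r hr => ?_⟩
  have h1 : EqOn (U.Ft 0) (fun r => c * radialLW r) (Ioi R) := by
    intro r hr
    have hr' : R < r := hr
    obtain ⟨d, hd⟩ := key ((R + r) / 2) (by linarith)
    have h2 := hc (R + r + 5) (by linarith)
    rw [hd (R + r + 5) (by linarith)] at h2
    have h3 := mul_right_cancel₀ (radialLW_ne_zero (by linarith)) h2
    rw [hd r (by linarith), h3]
  have h2 := h1.closure (U.continuous_Ft_radius 0) (continuous_const.mul
    (continuous_iff_continuousAt.2 fun r => (hasDerivAt_radialLW r).continuousAt))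
  rw [closure_Ioi] at h2
  exact h2 hr

end RadialWave

lemma eq_smul_fst_add_smul_snd (L : ℝ × ℝ →L[ℝ] ℝ) :
    L = L (1, 0) • ContinuousLinearMap.fst ℝ ℝ ℝ + L (0, 1) • ContinuousLinearMap.snd ℝ ℝ ℝ := by
  ext <;> simp

lemma hasFDerivAt_partial {G : ℝ × ℝ → ℝ} (hG : ContDiff ℝ 2 G) (v : ℝ × ℝ) (t r : ℝ) :
    HasFDerivAt (fun p : ℝ × ℝ => fderiv ℝ G (p.1, p.2) v)
      (fderiv ℝ (fderiv ℝ G) (t, r) (1, 0) v • ContinuousLinearMap.fst ℝ ℝ ℝ +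
        fderiv ℝ (fderiv ℝ G) (t, r) (0, 1) v • ContinuousLinearMap.snd ℝ ℝ ℝ) (t, r) := by
  have h1 : DifferentiableAt ℝ (fderiv ℝ G) (t, r) :=
    ((hG.fderiv_right (m := 1) (by norm_num)).differentiable one_ne_zero) (t, r)
  have h2 := h1.hasFDerivAt.clm_apply (hasFDerivAt_const v ((t, r) : ℝ × ℝ))
  refine h2.congr_fderiv ((eq_smul_fst_add_smul_snd _).trans ?_)
  simp

lemma fderiv_fderiv_comm {G : ℝ × ℝ → ℝ} (hG : ContDiff ℝ 2 G) (p v w : ℝ × ℝ) :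
    fderiv ℝ (fderiv ℝ G) p v w = fderiv ℝ (fderiv ℝ G) p w v :=
  hG.contDiffAt.isSymmSndFDerivAt (by simp) v w

lemma hasFDerivAt_comp_norm {g : ℝ → ℝ} {g' : ℝ} {x : E6} (hx : x ≠ 0)
    (hg : HasDerivAt g g' ‖x‖) :
    HasFDerivAt (fun y : E6 => g ‖y‖) ((g' / ‖x‖) • innerSL ℝ x) x := by
  have h0 : ‖x‖ ≠ 0 := norm_ne_zero_iff.2 hx
  have h1 : HasFDerivAt (fun y : E6 => ‖y‖) (‖x‖⁻¹ • innerSL ℝ x) x := by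
    have h2 := ((hasStrictFDerivAt_norm_sq x).hasFDerivAt).sqrt (pow_ne_zero 2 h0)
    simp only [Real.sqrt_sq (norm_nonneg _)] at h2
    refine h2.congr_fderiv ?_
    ext v
    simp
    field_simp
  have h3 := hg.comp_hasFDerivAt x h1
  refine h3.congr_fderiv ?_
  rw [smul_smul, div_eq_mul_inv]

lemma lap6_comp_norm {g g₁ : ℝ → ℝ} {g₂ : ℝ} {x : E6} (hx : x ≠ 0)
    (hg : ∀ r, HasDerivAt g (g₁ r) r) (hg₁ : HasDerivAt g₁ g₂ ‖x‖) :
    lap6 (fun y => g ‖y‖) x = g₂ + 5 / ‖x‖ * g₁ ‖x‖ := by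
  have h0 : ‖x‖ ≠ 0 := norm_ne_zero_iff.2 hx
  have key : ∀ i : Fin 6, fderiv ℝ (fun y => fderiv ℝ (fun z : E6 => g ‖z‖) y
      (EuclideanSpace.single i 1)) x (EuclideanSpace.single i 1)
      = (g₂ / ‖x‖ ^ 2 - g₁ ‖x‖ / ‖x‖ ^ 3) * x i ^ 2 + g₁ ‖x‖ / ‖x‖ := by
    intro i
    have h1 : (fun y => fderiv ℝ (fun z : E6 => g ‖z‖) y (EuclideanSpace.single i 1))
        =ᶠ[𝓝 x] fun y => (fun r => g₁ r / r) ‖y‖ * y i := by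
      filter_upwards [isOpen_ne.mem_nhds hx] with y hy
      rw [(hasFDerivAt_comp_norm hy (hg ‖y‖)).fderiv]
      simp [EuclideanSpace.inner_single_right]
    have h2 : HasFDerivAt (fun y : E6 => y i) (EuclideanSpace.proj i : E6 →L[ℝ] ℝ) x :=
      (EuclideanSpace.proj i : E6 →L[ℝ] ℝ).hasFDerivAt
    have h3 := (hasFDerivAt_comp_norm hx (hg₁.div (hasDerivAt_id _) h0)).mul h2
    rw [h1.fderiv_eq]
    refine (congrArg (fun L : E6 →L[ℝ] ℝ => L (EuclideanSpace.single i 1)) h3.fderiv).trans ?_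
    simp [EuclideanSpace.inner_single_right]
    field_simp
    ring
  rw [lap6, Finset.sum_congr rfl fun i _ => key i, Finset.sum_add_distrib, ← Finset.mul_sum,
    ← EuclideanSpace.real_norm_sq_eq]
  simp
  field_simp
  ring

lemma LW6_eq (x : E6) : LW6 x = radialLW ‖x‖ := by
  have hs : (1 + ‖x‖ ^ 2 / 24) ≠ 0 := by positivity
  have h1 : HasDerivAt (fun q : ℝ => ((1 + q / 24) ^ 2)⁻¹)
      (-(1 / 12) / (1 + ‖x‖ ^ 2 / 24) ^ 3) (‖x‖ ^ 2) := by
    refine (((((hasDerivAt_id (‖x‖ ^ 2)).div_const 24).const_add 1).pow 2).inv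
      (pow_ne_zero 2 hs)).of_eq (fun _ => rfl) ?_
    simp
    field_simp
    norm_num
  have h2 : HasFDerivAt W6 ((-(1 / 12) / (1 + ‖x‖ ^ 2 / 24) ^ 3) • 2 • innerSL ℝ x) x :=
    HasDerivAt.comp_hasFDerivAt (f := fun y : E6 => ‖y‖ ^ 2) x h1
      (hasStrictFDerivAt_norm_sq x).hasFDerivAt
  rw [LW6, h2.fderiv, W6, radialLW]
  simp
  field_simp
  ring

section

variable {u : ℝ → E6 → ℝ}

/-- The profile of a radial function along a ray, as a function of time and radius. -/
def profile (u : ℝ → E6 → ℝ) (p : ℝ × ℝ) : ℝ := u p.1 (p.2 • EuclideanSpace.single 0 1)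

lemma contDiff_profile (h : ContDiff ℝ 2 fun p : ℝ × E6 => u p.1 p.2) :
    ContDiff ℝ 2 (profile u) :=
  h.comp (contDiff_fst.prodMk (contDiff_snd.smul contDiff_const))

lemma eq_profile_norm (h : ∀ t x y, ‖x‖ = ‖y‖ → u t x = u t y) (t : ℝ) (x : E6) :
    u t x = profile u (t, ‖x‖) :=
  h t _ _ (by simp [norm_smul])

lemma hasDerivAt_profile_fst (h : ContDiff ℝ 2 fun p : ℝ × E6 => u p.1 p.2) (t r : ℝ) :
    HasDerivAt (fun s => profile u (s, r)) (fderiv ℝ (profile u) (t, r) (1, 0)) t :=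
  HasFDerivAt.comp_hasDerivAt (f := fun s : ℝ => (s, r)) t
    (((contDiff_profile h).differentiable two_ne_zero) (t, r)).hasFDerivAt
    ((hasDerivAt_id t).prodMk (hasDerivAt_const t r))

lemma hasDerivAt_profile_snd (h : ContDiff ℝ 2 fun p : ℝ × E6 => u p.1 p.2) (t r : ℝ) :
    HasDerivAt (fun s => profile u (t, s)) (fderiv ℝ (profile u) (t, r) (0, 1)) r :=
  HasFDerivAt.comp_hasDerivAt (f := fun s : ℝ => (t, s)) r
    (((contDiff_profile h).differentiable two_ne_zero) (t, r)).hasFDerivAt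
    ((hasDerivAt_const r t).prodMk (hasDerivAt_id r))

lemma dtu_eq (h : IsRadSolOf V6 u) (t : ℝ) (x : E6) :
    dtu u t x = fderiv ℝ (profile u) (t, ‖x‖) (1, 0) := by
  rw [dtu, funext fun s => eq_profile_norm h.2.1 s x]
  exact (hasDerivAt_profile_fst h.1 t ‖x‖).deriv

lemma eDensity_eq (h : IsRadSolOf V6 u) (t : ℝ) {x : E6} (hx : x ≠ 0) :
    eDensity u t x = fderiv ℝ (profile u) (t, ‖x‖) (1, 0) ^ 2 +
      fderiv ℝ (profile u) (t, ‖x‖) (0, 1) ^ 2 := by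
  have h1 : ‖gradient (u t) x‖ = ‖fderiv ℝ (u t) x‖ := by
    rw [gradient, LinearIsometryEquiv.norm_map]
  rw [eDensity, dtu_eq h, h1, funext (eq_profile_norm h.2.1 t),
    (hasFDerivAt_comp_norm hx (hasDerivAt_profile_snd h.1 t ‖x‖)).fderiv, norm_smul,
    innerSL_apply_norm, norm_div, norm_norm, div_mul_cancel₀ _ (norm_ne_zero_iff.2 hx),
    Real.norm_eq_abs, sq_abs]

/-- The radial wave attached to a radial solution on `ℝ × ℝ⁶`. -/
def IsRadSolOf.radialWave (h : IsRadSolOf V6 u) : RadialWave where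
  F t r := profile u (t, r)
  Ft t r := fderiv ℝ (profile u) (t, r) (1, 0)
  Fr t r := fderiv ℝ (profile u) (t, r) (0, 1)
  Ftt t r := fderiv ℝ (fderiv ℝ (profile u)) (t, r) (1, 0) (1, 0)
  Ftr t r := fderiv ℝ (fderiv ℝ (profile u)) (t, r) (0, 1) (1, 0)
  Frr t r := fderiv ℝ (fderiv ℝ (profile u)) (t, r) (0, 1) (0, 1)
  hasF t r := by
    rw [← eq_smul_fst_add_smul_snd]
    exact (((contDiff_profile h.1).differentiable two_ne_zero) (t, r)).hasFDerivAt
  hasFt t r := hasFDerivAt_partial (contDiff_profile h.1) (1, 0) t r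
  hasFr t r := by
    rw [fderiv_fderiv_comm (contDiff_profile h.1) (t, r) (0, 1) (1, 0)]
    exact hasFDerivAt_partial (contDiff_profile h.1) (0, 1) t r
  eqn t r hr := by
    have hn : ‖(r • EuclideanSpace.single 0 1 : E6)‖ = r := by simp [norm_smul, abs_of_pos hr]
    have h0 : (r • EuclideanSpace.single 0 1 : E6) ≠ 0 := norm_ne_zero_iff.1 (hn.trans_ne hr.ne')
    have h1 := h.2.2.1 t (r • EuclideanSpace.single 0 1)
    have h2 : HasDerivAt (fun s => fderiv ℝ (profile u) (s, r) (1, 0))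
        (fderiv ℝ (fderiv ℝ (profile u)) (t, r) (1, 0) (1, 0)) t :=
      ((hasFDerivAt_partial (contDiff_profile h.1) (1, 0) t r).comp_hasDerivAt t
        ((hasDerivAt_id t).prodMk (hasDerivAt_const t r))).of_eq (fun _ => rfl) (by simp)
    have h3 : HasDerivAt (fun s => fderiv ℝ (profile u) (t, s) (0, 1))
        (fderiv ℝ (fderiv ℝ (profile u)) (t, r) (0, 1) (0, 1)) r :=
      ((hasFDerivAt_partial (contDiff_profile h.1) (0, 1) t r).comp_hasDerivAt r
        ((hasDerivAt_const r t).prodMk (hasDerivAt_id r))).of_eq (fun _ => rfl) (by simp)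
    rw [dttu, funext fun s => dtu_eq h s _, hn, h2.deriv, funext (eq_profile_norm h.2.1 t),
      lap6_comp_norm h0 (hasDerivAt_profile_snd h.1 t) (hn.symm ▸ h3), hn, V6, W6, hn] at h1
    beta_reduce at h1
    rw [hn] at h1
    rw [potential]
    linarith

lemma setIntegral_eDensity (h : IsRadSolOf V6 u) (t : ℝ) {ρ : ℝ} (hρ : 0 ≤ ρ) :
    ∫ x in {x : E6 | ρ < ‖x‖}, eDensity u t x =
      6 * volume.real (Metric.ball (0 : E6) 1) * ∫ r in Ioi ρ, h.radialWave.energy t r := by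
  have hm : MeasurableSet {x : E6 | ρ < ‖x‖} := measurableSet_lt measurable_const measurable_norm
  have h1 : ∀ x : E6, indicator {x : E6 | ρ < ‖x‖} (eDensity u t) x = indicator (Ioi ρ)
      (fun r => h.radialWave.Ft t r ^ 2 + h.radialWave.Fr t r ^ 2) ‖x‖ := by
    intro x
    by_cases hx : ρ < ‖x‖
    · rw [indicator_of_mem (show x ∈ {x : E6 | ρ < ‖x‖} from hx),
        indicator_of_mem (show ‖x‖ ∈ Ioi ρ from hx),
        eDensity_eq h t (norm_pos_iff.1 (hρ.trans_lt hx))]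
      rfl
    · rw [indicator_of_notMem (show x ∉ {x : E6 | ρ < ‖x‖} from hx),
        indicator_of_notMem (show ‖x‖ ∉ Ioi ρ from hx)]
  rw [← integral_indicator hm, integral_congr_ae (ae_of_all _ h1), integral_fun_norm_addHaar,
    finrank_euclideanSpace_fin, nsmul_eq_mul, smul_eq_mul, mul_assoc]
  congr 2
  rw [setIntegral_congr_fun (g := indicator (Ioi ρ) (h.radialWave.energy t)) measurableSet_Ioi,
    setIntegral_indicator measurableSet_Ioi, inter_eq_right.2 (Ioi_subset_Ioi hρ)]
  intro r hr
  by_cases hx : r ∈ Ioi ρ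
  · simp [indicator_of_mem hx, RadialWave.energy]
  · simp [indicator_of_notMem hx]

lemma integrableOn_energy (h : IsRadSolOf V6 u) :
    IntegrableOn (h.radialWave.energy 0) (Ioi 0) := by
  have h1 : Integrable (fun x : E6 =>
      (fun r => h.radialWave.Ft 0 r ^ 2 + h.radialWave.Fr 0 r ^ 2) ‖x‖) := by
    refine h.2.2.2.congr ?_
    filter_upwards [compl_mem_ae_iff.2 (measure_singleton (0 : E6))] with x hx
    exact eDensity_eq h 0 hx
  have h2 := (integrable_fun_norm_addHaar volume (f := fun r =>
    h.radialWave.Ft 0 r ^ 2 + h.radialWave.Fr 0 r ^ 2)).1 h1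
  rwa [finrank_euclideanSpace_fin] at h2

end

lemma tendsto_energy {u : ℝ → E6 → ℝ} (h : IsRadSolOf V6 u) {R : ℝ} (hR : 0 ≤ R) {l : Filter ℝ}
    (hl : Tendsto (fun t => ∫ x in {x : E6 | R + |t| < ‖x‖}, eDensity u t x) l (𝓝 0)) :
    Tendsto (fun t => ∫ r in Ioi (R + |t|), h.radialWave.energy t r) l (𝓝 0) := by
  have hc : 6 * volume.real (Metric.ball (0 : E6) 1) ≠ 0 :=
    mul_ne_zero (by norm_num) (ENNReal.toReal_pos (Metric.measure_ball_pos _ _ one_pos).ne'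
      measure_ball_lt_top.ne).ne'
  have h1 := hl.const_mul (6 * volume.real (Metric.ball (0 : E6) 1))⁻¹
  rw [mul_zero] at h1
  refine h1.congr fun t => ?_
  rw [setIntegral_eDensity h t (by positivity), inv_mul_cancel_left₀ hc]

/-- Rigidity for odd-in-time non-radiative linear waves around a soliton. -/
theorem stmt4 (R : ℝ) (hR : 0 ≤ R) (u : ℝ → E6 → ℝ) (hu : IsRadSolOf V6 u)
    (hp : Tendsto (fun t => ∫ x in {x : E6 | R + |t| < ‖x‖}, eDensity u t x) atTop (𝓝 0))
    (hm : Tendsto (fun t => ∫ x in {x : E6 | R + |t| < ‖x‖}, eDensity u t x) atBot (𝓝 0)) :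
    ∃ c : ℝ, ∀ x : E6, R ≤ ‖x‖ → dtu u 0 x = c * LW6 x := by
  obtain ⟨c, hc⟩ := hu.radialWave.exists_Ft_eq hR (integrableOn_energy hu)
    (tendsto_energy hu hR hp) (tendsto_energy hu hR hm)
  refine ⟨c, fun x hx => ?_⟩
  rw [dtu_eq hu, LW6_eq]
  exact hc ‖x‖ hx

end
end

section
/- Properties of the Z_{−3,λ} norm for radial Ḣ¹ functions: let J ∈ ℕ, λ = (λ₁,…,λ_J) with 0 < λ_J < … < λ₁, and let f be a radial function on ℝ⁶, C¹ on (0,∞), with ∫_0^∞ f'(r)² r⁵ dr < ∞ and f(r) → 0 as r → ∞. Then: (i) ‖∇f‖_{Z_{−3,λ}} ≤ ‖∇f‖_{L²(ℝ⁶)}; (ii) there is a universal constant C (independent of J, λ, f) with |f(r)| ≤ C r^{−2} (1 + |min_{1≤j≤J} log(r/λ_j)|) ‖∇f‖_{Z_{−3,λ}} for all r > 0; (iii) for fixed cutoffs χ⁰ (smooth, χ⁰ = 1 on r ≤ 1, χ⁰ = 0 on r ≥ 2) and χ¹ (smooth, compactly supported in (0,∞)), there is a constant C depending only on χ⁰,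 χ¹ (not on R, J, λ, f) such that for all R > 0: ‖χ¹(·/R) f‖_{Ḣ¹} ≤ C (1 + |min_{1≤j≤J} log(R/λ_j)|) ‖∇f‖_{Z_{−3,λ}}, ‖∇(χ⁰(·/R) f)‖_{Z_{−3,λ}} ≤ C ‖∇f‖_{Z_{−3,λ}}, and ‖∇((1−χ⁰(·/R)) f)‖_{Z_{−3,λ}} ≤ C ‖1_{{|x|≥R}} ∇f‖_{Z_{−3,λ}}. -/
open MeasureTheory Real Filter Set Topology ENNReal

noncomputable section

/-- The `Z_{-3,λ}` norm of a radial profile `f`: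
`sup_{R>0} (inf_j ⟨log(R/λ_j)⟩)⁻¹ (∫_{R<|x|<2R} f(|x|)² dx)^{1/2}`. -/
def ZlamR {J : ℕ} (lam : Fin J → ℝ) (f : ℝ → ℝ) : ℝ≥0∞ :=
  ⨆ R : {R : ℝ // 0 < R}, ENNReal.ofReal
    ((⨅ j, Real.sqrt (1 + Real.log (R.1 / lam j) ^ 2))⁻¹ *
      Real.sqrt (∫ x in {x : E6 | R.1 < ‖x‖ ∧ ‖x‖ < 2 * R.1}, f ‖x‖ ^ 2))

/-- The weight `inf_j ⟨log(s/λ_j)⟩`. -/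
def logWeight {J : ℕ} (lam : Fin J → ℝ) (s : ℝ) : ℝ :=
  ⨅ j, Real.sqrt (1 + Real.log (s / lam j) ^ 2)

/-- The area of the unit sphere of `ℝ⁶`. -/
def sphereArea : ℝ := 6 * volume.real (Metric.ball (0 : E6) 1)

/-- The integral of `g(|x|)²` over the annulus `ρ < |x| < 2ρ` of `ℝ⁶`, in polar coordinates. -/
def annulusEnergy (g : ℝ → ℝ) (ρ : ℝ) : ℝ :=
  sphereArea * ∫ y in Ioo ρ (2 * ρ), y ^ 5 * g y ^ 2

lemma sphereArea_pos : 0 < sphereArea := by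
  unfold sphereArea
  have : 0 < volume.real (Metric.ball (0 : E6) 1) :=
    ENNReal.toReal_pos (Metric.measure_ball_pos _ _ one_pos).ne' measure_ball_lt_top.ne
  positivity

lemma integral_norm_E6 (F : ℝ → ℝ) :
    ∫ x : E6, F ‖x‖ = sphereArea * ∫ y in Ioi (0 : ℝ), y ^ 5 * F y := by
  rw [integral_fun_norm_addHaar (volume : Measure E6) F]
  simp [sphereArea, mul_assoc]

lemma integral_annulus_E6 (g : ℝ → ℝ) {ρ : ℝ} (hρ : 0 < ρ) :
    ∫ x in {x : E6 | ρ < ‖x‖ ∧ ‖x‖ < 2 * ρ}, g ‖x‖ ^ 2 = annulusEnergy g ρ := by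
  have hm : MeasurableSet {x : E6 | ρ < ‖x‖ ∧ ‖x‖ < 2 * ρ} :=
    (measurableSet_lt measurable_const measurable_norm).inter
      (measurableSet_lt measurable_norm measurable_const)
  rw [← integral_indicator hm]
  have h := integral_norm_E6 ((Ioo ρ (2 * ρ)).indicator fun y => g y ^ 2)
  have h1 : ∀ y : ℝ, y ^ 5 * (Ioo ρ (2 * ρ)).indicator (fun y => g y ^ 2) y =
      (Ioo ρ (2 * ρ)).indicator (fun y => y ^ 5 * g y ^ 2) y := fun y => by
    by_cases hy : y ∈ Ioo ρ (2 * ρ) <;> simp [hy]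
  have hsub : Ioi 0 ∩ Ioo ρ (2 * ρ) = Ioo ρ (2 * ρ) :=
    inter_eq_right.2 fun y hy => hρ.trans hy.1
  simp only [h1] at h
  rw [setIntegral_indicator measurableSet_Ioo, hsub] at h
  exact h

lemma annulusEnergy_le_integral {g : ℝ → ℝ} {ρ : ℝ} (hρ : 0 < ρ)
    (hg : IntegrableOn (fun y => y ^ 5 * g y ^ 2) (Ioi 0)) :
    annulusEnergy g ρ ≤ ∫ x : E6, g ‖x‖ ^ 2 := by
  rw [integral_norm_E6 fun y => g y ^ 2, annulusEnergy]
  refine mul_le_mul_of_nonneg_left ?_ sphereArea_pos.le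
  refine setIntegral_mono_set hg ?_ (Eventually.of_forall fun y hy => hρ.trans hy.1)
  filter_upwards [ae_restrict_mem measurableSet_Ioi] with y hy
  have : (0 : ℝ) < y := hy
  positivity

section weight

variable {J : ℕ} {lam : Fin J → ℝ}

lemma logWeight_le (j : Fin J) (s : ℝ) :
    logWeight lam s ≤ Real.sqrt (1 + Real.log (s / lam j) ^ 2) :=
  ciInf_le (finite_range _).bddBelow j

lemma one_le_logWeight (hJ : 0 < J) (s : ℝ) : 1 ≤ logWeight lam s := by
  have : Nonempty (Fin J) := ⟨⟨0, hJ⟩⟩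
  exact le_ciInf fun j => Real.one_le_sqrt.2 (by nlinarith [sq_nonneg (Real.log (s / lam j))])

lemma logWeight_le_mul (hJ : 0 < J) (hlam : ∀ j, 0 < lam j) {s R : ℝ} (hs : 0 < s) (hR : 0 < R) :
    logWeight lam s ≤ (1 + |Real.log (s / R)|) * logWeight lam R := by
  have : Nonempty (Fin J) := ⟨⟨0, hJ⟩⟩
  obtain ⟨j, hj⟩ := exists_eq_ciInf_of_finite
    (f := fun j => Real.sqrt (1 + Real.log (R / lam j) ^ 2))
  refine (logWeight_le j s).trans ?_
  rw [logWeight, ← hj]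
  have hlog : Real.log (s / lam j) = Real.log (s / R) + Real.log (R / lam j) := by
    rw [Real.log_div hs.ne' (hlam j).ne', Real.log_div hs.ne' hR.ne',
      Real.log_div hR.ne' (hlam j).ne']
    ring
  rw [hlog]
  set t := Real.log (s / R)
  set l := Real.log (R / lam j)
  rw [Real.sqrt_le_left (by positivity), mul_pow, Real.sq_sqrt (by positivity)]
  have h1 : t * l ≤ |t| * |l| := by rw [← abs_mul]; exact le_abs_self _
  have h2 : |l| ≤ 1 + l ^ 2 := by rw [← sq_abs l]; nlinarith [sq_nonneg (|l| - 1)]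
  have h3 := mul_le_mul_of_nonneg_left h2 (abs_nonneg t)
  have h4 : |t| ^ 2 = t ^ 2 := sq_abs t
  nlinarith [mul_nonneg (sq_nonneg t) (sq_nonneg l)]

lemma logWeight_le_two_mul (hJ : 0 < J) (hlam : ∀ j, 0 < lam j) {s ρ : ℝ} (hρ : 0 < ρ)
    (h1 : ρ ≤ s) (h2 : s ≤ 2 * ρ) : logWeight lam s ≤ 2 * logWeight lam ρ := by
  have hs := hρ.trans_le h1
  refine (logWeight_le_mul hJ hlam hs hρ).trans
    (mul_le_mul_of_nonneg_right ?_ (zero_le_one.trans (one_le_logWeight hJ ρ)))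
  have h0 : 0 ≤ Real.log (s / ρ) := Real.log_nonneg ((one_le_div hρ).2 h1)
  have h3 := Real.log_le_sub_one_of_pos (div_pos hs hρ)
  have h4 : s / ρ ≤ 2 := (div_le_iff₀ hρ).2 h2
  rw [abs_of_nonneg h0]
  linarith

lemma logWeight_le_one_add_abs_iInf (hJ : 0 < J) (s : ℝ) :
    logWeight lam s ≤ 1 + |⨅ j, Real.log (s / lam j)| := by
  have : Nonempty (Fin J) := ⟨⟨0, hJ⟩⟩
  obtain ⟨j, hj⟩ := exists_eq_ciInf_of_finite (f := fun j => Real.log (s / lam j))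
  rw [← hj]
  refine (logWeight_le j s).trans ?_
  rw [Real.sqrt_le_left (by positivity)]
  nlinarith [abs_nonneg (Real.log (s / lam j)), sq_abs (Real.log (s / lam j))]

lemma ZlamR_le {g : ℝ → ℝ} {B : ℝ≥0∞}
    (h : ∀ ρ, 0 < ρ → ENNReal.ofReal ((logWeight lam ρ)⁻¹ * Real.sqrt (annulusEnergy g ρ)) ≤ B) :
    ZlamR lam g ≤ B :=
  iSup_le fun R => by
    rw [integral_annulus_E6 g R.2]
    exact h R.1 R.2

/-- To bound by a multiple of the `Z` norm of `g`, one may argue with a real bound for all the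
annular energies of `g`. -/
lemma ofReal_le_mul_ZlamR (hJ : 0 < J) {g : ℝ → ℝ} {X c : ℝ} (hc : 0 < c)
    (h : ∀ N : ℝ, 0 ≤ N → (∀ ρ, 0 < ρ → annulusEnergy g ρ ≤ (logWeight lam ρ * N) ^ 2) →
      X ≤ c * N) :
    ENNReal.ofReal X ≤ ENNReal.ofReal c * ZlamR lam g := by
  by_cases htop : ZlamR lam g = ⊤
  · rw [htop, ENNReal.mul_top (by simpa using hc)]
    exact le_top
  rw [← ENNReal.ofReal_toReal htop, ← ENNReal.ofReal_mul hc.le]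
  refine ENNReal.ofReal_le_ofReal (h _ ENNReal.toReal_nonneg fun ρ hρ => ?_)
  have hw : 0 < logWeight lam ρ := zero_lt_one.trans_le (one_le_logWeight hJ ρ)
  have h1 : ENNReal.ofReal ((logWeight lam ρ)⁻¹ * Real.sqrt (annulusEnergy g ρ)) ≤
      ZlamR lam g := by
    rw [← integral_annulus_E6 g hρ]
    exact le_iSup (fun R : {R : ℝ // 0 < R} => ENNReal.ofReal
      ((⨅ j, Real.sqrt (1 + Real.log (R.1 / lam j) ^ 2))⁻¹ *
        Real.sqrt (∫ x in {x : E6 | R.1 < ‖x‖ ∧ ‖x‖ < 2 * R.1}, g ‖x‖ ^ 2))) ⟨ρ, hρ⟩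
  have h2 := (ENNReal.ofReal_le_iff_le_toReal htop).1 h1
  rw [inv_mul_le_iff₀ hw] at h2
  exact (Real.sqrt_le_left (by positivity)).1 h2

lemma ZlamR_le_mul_ZlamR (hJ : 0 < J) {g h : ℝ → ℝ} {c : ℝ} (hc : 0 < c)
    (H : ∀ N : ℝ, 0 ≤ N → (∀ ρ, 0 < ρ → annulusEnergy g ρ ≤ (logWeight lam ρ * N) ^ 2) →
      ∀ ρ, 0 < ρ → annulusEnergy h ρ ≤ (c * (logWeight lam ρ * N)) ^ 2) :
    ZlamR lam h ≤ ENNReal.ofReal c * ZlamR lam g := by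
  refine ZlamR_le fun ρ hρ => ofReal_le_mul_ZlamR hJ hc fun N hN hg => ?_
  have hw : 0 < logWeight lam ρ := zero_lt_one.trans_le (one_le_logWeight hJ ρ)
  rw [inv_mul_le_iff₀ hw]
  refine (Real.sqrt_le_sqrt (H N hN hg ρ hρ)).trans ?_
  rw [Real.sqrt_sq (by positivity)]
  exact le_of_eq (by ring)

/-- The fundamental theorem of calculus and Cauchy-Schwarz on a dyadic interval. -/
lemma sq_sub_le_annulusEnergy {f : ℝ → ℝ} (hf : ContDiffOn ℝ 1 f (Ioi 0)) {ρ : ℝ} (hρ : 0 < ρ) :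
    sphereArea * (f (2 * ρ) - f ρ) ^ 2 ≤ (ρ ^ 4)⁻¹ * annulusEnergy (deriv f) ρ := by
  have hcont : ContinuousOn (deriv f) (Ioi 0) :=
    hf.continuousOn_deriv_of_isOpen isOpen_Ioi le_rfl
  have hle : ρ ≤ 2 * ρ := by linarith
  have hsub : uIcc ρ (2 * ρ) ⊆ Ioi 0 := by
    rw [uIcc_of_le hle]
    exact fun y hy => hρ.trans_le hy.1
  have hc := hcont.mono hsub
  have hi : IntervalIntegrable (deriv f) volume ρ (2 * ρ) := hc.intervalIntegrable
  have hi2 : IntervalIntegrable (fun y => deriv f y ^ 2) volume ρ (2 * ρ) :=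
    (hc.pow 2).intervalIntegrable
  have hi5 : IntervalIntegrable (fun y => y ^ 5 * deriv f y ^ 2) volume ρ (2 * ρ) :=
    (((continuous_pow 5).continuousOn).mul (hc.pow 2)).intervalIntegrable
  have hftc : ∫ y in ρ..(2 * ρ), deriv f y = f (2 * ρ) - f ρ :=
    intervalIntegral.integral_eq_sub_of_hasDerivAt (fun y hy =>
      (((hf.differentiableOn one_ne_zero) y (hsub hy)).differentiableAt
        (isOpen_Ioi.mem_nhds (hsub hy))).hasDerivAt) hi
  set D := f (2 * ρ) - f ρ
  have hcs : D ^ 2 ≤ ρ * ∫ y in ρ..(2 * ρ), deriv f y ^ 2 := by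
    have h0 : 0 ≤ ∫ y in ρ..(2 * ρ), (deriv f y - D / ρ) ^ 2 :=
      intervalIntegral.integral_nonneg hle fun y _ => sq_nonneg _
    have h1 : ∫ y in ρ..(2 * ρ), (deriv f y - D / ρ) ^ 2 =
        (∫ y in ρ..(2 * ρ), deriv f y ^ 2) - D ^ 2 / ρ := by
      have h2 : (fun y => (deriv f y - D / ρ) ^ 2) =
          fun y => (deriv f y ^ 2 - 2 * (D / ρ) * deriv f y) + (D / ρ) ^ 2 := by
        funext y; ring
      rw [h2, intervalIntegral.integral_add (hi2.sub (hi.const_mul _)) (by simp),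
        intervalIntegral.integral_sub hi2 (hi.const_mul _), intervalIntegral.integral_const_mul,
        hftc, intervalIntegral.integral_const, smul_eq_mul]
      field_simp
      ring
    rw [h1, sub_nonneg, div_le_iff₀ hρ] at h0
    linarith
  have hmono : ρ ^ 5 * ∫ y in ρ..(2 * ρ), deriv f y ^ 2 ≤
      ∫ y in ρ..(2 * ρ), y ^ 5 * deriv f y ^ 2 := by
    rw [← intervalIntegral.integral_const_mul]
    refine intervalIntegral.integral_mono_on hle (hi2.const_mul _) hi5 fun y hy => ?_
    have := hy.1
    gcongr
  have hE : annulusEnergy (deriv f) ρ =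
      sphereArea * ∫ y in ρ..(2 * ρ), y ^ 5 * deriv f y ^ 2 := by
    rw [annulusEnergy, intervalIntegral.integral_of_le hle, integral_Ioc_eq_integral_Ioo]
  rw [hE, mul_left_comm]
  refine mul_le_mul_of_nonneg_left ?_ sphereArea_pos.le
  rw [← div_eq_inv_mul, le_div_iff₀ (by positivity)]
  calc D ^ 2 * ρ ^ 4 ≤ (ρ * ∫ y in ρ..(2 * ρ), deriv f y ^ 2) * ρ ^ 4 := by gcongr
    _ = ρ ^ 5 * ∫ y in ρ..(2 * ρ), deriv f y ^ 2 := by ring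
    _ ≤ _ := hmono

lemma annulusEnergy_congr {g h : ℝ → ℝ} {ρ : ℝ} (H : ∀ s ∈ Ioo ρ (2 * ρ), g s = h s) :
    annulusEnergy g ρ = annulusEnergy h ρ := by
  rw [annulusEnergy, annulusEnergy,
    setIntegral_congr_fun (g := fun y => y ^ 5 * h y ^ 2) measurableSet_Ioo
      fun s hs => by simp only [H s hs]]

/-- The pointwise bound, in terms of the derivative on `[r, ∞)` only. -/
lemma abs_le_of_annulusEnergy_le (hJ : 0 < J) (hlam : ∀ j, 0 < lam j) {f g : ℝ → ℝ}
    (hf : ContDiffOn ℝ 1 f (Ioi 0)) (hlim : Tendsto f atTop (𝓝 0)) {r N : ℝ} (hr : 0 < r)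
    (hN : 0 ≤ N) (hg : ∀ s, r ≤ s → g s = deriv f s)
    (H : ∀ ρ, 0 < ρ → annulusEnergy g ρ ≤ (logWeight lam ρ * N) ^ 2) :
    |f r| ≤ 2 / Real.sqrt sphereArea * (r ^ 2)⁻¹ * (logWeight lam r * N) := by
  have hκ := Real.sqrt_pos.2 sphereArea_pos
  have hw : ∀ s, 0 < logWeight lam s := fun s => zero_lt_one.trans_le (one_le_logWeight hJ s)
  set K := (Real.sqrt sphereArea)⁻¹ * (r ^ 2)⁻¹ * (logWeight lam r * N) with hK
  have hK0 : 0 ≤ K := by have := hw r; positivity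
  have hstep : ∀ ρ, r ≤ ρ →
      |f (2 * ρ) - f ρ| ≤ (Real.sqrt sphereArea)⁻¹ * (ρ ^ 2)⁻¹ * (logWeight lam ρ * N) := by
    intro ρ hρ
    have hρ0 := hr.trans_le hρ
    have hwρ := hw ρ
    have h1 := sq_sub_le_annulusEnergy hf hρ0
    rw [← annulusEnergy_congr fun s hs => hg s (hρ.trans hs.1.le)] at h1
    have h2 := h1.trans (mul_le_mul_of_nonneg_left (H ρ hρ0) (by positivity))
    refine abs_le_of_sq_le_sq ?_ (by positivity)
    rw [mul_pow, mul_pow, inv_pow, Real.sq_sqrt sphereArea_pos.le, mul_assoc,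
      ← div_eq_inv_mul, le_div_iff₀ sphereArea_pos, mul_comm]
    refine h2.trans (le_of_eq ?_)
    ring
  have hwk : ∀ k : ℕ, logWeight lam (2 ^ k * r) ≤ 2 ^ k * logWeight lam r := by
    intro k
    induction k with
    | zero => simp
    | succ k ih =>
      have hp : 0 < 2 ^ k * r := by positivity
      have h1 := logWeight_le_two_mul (lam := lam) (s := 2 ^ (k + 1) * r) hJ hlam hp
        (by rw [pow_succ]; linarith) (by rw [pow_succ]; linarith)
      refine h1.trans ?_
      rw [pow_succ]
      linarith
  have hsum : ∀ k : ℕ, |f r - f (2 ^ k * r)| ≤ K * (2 - 2 / 2 ^ k) := by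
    intro k
    induction k with
    | zero => simp
    | succ k ih =>
      have h1 := hstep (2 ^ k * r) (le_mul_of_one_le_left hr.le (one_le_pow₀ one_le_two))
      have h2 : (Real.sqrt sphereArea)⁻¹ * ((2 ^ k * r) ^ 2)⁻¹ * (logWeight lam (2 ^ k * r) * N) ≤
          (Real.sqrt sphereArea)⁻¹ * ((2 ^ k * r) ^ 2)⁻¹ * (2 ^ k * logWeight lam r * N) := by
        have := hwk k
        gcongr
      have h3 : (Real.sqrt sphereArea)⁻¹ * ((2 ^ k * r) ^ 2)⁻¹ * (2 ^ k * logWeight lam r * N) =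
          K / 2 ^ k := by
        rw [hK]
        field_simp
      have h4 : (2 : ℝ) ^ (k + 1) * r = 2 * (2 ^ k * r) := by ring
      have h5 : K * (2 - 2 / 2 ^ (k + 1)) = K * (2 - 2 / 2 ^ k) + K / 2 ^ k := by
        field_simp
        ring
      rw [h4, h5]
      calc |f r - f (2 * (2 ^ k * r))|
          ≤ |f r - f (2 ^ k * r)| + |f (2 ^ k * r) - f (2 * (2 ^ k * r))| := abs_sub_le _ _ _
        _ ≤ _ := by rw [abs_sub_comm (f (2 ^ k * r))]; linarith
  have hlim' : Tendsto (fun k : ℕ => |f r - f (2 ^ k * r)|) atTop (𝓝 |f r - 0|) :=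
    (tendsto_const_nhds.sub (hlim.comp
      ((tendsto_pow_atTop_atTop_of_one_lt (one_lt_two (α := ℝ))).atTop_mul_const hr))).abs
  rw [sub_zero] at hlim'
  refine le_of_tendsto' hlim' fun k => (hsum k).trans ?_
  have : (0 : ℝ) ≤ 2 / 2 ^ k := by positivity
  calc K * (2 - 2 / 2 ^ k) ≤ K * 2 := by gcongr; linarith
    _ = _ := by rw [hK]; ring

/-- An annular energy bound passes from `g` to every `h` dominated by `g` and by the size of
the pointwise bound divided by the radius. -/
lemma annulusEnergy_le_of_abs_le (hJ : 0 < J) (hlam : ∀ j, 0 < lam j) {g h : ℝ → ℝ}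
    {M N ρ : ℝ} (hM : 0 ≤ M) (hN : 0 ≤ N) (hρ : 0 < ρ)
    (hg : IntegrableOn (fun y => y ^ 5 * g y ^ 2) (Ioi 0))
    (hE : annulusEnergy g ρ ≤ (logWeight lam ρ * N) ^ 2)
    (hh : ∀ s ∈ Ioo ρ (2 * ρ),
      |h s| ≤ M * (2 / Real.sqrt sphereArea * (s ^ 3)⁻¹ * (logWeight lam s * N) + |g s|)) :
    annulusEnergy h ρ ≤ (33 * M * (logWeight lam ρ * N)) ^ 2 := by
  have hκ := Real.sqrt_pos.2 sphereArea_pos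
  have hκ2 := Real.sq_sqrt sphereArea_pos.le
  have hκ0 := sphereArea_pos
  have hw : ∀ s, 0 < logWeight lam s := fun s => zero_lt_one.trans_le (one_le_logWeight hJ s)
  have hwρ := hw ρ
  obtain ⟨W, hW⟩ : ∃ W, W = logWeight lam ρ * N := ⟨_, rfl⟩
  rw [← hW] at hE ⊢
  have hW0 : 0 ≤ W := by rw [hW]; positivity
  have hpt : ∀ y ∈ Ioo ρ (2 * ρ), y ^ 5 * h y ^ 2 ≤
      2 * M ^ 2 * (512 * W ^ 2 / (sphereArea * ρ) + y ^ 5 * g y ^ 2) := by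
    intro y hy
    have hy0 : 0 < y := hρ.trans hy.1
    have h1 : |h y| ≤ M * (4 / Real.sqrt sphereArea * (ρ ^ 3)⁻¹ * W + |g y|) := by
      refine (hh y hy).trans (mul_le_mul_of_nonneg_left (add_le_add_left ?_ _) hM)
      calc 2 / Real.sqrt sphereArea * (y ^ 3)⁻¹ * (logWeight lam y * N)
          ≤ 2 / Real.sqrt sphereArea * (ρ ^ 3)⁻¹ * (2 * logWeight lam ρ * N) := by
            have h2 := logWeight_le_two_mul hJ hlam hρ hy.1.le hy.2.le
            have h3 := hy.1.le
            have h4 := hw y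
            gcongr
        _ = _ := by rw [hW]; ring
    have h2 : h y ^ 2 ≤ 2 * M ^ 2 * (16 * W ^ 2 / (sphereArea * ρ ^ 6) + g y ^ 2) := by
      rw [← sq_abs (h y), ← sq_abs (g y)]
      refine (pow_le_pow_left₀ (abs_nonneg _) h1 2).trans ?_
      have h3 : 16 * W ^ 2 / (sphereArea * ρ ^ 6) =
          (4 / Real.sqrt sphereArea * (ρ ^ 3)⁻¹ * W) ^ 2 := by
        rw [mul_pow, mul_pow, div_pow, hκ2]
        field_simp
        ring
      rw [h3, mul_pow M, mul_comm 2 (M ^ 2), mul_assoc (M ^ 2) 2]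
      refine mul_le_mul_of_nonneg_left ?_ (sq_nonneg M)
      exact add_sq_le
    calc y ^ 5 * h y ^ 2
        ≤ y ^ 5 * (2 * M ^ 2 * (16 * W ^ 2 / (sphereArea * ρ ^ 6) + g y ^ 2)) := by gcongr
      _ = 2 * M ^ 2 * (y ^ 5 * (16 * W ^ 2 / (sphereArea * ρ ^ 6)) + y ^ 5 * g y ^ 2) := by ring
      _ ≤ 2 * M ^ 2 * ((2 * ρ) ^ 5 * (16 * W ^ 2 / (sphereArea * ρ ^ 6)) + y ^ 5 * g y ^ 2) := by
          have := hy.2.le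
          gcongr
      _ = _ := by
          congr 2
          field_simp
          ring
  have hgi := hg.mono_set (fun y (hy : y ∈ Ioo ρ (2 * ρ)) => hρ.trans hy.1)
  have hci : IntegrableOn (fun _ => 512 * W ^ 2 / (sphereArea * ρ)) (Ioo ρ (2 * ρ)) :=
    integrableOn_const measure_Ioo_lt_top.ne
  have hint : ∫ y in Ioo ρ (2 * ρ), y ^ 5 * h y ^ 2 ≤ ∫ y in Ioo ρ (2 * ρ),
      2 * M ^ 2 * (512 * W ^ 2 / (sphereArea * ρ) + y ^ 5 * g y ^ 2) := by
    refine integral_mono_of_nonneg ?_ ((hci.add hgi).const_mul _) ?_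
    · filter_upwards [ae_restrict_mem measurableSet_Ioo] with y hy
      have : 0 < y := hρ.trans hy.1
      positivity
    · filter_upwards [ae_restrict_mem measurableSet_Ioo] with y hy using hpt y hy
  have hval : ∫ y in Ioo ρ (2 * ρ),
      2 * M ^ 2 * (512 * W ^ 2 / (sphereArea * ρ) + y ^ 5 * g y ^ 2) =
      2 * M ^ 2 * (512 * W ^ 2 / sphereArea + ∫ y in Ioo ρ (2 * ρ), y ^ 5 * g y ^ 2) := by
    rw [integral_const_mul, integral_add hci hgi, setIntegral_const, Real.volume_real_Ioo_of_le
      (by linarith), smul_eq_mul]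
    congr 2
    field_simp
    ring
  rw [hval] at hint
  calc annulusEnergy h ρ ≤ sphereArea * (2 * M ^ 2 *
        (512 * W ^ 2 / sphereArea + ∫ y in Ioo ρ (2 * ρ), y ^ 5 * g y ^ 2)) :=
        mul_le_mul_of_nonneg_left hint hκ0.le
    _ = 2 * M ^ 2 * (512 * W ^ 2 + annulusEnergy g ρ) := by
        rw [annulusEnergy]
        field_simp
    _ ≤ 2 * M ^ 2 * (512 * W ^ 2 + W ^ 2) := by gcongr
    _ ≤ (33 * M * W) ^ 2 := by nlinarith [sq_nonneg (M * W)]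

end weight

/-- A function supported in `[c, 2ⁿ c]` has its energy controlled by the `n` dyadic annuli. -/
lemma integral_sq_le_of_annulusEnergy_le {h : ℝ → ℝ} (hh : ContinuousOn h (Ioi 0)) {c Y : ℝ}
    (hc : 0 < c) (n : ℕ) (hz : ∀ s, 0 < s → s < c ∨ 2 ^ n * c < s → h s = 0)
    (hE : ∀ k < n, annulusEnergy h (2 ^ k * c) ≤ Y ^ 2) :
    ∫ x : E6, h ‖x‖ ^ 2 ≤ n * Y ^ 2 := by
  have hle : c ≤ 2 ^ n * c := le_mul_of_one_le_left hc.le (one_le_pow₀ one_le_two)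
  have h1 : ∫ y in Ioi (0 : ℝ), y ^ 5 * h y ^ 2 = ∫ y in c..(2 ^ n * c), y ^ 5 * h y ^ 2 := by
    rw [intervalIntegral.integral_of_le hle, ← integral_Icc_eq_integral_Ioc]
    have hsub : Icc c (2 ^ n * c) ⊆ Ioi 0 := fun y hy => hc.trans_le hy.1
    have hzero : ∀ y ∈ Ioi 0 \ Icc c (2 ^ n * c), y ^ 5 * h y ^ 2 = 0 := fun y hy => by
      have h2 : h y = 0 := by
        refine hz y hy.1 ?_
        by_contra! hcon
        exact hy.2 ⟨hcon.1, hcon.2⟩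
      simp [h2]
    exact setIntegral_eq_of_subset_of_forall_sdiff_eq_zero measurableSet_Ioi hsub hzero
  have h2 : ∫ y in c..(2 ^ n * c), y ^ 5 * h y ^ 2 =
      ∑ k ∈ Finset.range n, ∫ y in (2 ^ k * c)..(2 ^ (k + 1) * c), y ^ 5 * h y ^ 2 := by
    rw [intervalIntegral.sum_integral_adjacent_intervals (a := fun k => 2 ^ k * c)]
    · simp
    · intro k _
      refine (((continuous_pow 5).continuousOn).mul
        ((hh.mono fun y hy => ?_).pow 2)).intervalIntegrable
      exact (lt_min (by positivity) (by positivity)).trans_le hy.1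
  rw [integral_norm_E6 fun y => h y ^ 2, h1, h2, Finset.mul_sum]
  calc _ ≤ ∑ _k ∈ Finset.range n, Y ^ 2 := by
        refine Finset.sum_le_sum fun k hk => ?_
        have hle' : 2 ^ k * c ≤ 2 * (2 ^ k * c) := by
          have : 0 < 2 ^ k * c := by positivity
          linarith
        have h3 := hE k (Finset.mem_range.1 hk)
        rwa [annulusEnergy, ← integral_Ioc_eq_integral_Ioo,
          ← intervalIntegral.integral_of_le hle', ← mul_assoc, ← pow_succ'] at h3
    _ = _ := by simp

/-- A smooth cutoff which is constant near infinity is bounded, and so is `t φ'(t)`. -/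
lemma exists_cutoff_bound {φ : ℝ → ℝ} (hφ : ContDiff ℝ 1 φ) {b c : ℝ}
    (hb : ∀ t, b < t → φ t = c) :
    ∃ M, 0 < M ∧ ∀ t, 0 < t → |φ t| ≤ M ∧ |t * deriv φ t| ≤ M := by
  have hd : Continuous (deriv φ) := hφ.continuous_deriv le_rfl
  obtain ⟨M₁, hM₁⟩ := (isCompact_Icc (a := 0) (b := b)).exists_bound_of_continuousOn
    hφ.continuous.continuousOn
  obtain ⟨M₂, hM₂⟩ := (isCompact_Icc (a := 0) (b := b)).exists_bound_of_continuousOn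
    (continuous_id.mul hd).continuousOn
  refine ⟨|M₁| + |M₂| + |c| + 1, by positivity, fun t ht => ?_⟩
  have p1 := abs_nonneg M₁
  have p2 := abs_nonneg M₂
  have p3 := abs_nonneg c
  rcases le_or_gt t b with h | h
  · have q1 : |φ t| ≤ M₁ := hM₁ t ⟨ht.le, h⟩
    have q2 : |t * deriv φ t| ≤ M₂ := hM₂ t ⟨ht.le, h⟩
    have := le_abs_self M₁
    have := le_abs_self M₂
    constructor <;> linarith
  · have h0 : deriv φ t = 0 := by
      have : φ =ᶠ[𝓝 t] fun _ => c := by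
        filter_upwards [lt_mem_nhds h] with u hu using hb u hu
      rw [this.deriv_eq, deriv_const]
    rw [h0, hb t h, mul_zero, abs_zero]
    constructor <;> linarith

lemma abs_deriv_cutoff_mul_le {φ f : ℝ → ℝ} (hφ : ContDiff ℝ 1 φ)
    (hf : ContDiffOn ℝ 1 f (Ioi 0)) {M R s : ℝ} (hR : 0 < R) (hs : 0 < s)
    (hM : ∀ t, 0 < t → |φ t| ≤ M ∧ |t * deriv φ t| ≤ M) :
    |deriv (fun s => φ (s / R) * f s) s| ≤ M * (|f s| / s + |deriv f s|) := by
  have h1 : HasDerivAt f (deriv f s) s :=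
    ((hf.differentiableOn one_ne_zero s hs).differentiableAt (isOpen_Ioi.mem_nhds hs)).hasDerivAt
  have h2 : HasDerivAt (fun s => φ (s / R)) (deriv φ (s / R) * (1 / R)) s :=
    ((hφ.differentiable one_ne_zero (s / R)).hasDerivAt).comp s ((hasDerivAt_id s).div_const R)
  have h3 : deriv φ (s / R) * (1 / R) * f s = s / R * deriv φ (s / R) * (f s / s) := by
    field_simp
  obtain ⟨h4, h5⟩ := hM (s / R) (div_pos hs hR)
  rw [(h2.fun_mul h1).deriv, h3, mul_add]
  refine (abs_add_le _ _).trans ?_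
  rw [abs_mul _ (f s / s), abs_mul _ (deriv f s), abs_div, abs_of_pos hs]
  gcongr

lemma deriv_eq_zero_of_eventually_eq_zero {h : ℝ → ℝ} {s : ℝ} (H : ∀ᶠ t in 𝓝 s, h t = 0) :
    deriv h s = 0 := by
  have H' : h =ᶠ[𝓝 s] fun _ => 0 := H
  rw [H'.deriv_eq, deriv_const]

/-- Properties of the `Z_{-3,λ}` norm for radial `Ḣ¹` functions on `ℝ⁶`: the `Ḣ¹` embedding
(with constant 1), the pointwise bound (with a universal constant), and the cutoff
estimates (with a constant depending only on the cutoffs). Radial functions are identified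
with their profiles, so that `|∇f| = |f'(|x|)|`. -/
theorem stmt13 :
    ∃ C2 : ℝ, 0 < C2 ∧
      ∀ χ0 χ1 : ℝ → ℝ,
        ContDiff ℝ (⊤ : ℕ∞) χ0 → (∀ r : ℝ, r ≤ 1 → χ0 r = 1) → (∀ r : ℝ, 2 ≤ r → χ0 r = 0) →
        ContDiff ℝ (⊤ : ℕ∞) χ1 → (∃ a b : ℝ, 0 < a ∧ ∀ r : ℝ, r < a ∨ b < r → χ1 r = 0) →
        ∃ C3 : ℝ, 0 < C3 ∧
          ∀ (J : ℕ), 0 < J → ∀ lam : Fin J → ℝ, (∀ j, 0 < lam j) → StrictAnti lam →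
            ∀ f : ℝ → ℝ, ContDiffOn ℝ 1 f (Ioi 0) →
              IntegrableOn (fun r => deriv f r ^ 2 * r ^ 5) (Ioi 0) →
              Tendsto f atTop (𝓝 0) →
              (ZlamR lam (deriv f) ≤
                ENNReal.ofReal (Real.sqrt (∫ x : E6, deriv f ‖x‖ ^ 2))) ∧
              (∀ r : ℝ, 0 < r →
                ENNReal.ofReal |f r| ≤
                  ENNReal.ofReal (C2 * (r ^ 2)⁻¹ * (1 + |⨅ j, Real.log (r / lam j)|)) *
                    ZlamR lam (deriv f)) ∧
              ∀ R : ℝ, 0 < R →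
                (ENNReal.ofReal
                    (Real.sqrt (∫ x : E6, deriv (fun s => χ1 (s / R) * f s) ‖x‖ ^ 2)) ≤
                  ENNReal.ofReal (C3 * (1 + |⨅ j, Real.log (R / lam j)|)) *
                    ZlamR lam (deriv f)) ∧
                (ZlamR lam (deriv (fun s => χ0 (s / R) * f s)) ≤
                  ENNReal.ofReal C3 * ZlamR lam (deriv f)) ∧
                (ZlamR lam (deriv (fun s => (1 - χ0 (s / R)) * f s)) ≤
                  ENNReal.ofReal C3 * ZlamR lam (indicator (Ici R) (deriv f))) := by
  have hκ := Real.sqrt_pos.2 sphereArea_pos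
  refine ⟨2 / Real.sqrt sphereArea, by positivity, ?_⟩
  intro χ0 χ1 hχ0 hχ0one hχ0zero hχ1 ⟨a, b, ha, hχ1zero⟩
  have hc0 : ContDiff ℝ 1 χ0 := hχ0.of_le (by exact_mod_cast le_top)
  have hc1 : ContDiff ℝ 1 χ1 := hχ1.of_le (by exact_mod_cast le_top)
  have hc2 : ContDiff ℝ 1 fun t => 1 - χ0 t := contDiff_const.sub hc0
  obtain ⟨M0, hM0, hM0b⟩ := exists_cutoff_bound hc0 (b := 2) (c := 0) fun t ht => hχ0zero t ht.le
  obtain ⟨M1, hM1, hM1b⟩ := exists_cutoff_bound hc1 (b := b) (c := 0)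
    fun t ht => hχ1zero t (Or.inr ht)
  obtain ⟨M2, hM2, hM2b⟩ := exists_cutoff_bound hc2 (b := 2) (c := 1)
    fun t ht => by rw [hχ0zero t ht.le, sub_zero]
  obtain ⟨n, hn⟩ := pow_unbounded_of_one_lt (b / a) (one_lt_two (α := ℝ))
  rw [div_lt_iff₀ ha] at hn
  set K := 1 + (n + |Real.log a|) with hK
  have hK0 : 0 < K := by positivity
  set D := (n + 1) * (33 * M1 * K) with hD
  have hD0 : 0 < D := by positivity
  refine ⟨D + 33 * M0 + 33 * M2, by positivity, ?_⟩
  intro J hJ lam hlam _ f hf hint hlim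
  have hw : ∀ s, 0 < logWeight lam s := fun s => zero_lt_one.trans_le (one_le_logWeight hJ s)
  have hint' : IntegrableOn (fun y => y ^ 5 * deriv f y ^ 2) (Ioi 0) := by
    simpa only [mul_comm] using hint
  have hpoint : ∀ N : ℝ, 0 ≤ N →
      (∀ ρ, 0 < ρ → annulusEnergy (deriv f) ρ ≤ (logWeight lam ρ * N) ^ 2) → ∀ r, 0 < r →
      |f r| ≤ 2 / Real.sqrt sphereArea * (r ^ 2)⁻¹ * (logWeight lam r * N) :=
    fun N hN H r hr => abs_le_of_annulusEnergy_le hJ hlam hf hlim hr hN (fun _ _ => rfl) H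
  have hdiv : ∀ s N : ℝ, 0 < s →
      |f s| ≤ 2 / Real.sqrt sphereArea * (s ^ 2)⁻¹ * (logWeight lam s * N) →
      |f s| / s ≤ 2 / Real.sqrt sphereArea * (s ^ 3)⁻¹ * (logWeight lam s * N) := by
    intro s N hs h
    rw [div_le_iff₀ hs]
    refine h.trans (le_of_eq ?_)
    field_simp
  have hcut : ∀ (φ : ℝ → ℝ) (M R N : ℝ), ContDiff ℝ 1 φ → 0 < M →
      (∀ t, 0 < t → |φ t| ≤ M ∧ |t * deriv φ t| ≤ M) → 0 < R → 0 ≤ N →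
      (∀ ρ, 0 < ρ → annulusEnergy (deriv f) ρ ≤ (logWeight lam ρ * N) ^ 2) → ∀ ρ, 0 < ρ →
      annulusEnergy (deriv fun s => φ (s / R) * f s) ρ ≤
        (33 * M * (logWeight lam ρ * N)) ^ 2 := by
    intro φ M R N hφ hM hMb hR hN H ρ hρ
    refine annulusEnergy_le_of_abs_le hJ hlam hM.le hN hρ hint' (H ρ hρ) fun s hs => ?_
    have hs0 : 0 < s := hρ.trans hs.1
    refine (abs_deriv_cutoff_mul_le hφ hf hR hs0 hMb).trans ?_
    have := hdiv s N hs0 (hpoint N hN H s hs0)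
    gcongr
  refine ⟨?_, ?_, fun R hR => ⟨?_, ?_, ?_⟩⟩
  · refine ZlamR_le fun ρ hρ => ENNReal.ofReal_le_ofReal ?_
    rw [inv_mul_le_iff₀ (hw ρ)]
    exact (Real.sqrt_le_sqrt (annulusEnergy_le_integral hρ hint')).trans
      (le_mul_of_one_le_left (Real.sqrt_nonneg _) (one_le_logWeight hJ ρ))
  · intro r hr
    refine ofReal_le_mul_ZlamR hJ (by positivity) fun N hN H => (hpoint N hN H r hr).trans ?_
    rw [mul_assoc _ (1 + _) N]
    have := logWeight_le_one_add_abs_iInf (lam := lam) hJ r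
    gcongr
  · refine ofReal_le_mul_ZlamR hJ (by positivity) fun N hN H => ?_
    have hwR := hw R
    have haR : 0 < a * R := by positivity
    have hcont : ContinuousOn (deriv fun s => χ1 (s / R) * f s) (Ioi 0) :=
      ContDiffOn.continuousOn_deriv_of_isOpen
        (((hc1.comp (contDiff_id.div_const R)).contDiffOn).mul hf) isOpen_Ioi le_rfl
    have hsupp : ∀ s, 0 < s → s < a * R ∨ 2 ^ n * (a * R) < s →
        deriv (fun s => χ1 (s / R) * f s) s = 0 := by
      intro s _ hs
      refine deriv_eq_zero_of_eventually_eq_zero ?_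
      rcases hs with hs | hs
      · filter_upwards [gt_mem_nhds hs] with t ht
        rw [hχ1zero _ (Or.inl ((div_lt_iff₀ hR).2 ht)), zero_mul]
      · have hbs : b * R < s := by nlinarith
        filter_upwards [lt_mem_nhds hbs] with t ht
        rw [hχ1zero _ (Or.inr ((lt_div_iff₀ hR).2 ht)), zero_mul]
    have hwk : ∀ k < n, logWeight lam (2 ^ k * (a * R)) ≤ K * logWeight lam R := by
      intro k hk
      refine (logWeight_le_mul hJ hlam (by positivity) hR).trans ?_
      have h1 : 2 ^ k * (a * R) / R = 2 ^ k * a := by field_simp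
      have h2 : Real.log (2 ^ k * a) = k * Real.log 2 + Real.log a := by
        rw [Real.log_mul (by positivity) ha.ne', Real.log_pow]
      have h3 : |k * Real.log 2| ≤ n := by
        rw [abs_of_nonneg (by positivity)]
        have h4 : Real.log 2 ≤ 1 := by linarith [Real.log_two_lt_d9]
        have h5 : (k : ℝ) ≤ n := by exact_mod_cast hk.le
        nlinarith [(Nat.cast_nonneg k : (0 : ℝ) ≤ k)]
      rw [h1, h2, hK]
      gcongr
      exact (abs_add_le _ _).trans (by gcongr)
    have hY := integral_sq_le_of_annulusEnergy_le hcont haR n hsupp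
      (Y := 33 * M1 * K * (logWeight lam R * N)) fun k hk => by
        refine (hcut χ1 M1 R N hc1 hM1 hM1b hR hN H _ (by positivity)).trans ?_
        have h1 := hwk k hk
        have h2 := hw (2 ^ k * (a * R))
        rw [mul_assoc (33 * M1) K, ← mul_assoc K]
        gcongr
    have hle : Real.sqrt (∫ x : E6, deriv (fun s => χ1 (s / R) * f s) ‖x‖ ^ 2) ≤
        D * (logWeight lam R * N) := by
      rw [Real.sqrt_le_left (by positivity)]
      refine hY.trans ?_
      have h1 : (n : ℝ) ≤ (n + 1) ^ 2 := by nlinarith [(Nat.cast_nonneg n : (0 : ℝ) ≤ n)]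
      calc n * (33 * M1 * K * (logWeight lam R * N)) ^ 2
          ≤ (n + 1) ^ 2 * (33 * M1 * K * (logWeight lam R * N)) ^ 2 := by gcongr
        _ = _ := by rw [hD]; ring
    refine hle.trans ?_
    rw [mul_assoc _ (1 + _) N]
    have h1 := logWeight_le_one_add_abs_iInf (lam := lam) hJ R
    have h2 : D ≤ D + 33 * M0 + 33 * M2 := by linarith
    gcongr
  · refine ZlamR_le_mul_ZlamR hJ (by positivity) fun N hN H ρ hρ =>
      (hcut χ0 M0 R N hc0 hM0 hM0b hR hN H ρ hρ).trans ?_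
    have h1 := hw ρ
    have h2 : 33 * M0 ≤ D + 33 * M0 + 33 * M2 := by linarith
    gcongr
  · refine ZlamR_le_mul_ZlamR hJ (by positivity) fun N hN H ρ hρ => ?_
    have hwρ := hw ρ
    have hgi : IntegrableOn (fun y => y ^ 5 * (Ici R).indicator (deriv f) y ^ 2) (Ioi 0) := by
      have h1 : (fun y => y ^ 5 * (Ici R).indicator (deriv f) y ^ 2) =
          (Ici R).indicator fun y => y ^ 5 * deriv f y ^ 2 := by
        funext y
        by_cases hy : y ∈ Ici R <;> simp [hy]
      rw [h1]
      exact Integrable.indicator hint' measurableSet_Ici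
    refine (annulusEnergy_le_of_abs_le hJ hlam hM2.le hN hρ hgi (H ρ hρ) fun s hs => ?_).trans
      (b := (33 * M2 * (logWeight lam ρ * N)) ^ 2) ?_
    · have hs0 : 0 < s := hρ.trans hs.1
      have hws := hw s
      rcases lt_or_ge s R with hsR | hsR
      · rw [deriv_eq_zero_of_eventually_eq_zero, abs_zero]
        · positivity
        · filter_upwards [gt_mem_nhds hsR] with t ht
          rw [hχ0one _ ((div_le_one hR).2 ht.le), sub_self, zero_mul]
      · refine (abs_deriv_cutoff_mul_le hc2 hf hR hs0 hM2b).trans ?_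
        rw [indicator_of_mem (show s ∈ Ici R from hsR)]
        have := hdiv s N hs0 (abs_le_of_annulusEnergy_le hJ hlam hf hlim hs0 hN
          (fun t ht => indicator_of_mem (show t ∈ Ici R from hsR.trans ht) _) H)
        gcongr
    · have h2 : 33 * M2 ≤ D + 33 * M0 + 33 * M2 := by linarith
      gcongr

end
end
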